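/- Let i ∈ I, set λ = Λ − β and a := ⟨h_i, λ⟩ := ⟨h_i, Λ⟩ − ⟨h_i, β⟩, and suppose a ≥ 0. Then for every graded left R^Λ(β)-module M there is an isomorphism of graded R^Λ(β)-modules q_i^{−2} F_i^Λ E_i^Λ M ⊕ (⊕_{k=0}^{a−1} q_i^{2k} M) ≅ E_i^Λ F_i^Λ M, natural in M; here E_i^Λ on modules over R^Λ(β) is N ↦ e(β−α_i,α_i) N regarded over R^Λ(β−α_i), interpreted as 0 when the coefficient of α_i in β is 0, and E_i^Λ F_i^Λ is the composite through modules over R^Λ(β+α_i). -/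

import Mathlib

/- ## Scaffold: Khovanov–Lauda–Rouquier algebras -/

open scoped TensorProduct

/-- A symmetrizable Cartan datum together with the structure constants of the
family of polynomials `Q`. -/
structure CartanDatum (k : Type) [Field k] (I : Type) [Fintype I] [DecidableEq I] : Type where
  a : I → I → ℤ
  d : I → ℤ
  t : I → I → ℕ → ℕ → k
  a_diag : ∀ i, a i i = 2
  a_nonpos : ∀ i j, i ≠ j → a i j ≤ 0
  a_zero_iff : ∀ i j, a i j = 0 ↔ a j i = 0
  d_pos : ∀ i, 0 < d i
  symmetrize : ∀ i j, d i * a i j = d j * a j i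
  t_symm : ∀ i j p q, t i j p q = t j i q p
  t_lead : ∀ i j, i ≠ j → t i j (-(a i j)).toNat 0 ≠ 0

namespace KLR

variable {k : Type} [Field k] {I : Type} [Fintype I] [DecidableEq I]

/-- The symmetric bilinear form `(α_i, α_j) = d_i a_{ij}`. -/
def B (C : CartanDatum k I) (i j : I) : ℤ := C.d i * C.a i j

/-- Generators of the KLR algebra `R(n)`. -/
inductive Gen (I : Type) (n : ℕ) : Type
  | e (ν : Fin n → I) : Gen I n
  | x (a : Fin n) : Gen I n
  | tau (l : ℕ) (h : l + 1 < n) : Gen I n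

variable (k) in
/-- The free algebra on the generators. -/
abbrev FA (I : Type) (n : ℕ) : Type := FreeAlgebra k (Gen I n)

variable (k) in
def ge {n : ℕ} (ν : Fin n → I) : FA k I n := FreeAlgebra.ι k (Gen.e ν)

variable (k) in
def gx {n : ℕ} (a : Fin n) : FA k I n := FreeAlgebra.ι k (Gen.x a)

variable (k) in
def gt {n : ℕ} (l : ℕ) (h : l + 1 < n) : FA k I n := FreeAlgebra.ι k (Gen.tau l h)

/-- The polynomial `Q_{ij}(u,v)` evaluated on two elements of an algebra. -/
def Qel (C : CartanDatum k I) {A : Type} [Ring A] [Algebra k A] (i j : I) (u v : A) : A :=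
  if i = j then 0 else
    ∑ p ∈ Finset.range ((-(C.a i j)).toNat + 1), ∑ q ∈ Finset.range ((-(C.a j i)).toNat + 1),
      if C.d i * (p : ℤ) + C.d j * (q : ℤ) = -(C.d i * C.a i j) then
        C.t i j p q • (u ^ p * v ^ q) else 0

/-- The divided difference `(Q_{ij}(u,v) - Q_{ij}(w,v))/(u - w)` evaluated on elements. -/
def Qdiff (C : CartanDatum k I) {A : Type} [Ring A] [Algebra k A] (i j : I) (u v w : A) : A :=
  if i = j then 0 else
    ∑ p ∈ Finset.range ((-(C.a i j)).toNat + 1), ∑ q ∈ Finset.range ((-(C.a j i)).toNat + 1),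
      if C.d i * (p : ℤ) + C.d j * (q : ℤ) = -(C.d i * C.a i j) then
        C.t i j p q • ((∑ c ∈ Finset.range p, u ^ c * w ^ (p - 1 - c)) * v ^ q) else 0

/-- The defining relations of the KLR algebra `R(n)`. -/
inductive Rel (C : CartanDatum k I) (n : ℕ) : FA k I n → FA k I n → Prop
  | ee : ∀ ν ν' : Fin n → I, Rel C n (ge k ν * ge k ν') (if ν = ν' then ge k ν else 0)
  | esum : Rel C n (∑ ν : Fin n → I, ge k ν) 1
  | xx : ∀ a b : Fin n, Rel C n (gx k a * gx k b) (gx k b * gx k a)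
  | xe : ∀ (a : Fin n) (ν : Fin n → I), Rel C n (gx k a * ge k ν) (ge k ν * gx k a)
  | taue : ∀ (l : ℕ) (h : l + 1 < n) (ν : Fin n → I),
      Rel C n (gt k l h * ge k ν)
        (ge k (ν ∘ Equiv.swap (⟨l, Nat.lt_of_succ_lt h⟩ : Fin n) ⟨l + 1, h⟩) * gt k l h)
  | tautau : ∀ (l : ℕ) (h : l + 1 < n) (l' : ℕ) (h' : l' + 1 < n),
      (l + 1 < l' ∨ l' + 1 < l) →
      Rel C n (gt k l h * gt k l' h') (gt k l' h' * gt k l h)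
  | tausq : ∀ (l : ℕ) (h : l + 1 < n) (ν : Fin n → I),
      Rel C n (gt k l h ^ 2 * ge k ν)
        (Qel C (ν ⟨l, Nat.lt_of_succ_lt h⟩) (ν ⟨l + 1, h⟩)
          (gx k ⟨l, Nat.lt_of_succ_lt h⟩) (gx k ⟨l + 1, h⟩) * ge k ν)
  | taux : ∀ (l : ℕ) (h : l + 1 < n) (m : Fin n) (ν : Fin n → I),
      Rel C n ((gt k l h * gx k m
          - gx k (Equiv.swap (⟨l, Nat.lt_of_succ_lt h⟩ : Fin n) ⟨l + 1, h⟩ m) * gt k l h) * ge k ν)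
        (if m = ⟨l, Nat.lt_of_succ_lt h⟩ ∧ ν ⟨l, Nat.lt_of_succ_lt h⟩ = ν ⟨l + 1, h⟩ then
            -(ge k ν)
          else if m = (⟨l + 1, h⟩ : Fin n) ∧ ν ⟨l, Nat.lt_of_succ_lt h⟩ = ν ⟨l + 1, h⟩ then
            ge k ν
          else 0)
  | braid : ∀ (l : ℕ) (h2 : l + 2 < n) (ν : Fin n → I),
      Rel C n ((gt k (l + 1) h2 * gt k l (Nat.lt_of_succ_lt h2) * gt k (l + 1) h2
          - gt k l (Nat.lt_of_succ_lt h2) * gt k (l + 1) h2 * gt k l (Nat.lt_of_succ_lt h2))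
          * ge k ν)
        (if ν ⟨l, Nat.lt_of_succ_lt (Nat.lt_of_succ_lt h2)⟩ = ν ⟨l + 2, h2⟩ then
            Qdiff C (ν ⟨l, Nat.lt_of_succ_lt (Nat.lt_of_succ_lt h2)⟩)
              (ν ⟨l + 1, Nat.lt_of_succ_lt h2⟩)
              (gx k ⟨l, Nat.lt_of_succ_lt (Nat.lt_of_succ_lt h2)⟩)
              (gx k ⟨l + 1, Nat.lt_of_succ_lt h2⟩)
              (gx k ⟨l + 2, h2⟩) * ge k ν
          else 0)

/-- The Khovanov–Lauda–Rouquier algebra `R(n)`. -/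
abbrev Alg (C : CartanDatum k I) (n : ℕ) : Type := RingQuot (Rel C n)

variable (C : CartanDatum k I)

/-- The generator `e(ν)` of `R(n)`. -/
noncomputable def Ee {n : ℕ} (ν : Fin n → I) : Alg C n :=
  RingQuot.mkAlgHom k (Rel C n) (ge k ν)

/-- The generator `x_a` of `R(n)`. -/
noncomputable def Xx {n : ℕ} (a : Fin n) : Alg C n :=
  RingQuot.mkAlgHom k (Rel C n) (gx k a)

/-- The generator `τ_l` of `R(n)`. -/
noncomputable def Tt {n : ℕ} (l : ℕ) (h : l + 1 < n) : Alg C n :=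
  RingQuot.mkAlgHom k (Rel C n) (gt k l h)

variable (I) in
/-- The height of `β = Σ k_i α_i`. -/
def ht (β : I → ℕ) : ℕ := ∑ i, β i

/-- The content of a sequence `ν`. -/
def content {m : ℕ} (ν : Fin m → I) : I → ℕ :=
  fun i => (Finset.univ.filter (fun a => ν a = i)).card

/-- The set `I^β` of sequences of length `m` with content `β`. -/
def seqs (β : I → ℕ) (m : ℕ) : Finset (Fin m → I) :=
  Finset.univ.filter (fun ν => content ν = β)

/-- The central idempotent `e(β)` in `R(n)`. -/
noncomputable def eIdem (n : ℕ) (β : I → ℕ) : Alg C n := ∑ ν ∈ seqs β n, Ee C ν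

/-- `β + α_i`. -/
def addA (β : I → ℕ) (i : I) : I → ℕ := fun j => β j + if j = i then 1 else 0

/-- The idempotent `e(β, α_i)` of `R(n+1)` (sum over `ν ∈ I^{β+α_i}` with `ν_{n+1} = i`). -/
noncomputable def eR (n : ℕ) (β : I → ℕ) (i : I) : Alg C (n + 1) :=
  ∑ ν ∈ (seqs (addA β i) (n + 1)).filter (fun ν => ν (Fin.last n) = i), Ee C ν

/-- The idempotent `e(α_i, β)` of `R(n+1)` (sum over `ν ∈ I^{β+α_i}` with `ν_1 = i`). -/
noncomputable def eL (n : ℕ) (β : I → ℕ) (i : I) : Alg C (n + 1) :=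
  ∑ ν ∈ (seqs (addA β i) (n + 1)).filter (fun ν => ν 0 = i), Ee C ν

/-- The idempotent `e(β - α_i, α_i)` of `R(n)`: sum over `ν ∈ I^β` with last entry `i`;
this is `0` when the coefficient of `α_i` in `β` is `0` or `n = 0`. -/
noncomputable def eD (n : ℕ) (β : I → ℕ) (i : I) : Alg C n :=
  ∑ ν ∈ (seqs β n).filter (fun ν => if h : 0 < n then ν ⟨n - 1, Nat.sub_lt h one_pos⟩ = i
      else False), Ee C ν

/-- The relations defining `R(β) = R(n)e(β)` (a unital ring with unit the image of
`e(β)`): the KLR relations together with the relation `e(β) = 1`. -/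
inductive URel (n : ℕ) (β : I → ℕ) : FA k I n → FA k I n → Prop
  | base : ∀ {x y : FA k I n}, Rel C n x y → URel n β x y
  | unit : URel n β (∑ ν ∈ seqs β n, ge k ν) 1

/-- The algebra `R(β)`, realized as the quotient of `R(n)` identifying `e(β)` with `1`. -/
abbrev bAlg (n : ℕ) (β : I → ℕ) : Type := RingQuot (URel C n β)

/-- The canonical projection `R(n) → R(β)`. -/
noncomputable def toB {n : ℕ} {β : I → ℕ} : Alg C n →ₐ[k] bAlg C n β :=
  RingQuot.liftAlgHom (S := k)
    ⟨RingQuot.mkAlgHom k (URel C n β),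
      fun _ _ h => RingQuot.mkAlgHom_rel k (URel.base h)⟩

/-- The element `a^Λ(x_1)` at the level of the free algebra. -/
noncomputable def aLamF (Λ : I → ℕ) (n : ℕ) (β : I → ℕ) : FA k I n :=
  if h : 0 < n then
    ∑ ν ∈ seqs β n, (gx k (⟨0, h⟩ : Fin n)) ^ (Λ (ν ⟨0, h⟩)) * ge k ν
  else 0

/-- The element `a^Λ(x_1)` of `R(β)`. -/
noncomputable def aLam (Λ : I → ℕ) (n : ℕ) (β : I → ℕ) : bAlg C n β :=
  RingQuot.mkAlgHom k (URel C n β) (aLamF Λ n β)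

/-- The relations defining the cyclotomic quotient `R^Λ(β)`. -/
inductive CRel (Λ : I → ℕ) (n : ℕ) (β : I → ℕ) : FA k I n → FA k I n → Prop
  | base : ∀ {x y : FA k I n}, Rel C n x y → CRel Λ n β x y
  | unit : CRel Λ n β (∑ ν ∈ seqs β n, ge k ν) 1
  | cyc : CRel Λ n β (aLamF Λ n β) 0

/-- The cyclotomic KLR algebra `R^Λ(β)`. -/
abbrev cAlg (Λ : I → ℕ) (n : ℕ) (β : I → ℕ) : Type := RingQuot (CRel C Λ n β)

/-- The canonical projection `R(β) → R^Λ(β)`. -/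
noncomputable def toC {Λ : I → ℕ} {n : ℕ} {β : I → ℕ} : bAlg C n β →ₐ[k] cAlg C Λ n β :=
  RingQuot.liftAlgHom (S := k)
    ⟨RingQuot.mkAlgHom k (CRel C Λ n β),
      fun _ _ h => by
        cases h with
        | base hb => exact RingQuot.mkAlgHom_rel k (CRel.base hb)
        | unit => exact RingQuot.mkAlgHom_rel k CRel.unit⟩

/-- The canonical projection `R(n) → R^Λ(β)`. -/
noncomputable def toCB (Λ : I → ℕ) {n : ℕ} {β : I → ℕ} : Alg C n →ₐ[k] cAlg C Λ n β :=
  (toC C).comp (toB C)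

end KLR
namespace KLR

variable {k : Type} [Field k] {I : Type} [Fintype I] [DecidableEq I] (C : CartanDatum k I)

section Homs

/-- Characterization of the non-unital algebra homomorphism `R(n) → R(n+1)` adding `i`
on the right: `e(ν) ↦ e(ν∗(i))`, `x_a ↦ x_a e(…,α_i)`, `τ_l ↦ τ_l e(…,α_i)`,
where the relevant idempotent is supplied as `e`. -/
def IsUpR {n : ℕ} (i : I) (e : Alg C (n + 1)) (φ : Alg C n →ₙₐ[k] Alg C (n + 1)) : Prop :=
  (∀ ν : Fin n → I, φ (Ee C ν) = Ee C (Fin.snoc ν i)) ∧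
  (∀ a : Fin n, φ (Xx C a) = Xx C a.castSucc * e) ∧
  (∀ (l : ℕ) (h : l + 1 < n), φ (Tt C l h) = Tt C l (Nat.lt_succ_of_lt h) * e)

/-- Characterization of the non-unital algebra homomorphism `R(n) → R(n+1)` adding `i`
on the left: `e(ν) ↦ e((i)∗ν)`, `x_a ↦ x_{a+1} e(α_i,…)`, `τ_l ↦ τ_{l+1} e(α_i,…)`. -/
def IsUpL {n : ℕ} (i : I) (e : Alg C (n + 1)) (φ : Alg C n →ₙₐ[k] Alg C (n + 1)) : Prop :=
  (∀ ν : Fin n → I, φ (Ee C ν) = Ee C (Fin.cons i ν)) ∧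
  (∀ a : Fin n, φ (Xx C a) = Xx C a.succ * e) ∧
  (∀ (l : ℕ) (h : l + 1 < n), φ (Tt C l h) = Tt C (l + 1) (Nat.succ_lt_succ h) * e)

/-- Characterization of the non-unital homomorphism `R(β) → R(β+α_i)` (right version). -/
def IsUpRb {n : ℕ} {β γ' : I → ℕ} (i : I)
    (φ : bAlg C n β →ₙₐ[k] bAlg C (n + 1) γ') : Prop :=
  (∀ ν : Fin n → I, φ (toB C (Ee C ν)) = toB C (Ee C (Fin.snoc ν i))) ∧
  (∀ a : Fin n, φ (toB C (Xx C a)) = toB C (Xx C a.castSucc * eR C n β i)) ∧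
  (∀ (l : ℕ) (h : l + 1 < n),
    φ (toB C (Tt C l h)) = toB C (Tt C l (Nat.lt_succ_of_lt h) * eR C n β i))

/-- Characterization of the non-unital homomorphism `R(β) → R(β+α_i)` (left version). -/
def IsUpLb {n : ℕ} {β γ' : I → ℕ} (i : I)
    (φ : bAlg C n β →ₙₐ[k] bAlg C (n + 1) γ') : Prop :=
  (∀ ν : Fin n → I, φ (toB C (Ee C ν)) = toB C (Ee C (Fin.cons i ν))) ∧
  (∀ a : Fin n, φ (toB C (Xx C a)) = toB C (Xx C a.succ * eL C n β i)) ∧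
  (∀ (l : ℕ) (h : l + 1 < n),
    φ (toB C (Tt C l h)) = toB C (Tt C (l + 1) (Nat.succ_lt_succ h) * eL C n β i))

/-- Characterization of the non-unital homomorphism `R^Λ(β) → R^Λ(β+α_i)` (right version). -/
def IsUpRc (Λ : I → ℕ) {n : ℕ} {β γ' : I → ℕ} (i : I)
    (φ : cAlg C Λ n β →ₙₐ[k] cAlg C Λ (n + 1) γ') : Prop :=
  (∀ ν : Fin n → I, φ (toCB C Λ (Ee C ν)) = toCB C Λ (Ee C (Fin.snoc ν i))) ∧
  (∀ a : Fin n, φ (toCB C Λ (Xx C a)) = toCB C Λ (Xx C a.castSucc * eR C n β i)) ∧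
  (∀ (l : ℕ) (h : l + 1 < n),
    φ (toCB C Λ (Tt C l h)) = toCB C Λ (Tt C l (Nat.lt_succ_of_lt h) * eR C n β i))

end Homs

section Tensor

open scoped TensorProduct

variable (S B M : Type) [Ring S] [Algebra k S] [Ring B] [Algebra k B]
  [AddCommGroup M] [Module k M] [Module S M] [IsScalarTower k S M]

variable (k) in
/-- The relation submodule defining the balanced tensor product `B ⊗_S M` where `S`
acts on `B` on the right through the (non-unital) homomorphism `φ : S → B`. -/
def TRel (φ : S →ₙₐ[k] B) : Submodule B (B ⊗[k] M) :=
  Submodule.span B {z | ∃ (b : B) (r : S) (m : M), z = (b * φ r) ⊗ₜ[k] m - b ⊗ₜ[k] (r • m)}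

variable (k) in
/-- The balanced tensor product `B ⊗_S M` (over the homomorphism `φ : S → B`). -/
abbrev OT (φ : S →ₙₐ[k] B) : Type := (B ⊗[k] M) ⧸ TRel k S B M φ

variable (k) in
/-- The canonical projection onto the balanced tensor product. -/
def OTmk (φ : S →ₙₐ[k] B) (z : B ⊗[k] M) : OT k S B M φ := Submodule.Quotient.mk z

end Tensor

section ESub

variable (A : Type) [Ring A] [Algebra k A] (N : Type) [AddCommGroup N] [Module k N]
  [Module A N] [IsScalarTower k A N]

variable (k) in
/-- Multiplication by `e` as a `k`-linear endomorphism of an `A`-module. -/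
def eMap (e : A) : N →ₗ[k] N where
  toFun x := e • x
  map_add' x y := smul_add e x y
  map_smul' c x := by
    simp only [RingHom.id_apply]
    rw [← algebraMap_smul A c x, ← mul_smul, ← Algebra.commutes, mul_smul, algebraMap_smul]

variable (k) in
/-- The `k`-submodule `eN` of an `A`-module `N`. -/
def eSub (e : A) : Submodule k N := LinearMap.range (eMap k A N e)

end ESub

section Grading

variable {A M : Type}

variable (k) in
/-- `𝒜` is an algebra grading of `A`. -/
def IsAlgGrading [Ring A] [Algebra k A] (𝒜 : ℤ → Submodule k A) : Prop :=
  (1 : A) ∈ 𝒜 0 ∧ (∀ {c₁ c₂ : ℤ} {a b : A}, a ∈ 𝒜 c₁ → b ∈ 𝒜 c₂ → a * b ∈ 𝒜 (c₁ + c₂)) ∧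
    DirectSum.IsInternal 𝒜

variable (k) in
/-- `gr` is a grading of the `A`-module `M` compatible with the algebra grading `𝒜`. -/
def IsModGrading [Ring A] [Algebra k A] [AddCommGroup M] [Module k M] [Module A M]
    (𝒜 : ℤ → Submodule k A) (gr : ℤ → Submodule k M) : Prop :=
  DirectSum.IsInternal gr ∧
    ∀ {c m : ℤ} {a : A} {x : M}, a ∈ 𝒜 c → x ∈ gr m → a • x ∈ gr (c + m)

end Grading

section KLRGrading

/-- The canonical grading property for `R(n)`-type quotients: images of `e(ν)` have degree 0,
`x_a e(ν)` has degree `(α_{ν_a}, α_{ν_a})`, and `τ_l e(ν)` has degree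
`-(α_{ν_l}, α_{ν_{l+1}})`.  Here `p : R(n) → A` is the canonical projection onto the
quotient under consideration. -/
def IsKLRGrading {n : ℕ} {A : Type} [Ring A] [Algebra k A] (p : Alg C n →ₐ[k] A)
    (𝒜 : ℤ → Submodule k A) : Prop :=
  IsAlgGrading k 𝒜 ∧
  (∀ ν : Fin n → I, p (Ee C ν) ∈ 𝒜 0) ∧
  (∀ (a : Fin n) (ν : Fin n → I), p (Xx C a * Ee C ν) ∈ 𝒜 (B C (ν a) (ν a))) ∧
  (∀ (l : ℕ) (h : l + 1 < n) (ν : Fin n → I),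
    p (Tt C l h * Ee C ν) ∈ 𝒜 (-(B C (ν ⟨l, Nat.lt_of_succ_lt h⟩) (ν ⟨l + 1, h⟩))))

end KLRGrading

end KLR
namespace KLR

open scoped TensorProduct

variable {k : Type} [Field k] {I : Type} [Fintype I] [DecidableEq I] (C : CartanDatum k I)

section IndGrading

variable (S B M : Type) [Ring S] [Algebra k S] [Ring B] [Algebra k B]
  [AddCommGroup M] [Module k M] [Module S M] [IsScalarTower k S M]

variable (k) in
/-- The induced grading on the balanced tensor product `B ⊗_S M`. -/
def otGr (φ : S →ₙₐ[k] B) (𝒜 : ℤ → Submodule k B) (gr : ℤ → Submodule k M)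
    (c : ℤ) : Submodule k (OT k S B M φ) :=
  Submodule.span k {z | ∃ (c₁ c₂ : ℤ) (b : B) (m : M),
    c₁ + c₂ = c ∧ b ∈ 𝒜 c₁ ∧ m ∈ gr c₂ ∧ z = OTmk k S B M φ (b ⊗ₜ[k] m)}

end IndGrading

section ESubGrading

variable (A N : Type) [Ring A] [Algebra k A] [AddCommGroup N] [Module k N]
  [Module A N] [IsScalarTower k A N]

variable (k) in
/-- The induced grading on the submodule `eN ⊆ N`. -/
def eSubGr (e : A) (gr : ℤ → Submodule k N) (c : ℤ) : Submodule k ↥(eSub k A N e) :=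
  (gr c).comap (eSub k A N e).subtype

end ESubGrading

section Instances

variable (n : ℕ) (β : I → ℕ) (Λ : I → ℕ)

noncomputable instance : Module (bAlg C n β) (cAlg C Λ n β) :=
  Module.compHom _ (toC C (Λ := Λ) (n := n) (β := β)).toRingHom

instance : IsScalarTower k (bAlg C n β) (cAlg C Λ n β) := by
  constructor
  intro c s m
  show (toC C (c • s)) * m = c • (toC C s * m)
  rw [map_smul, Algebra.smul_mul_assoc]

end Instances


end KLR
namespace KLR

open scoped TensorProduct

variable {k : Type} [Field k] {I : Type} [Fintype I] [DecidableEq I] (C : CartanDatum k I)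

/-- `⟨h_i, β⟩ = Σ_j k_j a_{ij}`. -/
def pairH (i : I) (β : I → ℕ) : ℤ := ∑ j, (β j : ℤ) * C.a i j

/-- `(α_i, β) = Σ_j k_j (α_i, α_j)`. -/
def pairB (i : I) (β : I → ℕ) : ℤ := ∑ j, (β j : ℤ) * B C i j

/-- The ordered product `τ_1 τ_2 ⋯ τ_n` in `R(β+α_i)`-type quotients. -/
noncomputable def tauProd (n : ℕ) (γ : I → ℕ) : bAlg C (n + 1) γ :=
  (List.ofFn (fun l : Fin n => toB C (Tt C l.val (Nat.succ_lt_succ l.isLt)))).prod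

/-- The right ideal `Ae` as a `k`-submodule. -/
noncomputable def rId {A : Type} [Ring A] [Algebra k A] (e : A) : Submodule k A :=
  LinearMap.range (LinearMap.mulRight k e)

/-- The left ideal `eA` as a `k`-submodule. -/
noncomputable def lId {A : Type} [Ring A] [Algebra k A] (e : A) : Submodule k A :=
  LinearMap.range (LinearMap.mulLeft k e)

variable (k) in
/-- Characterization of the module structure on `eN` over `S'` acting through
the (non-unital) homomorphism `φ : S' → A`. -/
def IsEAction {A N S' : Type} [Ring A] [Algebra k A] [AddCommGroup N] [Module k N]
    [Module A N] [IsScalarTower k A N] [Ring S'] [Algebra k S']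
    (e : A) (φ : S' →ₙₐ[k] A) (inst : Module S' ↥(eSub k A N e)) : Prop :=
  letI := inst
  ∀ (r : S') (x : ↥(eSub k A N e)), ((r • x : ↥(eSub k A N e)) : N) = φ r • (x : N)

end KLR

namespace KLR

variable {k : Type} [Field k] {I : Type} [Fintype I] [DecidableEq I] (C : CartanDatum k I)

/-- The image of `e(β,α_i)` in `R(β+α_i)`. -/
noncomputable def eRb (n : ℕ) (β : I → ℕ) (i : I) : bAlg C (n + 1) (addA β i) :=
  toB C (eR C n β i)

/-- The image of `e(α_i,β)` in `R(β+α_i)`. -/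
noncomputable def eLb (n : ℕ) (β : I → ℕ) (i : I) : bAlg C (n + 1) (addA β i) :=
  toB C (eL C n β i)

/-- The image of `e(β-α_i,α_i)` in `R(β)`. -/
noncomputable def eDb (n : ℕ) (β : I → ℕ) (i : I) : bAlg C n β :=
  toB C (eD C n β i)

/-- The image of `e(β,α_i)` in `R^Λ(β+α_i)`. -/
noncomputable def eRc (Λ : I → ℕ) (n : ℕ) (β : I → ℕ) (i : I) :
    cAlg C Λ (n + 1) (addA β i) :=
  toCB C Λ (eR C n β i)

/-- The image of `e(β-α_i,α_i)` in `R^Λ(β)`. -/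
noncomputable def eDc (Λ : I → ℕ) (n : ℕ) (β : I → ℕ) (i : I) : cAlg C Λ n β :=
  toCB C Λ (eD C n β i)

end KLR

namespace KLR

variable {k : Type} [Field k] {I : Type} [Fintype I] [DecidableEq I]

variable (k) in
/-- Bundled data of the canonical module structure on `eN` over `S'`, acting through
the non-unital homomorphism `φ : S' → A`, together with its scalar-tower property. -/
structure EData {A S' : Type} (N : Type) [Ring A] [Algebra k A] [AddCommGroup N]
    [Module k N] [Module A N] [IsScalarTower k A N] [Ring S'] [Algebra k S']
    (e : A) (φ : S' →ₙₐ[k] A) : Type where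
  inst : Module S' ↥(eSub k A N e)
  compat : IsEAction k e φ inst
  tower : letI := inst; IsScalarTower k S' ↥(eSub k A N e)

end KLR

namespace KLR
/-- `β - α_i` (truncated subtraction). -/
def subA {I : Type} [DecidableEq I] (β : I → ℕ) (i : I) : I → ℕ :=
  fun j => β j - if j = i then 1 else 0
end KLR



namespace KLR

set_option autoImplicit false
set_option linter.unusedSectionVars false
set_option linter.unusedSimpArgs false

variable {k : Type} [Field k] {I : Type} [Fintype I] [DecidableEq I] (C : CartanDatum k I)

theorem map_Qel {A A' : Type} [Ring A] [Algebra k A] [Ring A'] [Algebra k A'] (f : A →ₐ[k] A')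
    (i j : I) (u v : A) : f (Qel C i j u v) = Qel C i j (f u) (f v) := by
  unfold Qel
  split_ifs with h
  · simp
  · simp only [map_sum]
    refine Finset.sum_congr rfl fun p _ => Finset.sum_congr rfl fun q _ => ?_
    split_ifs <;> simp

theorem map_Qdiff {A A' : Type} [Ring A] [Algebra k A] [Ring A'] [Algebra k A'] (f : A →ₐ[k] A')
    (i j : I) (u v w : A) : f (Qdiff C i j u v w) = Qdiff C i j (f u) (f v) (f w) := by
  unfold Qdiff
  split_ifs with h
  · simp
  · simp only [map_sum]
    refine Finset.sum_congr rfl fun p _ => Finset.sum_congr rfl fun q _ => ?_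
    split_ifs <;> simp

/-- A family of elements of an algebra satisfying the KLR relations. -/
structure IsRep (n : ℕ) {A : Type} [Ring A] [Algebra k A] (e : (Fin n → I) → A) (x : Fin n → A)
    (t : ∀ l : ℕ, l + 1 < n → A) : Prop where
  ee : ∀ ν ν', e ν * e ν' = if ν = ν' then e ν else 0
  esum : ∑ ν, e ν = 1
  xx : ∀ a b, x a * x b = x b * x a
  xe : ∀ a ν, x a * e ν = e ν * x a
  taue : ∀ (l : ℕ) (h : l + 1 < n) (ν : Fin n → I), t l h * e ν =
    e (ν ∘ Equiv.swap (⟨l, Nat.lt_of_succ_lt h⟩ : Fin n) ⟨l + 1, h⟩) * t l h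
  tautau : ∀ (l : ℕ) (h : l + 1 < n) (l' : ℕ) (h' : l' + 1 < n),
      (l + 1 < l' ∨ l' + 1 < l) → t l h * t l' h' = t l' h' * t l h
  tausq : ∀ (l : ℕ) (h : l + 1 < n) (ν : Fin n → I),
      t l h ^ 2 * e ν =
        Qel C (ν ⟨l, Nat.lt_of_succ_lt h⟩) (ν ⟨l + 1, h⟩)
          (x ⟨l, Nat.lt_of_succ_lt h⟩) (x ⟨l + 1, h⟩) * e ν
  taux : ∀ (l : ℕ) (h : l + 1 < n) (m : Fin n) (ν : Fin n → I),
      (t l h * x m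
          - x (Equiv.swap (⟨l, Nat.lt_of_succ_lt h⟩ : Fin n) ⟨l + 1, h⟩ m) * t l h) * e ν =
        (if m = ⟨l, Nat.lt_of_succ_lt h⟩ ∧ ν ⟨l, Nat.lt_of_succ_lt h⟩ = ν ⟨l + 1, h⟩ then
            -(e ν)
          else if m = (⟨l + 1, h⟩ : Fin n) ∧ ν ⟨l, Nat.lt_of_succ_lt h⟩ = ν ⟨l + 1, h⟩ then
            e ν
          else 0)
  braid : ∀ (l : ℕ) (h2 : l + 2 < n) (ν : Fin n → I),
      (t (l + 1) h2 * t l (Nat.lt_of_succ_lt h2) * t (l + 1) h2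
          - t l (Nat.lt_of_succ_lt h2) * t (l + 1) h2 * t l (Nat.lt_of_succ_lt h2))
          * e ν =
        (if ν ⟨l, Nat.lt_of_succ_lt (Nat.lt_of_succ_lt h2)⟩ = ν ⟨l + 2, h2⟩ then
            Qdiff C (ν ⟨l, Nat.lt_of_succ_lt (Nat.lt_of_succ_lt h2)⟩)
              (ν ⟨l + 1, Nat.lt_of_succ_lt h2⟩)
              (x ⟨l, Nat.lt_of_succ_lt (Nat.lt_of_succ_lt h2)⟩)
              (x ⟨l + 1, Nat.lt_of_succ_lt h2⟩)
              (x ⟨l + 2, h2⟩) * e ν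
          else 0)

/-- The algebra `R(n)`, with sealed instances. -/
def RA (n : ℕ) : Type := Alg C n

noncomputable instance instRingRA (n : ℕ) : Ring (RA C n) := inferInstanceAs (Ring (Alg C n))
noncomputable instance instAlgebraRA (n : ℕ) : Algebra k (RA C n) :=
  inferInstanceAs (Algebra k (Alg C n))

/-- The projection from the free algebra. -/
noncomputable def mkA (n : ℕ) : FA k I n →ₐ[k] RA C n := RingQuot.mkAlgHom k (Rel C n)

theorem mkA_rel {n : ℕ} {x y : FA k I n} (h : Rel C n x y) : mkA C n x = mkA C n y :=
  RingQuot.mkAlgHom_rel k h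

theorem mkA_surj (n : ℕ) : Function.Surjective (mkA C n) :=
  RingQuot.mkAlgHom_surjective k (Rel C n)

/-- The identity map to `RA`. -/
noncomputable def toRA (n : ℕ) : Alg C n ≃ₐ[k] RA C n where
  toFun x := x
  invFun x := x
  left_inv _ := rfl
  right_inv _ := rfl
  map_mul' _ _ := rfl
  map_add' _ _ := rfl
  commutes' _ := rfl

/-- `e(ν)` -/
noncomputable def ee {n : ℕ} (ν : Fin n → I) : RA C n := mkA C n (ge k ν)
/-- `x_a` -/
noncomputable def xx {n : ℕ} (a : Fin n) : RA C n := mkA C n (gx k a)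
/-- `τ_l` -/
noncomputable def tt {n : ℕ} (l : ℕ) (h : l + 1 < n) : RA C n := mkA C n (gt k l h)

/-- The free-algebra map attached to a family of elements. -/
noncomputable def preLift {n : ℕ} {A : Type} [Ring A] [Algebra k A] (e : (Fin n → I) → A)
    (x : Fin n → A) (t : ∀ l : ℕ, l + 1 < n → A) : FA k I n →ₐ[k] A :=
  FreeAlgebra.lift k (fun g => match g with
    | Gen.e ν => e ν
    | Gen.x a => x a
    | Gen.tau l h => t l h)

section
variable {n : ℕ} {A : Type} [Ring A] [Algebra k A] (e : (Fin n → I) → A)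
    (x : Fin n → A) (t : ∀ l : ℕ, l + 1 < n → A)

@[simp] theorem preLift_e (ν : Fin n → I) : preLift e x t (ge k ν) = e ν := by
  simp [preLift, ge]
@[simp] theorem preLift_x (a : Fin n) : preLift e x t (gx k a) = x a := by
  simp [preLift, gx]
@[simp] theorem preLift_t (l : ℕ) (h : l + 1 < n) : preLift e x t (gt k l h) = t l h := by
  simp [preLift, gt]

variable {e x t}

theorem preLift_rel (H : IsRep C n e x t) : ∀ ⦃a b : FA k I n⦄, Rel C n a b →
    preLift e x t a = preLift e x t b := by
    intro a b h
    cases h with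
    | ee ν ν' => simp only [map_mul, preLift_e, H.ee]; split_ifs <;> simp
    | esum => simpa using H.esum
    | xx a b => simpa using H.xx a b
    | xe a ν => simpa using H.xe a ν
    | taue l h ν => simpa using H.taue l h ν
    | tautau l h l' h' hl => simpa using H.tautau l h l' h' hl
    | tausq l h ν => simpa [map_Qel] using H.tausq l h ν
    | taux l h m ν =>
      have := H.taux l h m ν
      simp only [map_mul, map_sub, preLift_e, preLift_x, preLift_t]
      rw [this]
      split_ifs <;> simp
    | braid l h ν =>
      have := H.braid l h ν
      simp only [map_mul, map_sub, preLift_e, preLift_t]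
      rw [this]
      split_ifs <;> simp [map_Qdiff]

/-- The algebra map out of `R(n)` attached to a family satisfying the relations. -/
noncomputable def liftA (H : IsRep C n e x t) : RA C n →ₐ[k] A :=
  (RingQuot.liftAlgHom (S := k) ⟨preLift e x t, preLift_rel C H⟩ : Alg C n →ₐ[k] A)

theorem liftA_mk (H : IsRep C n e x t) (f : FA k I n) : liftA C H (mkA C n f) = preLift e x t f :=
  RingQuot.liftAlgHom_mkAlgHom_apply k (preLift e x t) (preLift_rel C H) f

@[simp] theorem liftA_e (H : IsRep C n e x t) (ν : Fin n → I) : liftA C H (ee C ν) = e ν := by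
  rw [ee, liftA_mk, preLift_e]
@[simp] theorem liftA_x (H : IsRep C n e x t) (a : Fin n) : liftA C H (xx C a) = x a := by
  rw [xx, liftA_mk, preLift_x]
@[simp] theorem liftA_t (H : IsRep C n e x t) (l : ℕ) (h : l + 1 < n) :
    liftA C H (tt C l h) = t l h := by
  rw [tt, liftA_mk, preLift_t]
end

theorem isRep_alg (n : ℕ) : IsRep C n (ee C) (xx C) (tt C) where
  ee ν ν' := by
    have := mkA_rel C (Rel.ee (C := C) ν ν')
    rw [map_mul] at this
    refine this.trans ?_
    split_ifs <;> simp [ee]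
  esum := by
    have := mkA_rel C (Rel.esum (C := C) (n := n))
    rw [map_sum, map_one] at this
    exact this
  xx a b := by
    have := mkA_rel C (Rel.xx (C := C) a b)
    rw [map_mul, map_mul] at this
    exact this
  xe a ν := by
    have := mkA_rel C (Rel.xe (C := C) a ν)
    rw [map_mul, map_mul] at this
    exact this
  taue l h ν := by
    have := mkA_rel C (Rel.taue (C := C) l h ν)
    rw [map_mul, map_mul] at this
    exact this
  tautau l h l' h' hl := by
    have := mkA_rel C (Rel.tautau (C := C) l h l' h' hl)
    rw [map_mul, map_mul] at this
    exact this
  tausq l h ν := by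
    have := mkA_rel C (Rel.tausq (C := C) l h ν)
    rw [map_mul, map_mul, map_pow, map_Qel] at this
    exact this
  taux l h m ν := by
    have := mkA_rel C (Rel.taux (C := C) l h m ν)
    rw [map_mul, map_sub, map_mul, map_mul] at this
    refine this.trans ?_
    split_ifs <;> simp [ee]
  braid l h ν := by
    have := mkA_rel C (Rel.braid (C := C) l h ν)
    rw [map_mul, map_sub, map_mul, map_mul, map_mul, map_mul] at this
    refine this.trans ?_
    split_ifs <;> simp [ee, xx, map_Qdiff]

/-- Induction principle for `R(n)`: a subalgebra containing the generators is everything. -/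
theorem alg_top {n : ℕ} (S : Subalgebra k (RA C n)) (he : ∀ ν, ee C ν ∈ S)
    (hx : ∀ a, xx C a ∈ S) (ht : ∀ l h, tt C l h ∈ S) : ∀ y, y ∈ S := by
  intro y
  obtain ⟨f, rfl⟩ := mkA_surj C n y
  induction f using FreeAlgebra.induction with
  | grade0 r => rw [AlgHom.commutes]; exact S.algebraMap_mem r
  | grade1 g =>
    cases g with
    | e ν => exact he ν
    | x a => exact hx a
    | tau l h => exact ht l h
  | mul a b ha hb => rw [map_mul]; exact S.mul_mem ha hb
  | add a b ha hb => rw [map_add]; exact S.add_mem ha hb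

theorem ext_e {n : ℕ} {y y' : RA C n} (h : ∀ ν, y * ee C ν = y' * ee C ν) : y = y' := by
  rw [← mul_one y, ← mul_one y', ← (isRep_alg C n).esum, Finset.mul_sum, Finset.mul_sum]
  exact Finset.sum_congr rfl fun ν _ => h ν

theorem ee_mul {n : ℕ} (ν ν' : Fin n → I) :
    ee C ν * ee C ν' = if ν = ν' then ee C ν else 0 := by
  exact (isRep_alg C n).ee ν _

/-- The idempotent fixing the color at one position. -/
noncomputable def ec {n : ℕ} (p : Fin n) (j : I) : RA C n :=
  ∑ ν : Fin n → I, if ν p = j then ee C ν else 0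

theorem ec_mul_ee {n : ℕ} (p : Fin n) (j : I) (ν : Fin n → I) :
    ec C p j * ee C ν = if ν p = j then ee C ν else 0 := by
  unfold ec
  rw [Finset.sum_mul, Finset.sum_eq_single ν]
  · split_ifs <;> simp [ee_mul]
  · intro b _ hb
    split_ifs <;> simp [ee_mul, hb]
  · simp

theorem ee_mul_ec {n : ℕ} (p : Fin n) (j : I) (ν : Fin n → I) :
    ee C ν * ec C p j = if ν p = j then ee C ν else 0 := by
  unfold ec
  rw [Finset.mul_sum, Finset.sum_eq_single ν]
  · split_ifs <;> simp [ee_mul]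
  · intro b _ hb
    split_ifs <;> simp [ee_mul, hb.symm]
  · simp

theorem ec_sum {n : ℕ} (p : Fin n) : ∑ j, ec C p j = 1 := by
  apply ext_e
  intro ν
  rw [Finset.sum_mul]
  simp [ec_mul_ee]

theorem ec_mul_ec {n : ℕ} (p : Fin n) (i j : I) :
    ec C p i * ec C p j = if i = j then ec C p i else 0 := by
  apply ext_e
  intro ν
  rw [mul_assoc, ec_mul_ee]
  by_cases h : ν p = j
  · subst h
    by_cases h2 : i = ν p
    · subst h2; simp
    · simp [h2, ec_mul_ee, Ne.symm h2]
  · by_cases h2 : i = j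
    · subst h2; simp [h, ec_mul_ee]
    · simp [h, h2]

theorem ec_comm {n : ℕ} (p q : Fin n) (i j : I) : ec C p i * ec C q j = ec C q j * ec C p i := by
  apply ext_e
  intro ν
  rw [mul_assoc, mul_assoc, ec_mul_ee, ec_mul_ee]
  split_ifs <;> simp [ec_mul_ee, *]

theorem ee_ec_comm {n : ℕ} (p : Fin n) (j : I) (ν : Fin n → I) :
    ee C ν * ec C p j = ec C p j * ee C ν := by rw [ee_mul_ec, ec_mul_ee]

theorem xx_ec_comm {n : ℕ} (a p : Fin n) (j : I) :
    xx C a * ec C p j = ec C p j * xx C a := by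
  unfold ec
  rw [Finset.mul_sum, Finset.sum_mul]
  refine Finset.sum_congr rfl fun ν _ => ?_
  split_ifs <;> simp [(isRep_alg C n).xe]

theorem tt_ec {n : ℕ} (l : ℕ) (h : l + 1 < n) (p : Fin n) (j : I) :
    tt C l h * ec C p j =
      ec C (Equiv.swap (⟨l, Nat.lt_of_succ_lt h⟩ : Fin n) ⟨l + 1, h⟩ p) j * tt C l h := by
  apply ext_e
  intro ν
  rw [mul_assoc, ec_mul_ee, mul_assoc, (isRep_alg C n).taue, ← mul_assoc, ec_mul_ee]
  simp only [Function.comp, Equiv.swap_apply_self]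
  split_ifs
  · exact (isRep_alg C n).taue l h ν
  · simp

end KLR


namespace KLR

set_option linter.unusedSectionVars false
set_option linter.unusedSimpArgs false

variable {k : Type} [Field k] {I : Type} [Fintype I] [DecidableEq I] (C : CartanDatum k I)

theorem swap_castSucc {n : ℕ} (a b c : Fin n) :
    Equiv.swap a.castSucc b.castSucc c.castSucc = (Equiv.swap a b c).castSucc :=
  ((Fin.castSucc_injective n).map_swap a b c).symm

/-- The image of `e(ν)` under the unital embedding `R(n) → R(n+1)`. -/
noncomputable def eUp {n : ℕ} (ν : Fin n → I) : RA C (n + 1) := ∑ j, ee C (Fin.snoc ν j)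

theorem eUp_mul {n : ℕ} (ν : Fin n → I) (μ : Fin (n + 1) → I) :
    eUp C ν * ee C μ = if Fin.init μ = ν then ee C μ else 0 := by
  unfold eUp
  rw [Finset.sum_mul]
  by_cases h : Fin.init μ = ν
  · subst h
    rw [Finset.sum_eq_single (μ (Fin.last n))]
    · simp [ee_mul]
    · intro j _ hj
      rw [ee_mul, if_neg]
      intro h
      apply hj
      have := congrFun h (Fin.last n)
      simpa using this
    · simp
  · rw [if_neg h]
    refine Finset.sum_eq_zero fun j _ => ?_
    rw [ee_mul, if_neg]
    rintro rfl
    exact h (by simp)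

theorem isRep_up (n : ℕ) : IsRep C n (A := RA C (n + 1)) (eUp C) (fun a => xx C a.castSucc)
    (fun l h => tt C l (Nat.lt_succ_of_lt h)) where
  ee ν ν' := by
    apply ext_e
    intro μ
    rw [mul_assoc, eUp_mul]
    by_cases h : Fin.init μ = ν'
    · subst h
      by_cases h2 : ν = Fin.init μ
      · simp [h2]
      · simp [eUp_mul, h2, Ne.symm h2]
    · by_cases h2 : ν = ν'
      · subst h2; simp [h, eUp_mul]
      · simp [h, h2]
  esum := by
    apply ext_e
    intro μ
    rw [Finset.sum_mul]
    simp [eUp_mul]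
  xx a b := (isRep_alg C (n + 1)).xx _ _
  xe a ν := by
    unfold eUp
    rw [Finset.mul_sum, Finset.sum_mul]
    exact Finset.sum_congr rfl fun j _ => (isRep_alg C (n + 1)).xe _ _
  taue l h ν := by
    apply ext_e
    intro μ
    rw [mul_assoc, mul_assoc, eUp_mul, (isRep_alg C (n + 1)).taue, ← mul_assoc, eUp_mul]
    have key : (Fin.init (μ ∘ Equiv.swap (⟨l, Nat.lt_of_succ_lt (Nat.lt_succ_of_lt h)⟩ : Fin (n+1))
        ⟨l + 1, Nat.lt_succ_of_lt h⟩) = ν ∘ Equiv.swap (⟨l, Nat.lt_of_succ_lt h⟩ : Fin n) ⟨l + 1, h⟩)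
        ↔ Fin.init μ = ν := by
      have : Fin.init (μ ∘ Equiv.swap (⟨l, Nat.lt_of_succ_lt (Nat.lt_succ_of_lt h)⟩ : Fin (n+1))
        ⟨l + 1, Nat.lt_succ_of_lt h⟩) = (Fin.init μ) ∘
          Equiv.swap (⟨l, Nat.lt_of_succ_lt h⟩ : Fin n) ⟨l + 1, h⟩ := by
        funext c
        simp only [Fin.init, Function.comp]
        rw [← swap_castSucc]; rfl
      rw [this]
      constructor
      · intro h
        funext c
        have := congrFun h (Equiv.swap (⟨l, Nat.lt_of_succ_lt ‹_›⟩ : Fin n) ⟨l + 1, ‹_›⟩ c)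
        simpa using this
      · rintro rfl; rfl
    by_cases hh : Fin.init μ = ν
    · rw [if_pos hh, if_pos (key.2 hh), (isRep_alg C (n + 1)).taue]
    · rw [if_neg hh, if_neg (fun h' => hh (key.1 h'))]; simp
  tautau l h l' h' hl := (isRep_alg C (n + 1)).tautau _ _ _ _ hl
  tausq l h ν := by
    apply ext_e
    intro μ
    rw [mul_assoc, mul_assoc, eUp_mul]
    split_ifs with hh
    · subst hh
      exact (isRep_alg C (n + 1)).tausq _ _ _
    · simp
  taux l h m ν := by
    apply ext_e
    intro μ
    rw [mul_assoc, eUp_mul]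
    by_cases hh : Fin.init μ = ν
    · subst hh
      rw [if_pos rfl]
      have := (isRep_alg C (n + 1)).taux l (Nat.lt_succ_of_lt h) m.castSucc μ
      rw [show (⟨l, Nat.lt_of_succ_lt (Nat.lt_succ_of_lt h)⟩ : Fin (n+1)) =
        (⟨l, Nat.lt_of_succ_lt h⟩ : Fin n).castSucc from rfl,
        show (⟨l + 1, Nat.lt_succ_of_lt h⟩ : Fin (n+1)) =
        (⟨l + 1, h⟩ : Fin n).castSucc from rfl, swap_castSucc] at this
      rw [this]
      rw [ite_mul, ite_mul, neg_mul, eUp_mul, if_pos rfl, zero_mul]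
      simp only [Fin.castSucc_inj]
      rfl
    · rw [if_neg hh, ite_mul, ite_mul, neg_mul, eUp_mul, if_neg hh]
      simp
  braid l h ν := by
    apply ext_e
    intro μ
    rw [mul_assoc, eUp_mul]
    by_cases hh : Fin.init μ = ν
    · subst hh
      rw [if_pos rfl]
      have := (isRep_alg C (n + 1)).braid l (Nat.lt_succ_of_lt h) μ
      rw [this, ite_mul, mul_assoc, eUp_mul, if_pos rfl, zero_mul]
      rfl
    · rw [if_neg hh]
      split_ifs <;> simp [eUp_mul, hh, mul_assoc]

/-- The unital embedding `R(n) → R(n+1)`. -/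
noncomputable def up (n : ℕ) : RA C n →ₐ[k] RA C (n + 1) := liftA C (isRep_up C n)

theorem up_e {n : ℕ} (ν : Fin n → I) : up C n (ee C ν) = ∑ j, ee C (Fin.snoc ν j) :=
  liftA_e C _ ν
theorem up_x {n : ℕ} (a : Fin n) : up C n (xx C a) = xx C a.castSucc := liftA_x C _ a
theorem up_t {n : ℕ} (l : ℕ) (h : l + 1 < n) :
    up C n (tt C l h) = tt C l (Nat.lt_succ_of_lt h) := liftA_t C _ l h

theorem up_e_mul {n : ℕ} (ν : Fin n → I) (μ : Fin (n + 1) → I) :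
    up C n (ee C ν) * ee C μ = if Fin.init μ = ν then ee C μ else 0 := by
  rw [up_e]; exact eUp_mul C ν μ

theorem up_ec {n : ℕ} (p : Fin n) (j : I) : up C n (ec C p j) = ec C p.castSucc j := by
  apply ext_e
  intro μ
  rw [ec_mul_ee]
  unfold ec
  rw [map_sum, Finset.sum_mul, Finset.sum_eq_single (Fin.init μ)]
  · change _ = if Fin.init μ p = j then _ else _
    by_cases h : Fin.init μ p = j
    · rw [if_pos h, if_pos h, up_e_mul, if_pos rfl]
    · rw [if_neg h, if_neg h]; simp
  · intro ν _ hν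
    split_ifs
    · rw [up_e_mul, if_neg hν.symm]
    · simp
  · simp

/-- The last polynomial generator. -/
noncomputable def X (n : ℕ) : RA C (n + 1) := xx C (Fin.last n)
/-- The idempotent fixing the last color. -/
noncomputable def E (n : ℕ) (j : I) : RA C (n + 1) := ec C (Fin.last n) j
/-- The last intertwiner. -/
noncomputable def T (n : ℕ) : RA C (n + 2) := tt C n (Nat.lt_succ_self _)
/-- The idempotent where the last two colors agree. -/
noncomputable def EE (n : ℕ) : RA C (n + 2) := ∑ j, up C (n + 1) (E C n j) * E C (n + 1) j

theorem ee_eq (n : ℕ) (μ : Fin (n + 1) → I) :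
    ee C μ = up C n (ee C (Fin.init μ)) * E C n (μ (Fin.last n)) := by
  apply ext_e
  intro ν
  rw [mul_assoc, E, ec_mul_ee, ee_mul]
  by_cases h : μ = ν
  · subst h; rw [if_pos rfl, if_pos rfl, up_e_mul, if_pos rfl]
  · rw [if_neg h]
    split_ifs with h2
    · rw [up_e_mul, if_neg]
      intro h3
      apply h
      rw [← Fin.snoc_init_self μ, ← Fin.snoc_init_self ν, h3, h2]
    · simp

/-- Subalgebra of elements commuting with a given element. -/
theorem comm_of_gen {n : ℕ} {A : Type} [Ring A] [Algebra k A] (f : RA C n →ₐ[k] A) (c : A)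
    (he : ∀ ν, c * f (ee C ν) = f (ee C ν) * c)
    (hx : ∀ a, c * f (xx C a) = f (xx C a) * c)
    (ht : ∀ l h, c * f (tt C l h) = f (tt C l h) * c) (y : RA C n) : c * f y = f y * c := by
  have := alg_top C ((Subalgebra.centralizer k {c}).comap f)
    (fun ν => by simpa [Subalgebra.mem_centralizer_iff] using he ν)
    (fun a => by simpa [Subalgebra.mem_centralizer_iff] using hx a)
    (fun l h => by simpa [Subalgebra.mem_centralizer_iff] using ht l h) y
  simpa [Subalgebra.mem_centralizer_iff] using this

theorem taux0 {n : ℕ} (l : ℕ) (h : l + 1 < n) (m : Fin n) (h1 : m ≠ ⟨l, Nat.lt_of_succ_lt h⟩)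
    (h2 : m ≠ ⟨l + 1, h⟩) : tt C l h * xx C m = xx C m * tt C l h := by
  rw [← sub_eq_zero]
  apply ext_e
  intro ν
  have := (isRep_alg C n).taux l h m ν
  rw [Equiv.swap_apply_of_ne_of_ne h1 h2] at this
  rw [this]
  simp [h1, h2]

theorem X_up {n : ℕ} (y : RA C n) : X C n * up C n y = up C n y * X C n := by
  apply comm_of_gen
  · intro ν; rw [up_e, X, Finset.mul_sum, Finset.sum_mul]
    exact Finset.sum_congr rfl fun j _ => (isRep_alg C (n + 1)).xe _ _
  · intro a; rw [up_x]; exact (isRep_alg C (n + 1)).xx _ _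
  · intro l h; rw [up_t, X, taux0]
    · intro h'; have := congrArg Fin.val h'; simp at this; omega
    · intro h'; have := congrArg Fin.val h'; simp at this; omega

theorem E_up {n : ℕ} (j : I) (y : RA C n) : E C n j * up C n y = up C n y * E C n j := by
  apply comm_of_gen
  · intro ν; rw [up_e, E, Finset.mul_sum, Finset.sum_mul]
    exact Finset.sum_congr rfl fun j _ => (ee_ec_comm C _ _ _).symm
  · intro a; rw [up_x]; exact (xx_ec_comm C _ _ _).symm
  · intro l h; rw [up_t, E, tt_ec, Equiv.swap_apply_of_ne_of_ne]
    · intro h'; have := congrArg Fin.val h'; simp at this; omega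
    · intro h'; have := congrArg Fin.val h'; simp at this; omega

theorem X_E {n : ℕ} (j : I) : X C n * E C n j = E C n j * X C n := xx_ec_comm C _ _ _

theorem E_E {n : ℕ} (i j : I) : E C n i * E C n j = if i = j then E C n i else 0 :=
  ec_mul_ec C _ _ _

theorem E_sum (n : ℕ) : ∑ j, E C n j = 1 := ec_sum C _

theorem T_upup {n : ℕ} (y : RA C n) :
    T C n * up C (n + 1) (up C n y) = up C (n + 1) (up C n y) * T C n := by
  refine comm_of_gen C ((up C (n + 1)).comp (up C n)) (T C n) ?_ ?_ ?_ y
  · intro ν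
    simp only [AlgHom.comp_apply]
    apply ext_e
    intro μ
    have hs : Fin.init (Fin.init (μ ∘ Equiv.swap (⟨n, Nat.lt_of_succ_lt (Nat.lt_succ_self _)⟩ :
      Fin (n + 2)) ⟨n + 1, Nat.lt_succ_self _⟩)) = Fin.init (Fin.init μ) := by
      funext c
      simp only [Fin.init, Function.comp]
      rw [Equiv.swap_apply_of_ne_of_ne]
      · intro h'; have := congrArg Fin.val h'; simp at this; omega
      · intro h'; have := congrArg Fin.val h'; simp at this; omega
    have : ∀ μ : Fin (n+2) → I, up C (n + 1) (up C n (ee C ν)) * ee C μ =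
        if Fin.init (Fin.init μ) = ν then ee C μ else 0 := by
      intro μ
      rw [ee_eq C (n + 1) μ, ← mul_assoc, ← map_mul, up_e_mul]
      split_ifs <;> simp
    rw [mul_assoc, this, mul_assoc, T, (isRep_alg C (n+2)).taue, ← mul_assoc, this, hs]
    split_ifs
    · rw [(isRep_alg C (n+2)).taue]
    · simp
  · intro a
    simp only [AlgHom.comp_apply, up_x]
    rw [T, taux0]
    · intro h'; have := congrArg Fin.val h'; simp at this; omega
    · intro h'; have := congrArg Fin.val h'; simp at this; omega
  · intro l h
    simp only [AlgHom.comp_apply, up_t, T]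
    exact (isRep_alg C (n+2)).tautau _ _ _ _ (Or.inr (by omega))

end KLR


namespace KLR

set_option linter.unusedSectionVars false
set_option linter.unusedSimpArgs false
set_option autoImplicit false

variable {k : Type} [Field k] {I : Type} [Fintype I] [DecidableEq I] (C : CartanDatum k I)

theorem up_X (n : ℕ) : up C (n + 1) (X C n) = xx C (⟨n, Nat.lt_of_succ_lt (Nat.lt_succ_self _)⟩ :
    Fin (n + 2)) := up_x C _

theorem up_E (n : ℕ) (j : I) : up C (n + 1) (E C n j) =
    ec C (⟨n, Nat.lt_of_succ_lt (Nat.lt_succ_self _)⟩ : Fin (n + 2)) j := up_ec C _ _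

theorem EE_mul (n : ℕ) (ν : Fin (n + 2) → I) : EE C n * ee C ν =
    if ν ⟨n, Nat.lt_of_succ_lt (Nat.lt_succ_self _)⟩ = ν ⟨n + 1, Nat.lt_succ_self _⟩
      then ee C ν else 0 := by
  unfold EE
  rw [Finset.sum_mul]
  simp only [E, up_ec, mul_assoc, ec_mul_ee]
  rw [Finset.sum_eq_single (ν (Fin.last (n + 1)))]
  · rw [if_pos rfl, ec_mul_ee]; rfl
  · intro j _ hj
    rw [if_neg hj.symm]; simp
  · simp

theorem T_X1 (n : ℕ) : T C n * up C (n + 1) (X C n) = X C (n + 1) * T C n - EE C n := by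
  rw [eq_sub_iff_add_eq, ← eq_sub_iff_add_eq', ← neg_sub, ← neg_eq_iff_eq_neg]
  apply ext_e
  intro ν
  have := (isRep_alg C (n + 2)).taux n (Nat.lt_succ_self _)
    ⟨n, Nat.lt_of_succ_lt (Nat.lt_succ_self _)⟩ ν
  rw [Equiv.swap_apply_left] at this
  rw [neg_mul, EE_mul, up_X]
  refine Eq.trans ?_ this.symm
  split_ifs with h1 h2 h3 h4 <;> simp_all

theorem T_X2 (n : ℕ) : T C n * X C (n + 1) = up C (n + 1) (X C n) * T C n + EE C n := by
  rw [← sub_eq_iff_eq_add']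
  apply ext_e
  intro ν
  have := (isRep_alg C (n + 2)).taux n (Nat.lt_succ_self _) ⟨n + 1, Nat.lt_succ_self _⟩ ν
  rw [Equiv.swap_apply_right] at this
  rw [EE_mul, up_X]
  refine Eq.trans this ?_
  split_ifs with h1 h2 h3 h4 <;> simp_all

theorem T_E (n : ℕ) (j : I) : T C n * E C (n + 1) j = up C (n + 1) (E C n j) * T C n := by
  rw [up_E, T, E]
  have := tt_ec C n (Nat.lt_succ_self (n + 1)) (Fin.last (n + 1)) j
  rw [show (⟨n + 1, Nat.lt_succ_self (n + 1)⟩ : Fin (n + 2)) = Fin.last (n + 1) from rfl,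
    Equiv.swap_apply_right] at this
  exact this

theorem T_E' (n : ℕ) (j : I) : T C n * up C (n + 1) (E C n j) = E C (n + 1) j * T C n := by
  rw [up_E, T, E]
  have := tt_ec C n (Nat.lt_succ_self (n + 1))
    ⟨n, Nat.lt_of_succ_lt (Nat.lt_succ_self (n + 1))⟩ j
  rw [Equiv.swap_apply_left] at this
  exact this

theorem T_sq (n : ℕ) (a b : I) : T C n * T C n * (up C (n + 1) (E C n a) * E C (n + 1) b) =
    Qel C a b (up C (n + 1) (X C n)) (X C (n + 1)) * (up C (n + 1) (E C n a) * E C (n + 1) b) := by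
  apply ext_e
  intro ν
  simp only [mul_assoc, E, ec_mul_ee, up_ec]
  split_ifs with h
  · rw [ec_mul_ee]
    split_ifs with h2
    · subst h h2
      rw [← mul_assoc, ← pow_two, T, (isRep_alg C (n + 2)).tausq, up_X]
      rfl
    · simp
  · simp

/-- The braid correction term. -/
noncomputable def Dd (n : ℕ) : RA C (n + 3) :=
  ∑ a, ∑ b, Qdiff C a b (up C (n + 2) (up C (n + 1) (X C n))) (up C (n + 2) (X C (n + 1)))
    (X C (n + 2)) *
    (up C (n + 2) (up C (n + 1) (E C n a)) * (up C (n + 2) (E C (n + 1) b) * E C (n + 2) a))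

theorem braid' (n : ℕ) : T C (n + 1) * up C (n + 2) (T C n) * T C (n + 1) =
    up C (n + 2) (T C n) * T C (n + 1) * up C (n + 2) (T C n) + Dd C n := by
  rw [← sub_eq_iff_eq_add']
  apply ext_e
  intro ν
  have := (isRep_alg C (n + 3)).braid n (Nat.lt_succ_self _) ν
  rw [T, T, up_t]
  refine this.trans ?_
  unfold Dd
  simp only [Finset.sum_mul, mul_assoc, E, ec_mul_ee, up_ec, X, up_x]
  rw [Finset.sum_eq_single (ν (Fin.last (n + 2)))]
  · rw [if_pos rfl, Finset.sum_eq_single (ν (Fin.last (n + 1)).castSucc)]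
    · rw [ec_mul_ee, if_pos rfl, ec_mul_ee]
      by_cases h : ν ⟨n, Nat.lt_of_succ_lt (Nat.lt_of_succ_lt (Nat.lt_succ_self _))⟩ =
        ν ⟨n + 2, Nat.lt_succ_self _⟩
      · rw [if_pos h]
        have h' : ν (Fin.last n).castSucc.castSucc = ν (Fin.last (n + 2)) := h
        rw [if_pos h', ← h']
        rfl
      · rw [if_neg h]
        have h' : ¬ ν (Fin.last n).castSucc.castSucc = ν (Fin.last (n + 2)) := h
        rw [if_neg h']
        simp
    · intro b _ hb
      rw [ec_mul_ee, if_neg hb.symm]; simp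
    · simp
  · intro b _ hb
    rw [if_neg hb.symm]; simp
  · simp

/-- A subalgebra containing the lower algebra and the new generators is everything. -/
theorem alg_top_succ {n : ℕ} (S : Subalgebra k (RA C (n + 2)))
    (hu : ∀ y, up C (n + 1) y ∈ S) (hX : X C (n + 1) ∈ S) (hE : ∀ j, E C (n + 1) j ∈ S)
    (hT : T C n ∈ S) : ∀ y, y ∈ S := by
  apply alg_top
  · intro ν; rw [ee_eq]; exact S.mul_mem (hu _) (hE _)
  · intro a
    induction a using Fin.lastCases with
    | last => exact hX
    | cast a => rw [← up_x]; exact hu _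
  · intro l h
    by_cases h' : l + 1 < n + 1
    · have := hu (tt C l h')
      rwa [up_t] at this
    · obtain rfl : l = n := by omega
      exact hT

theorem alg_top_one (S : Subalgebra k (RA C 1))
    (hX : X C 0 ∈ S) (hE : ∀ j, E C 0 j ∈ S) : ∀ y, y ∈ S := by
  apply alg_top
  · intro ν
    rw [ee_eq]
    have h1 : up C 0 (ee C (Fin.init ν)) = 1 := by
      have := (isRep_alg C 0).esum
      rw [Fintype.sum_subsingleton _ (Fin.init ν)] at this
      rw [this, map_one]
    rw [h1, one_mul]
    exact hE _
  · intro a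
    obtain rfl : a = Fin.last 0 := Subsingleton.elim _ _
    exact hX
  · intro l h; omega

theorem alg_zero (y : RA C 0) : ∃ c : k, y = algebraMap k _ c := by
  have : y ∈ (⊥ : Subalgebra k (RA C 0)) := by
    apply alg_top
    · intro ν
      have := (isRep_alg C 0).esum
      rw [Fintype.sum_subsingleton _ ν] at this
      rw [this]; exact Subalgebra.one_mem _
    · intro a; exact a.elim0
    · intro l h; omega
  obtain ⟨c, hc⟩ := Algebra.mem_bot.1 this
  exact ⟨c, hc.symm⟩

theorem EE_up_E (n : ℕ) (a b : I) : EE C n * (up C (n + 1) (E C n a) * E C (n + 1) b) =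
    if a = b then up C (n + 1) (E C n a) * E C (n + 1) b else 0 := by
  unfold EE
  rw [Finset.sum_mul, Finset.sum_eq_single b]
  · rw [mul_assoc, ← mul_assoc (E C (n+1) b), E_up, mul_assoc, E_E, if_pos rfl, ← mul_assoc,
      ← map_mul, E_E]
    split_ifs with h1 h2 h3
    · rw [h1]
    · exact absurd h1.symm h2
    · exact absurd h3.symm h1
    · simp
  · intro j _ hj
    rw [mul_assoc, ← mul_assoc (E C (n+1) j), E_up, mul_assoc, E_E, if_neg hj]; simp
  · simp

theorem EE_X2 (n : ℕ) : EE C n * X C (n + 1) = X C (n + 1) * EE C n := by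
  unfold EE
  rw [Finset.sum_mul, Finset.mul_sum]
  refine Finset.sum_congr rfl fun j _ => ?_
  rw [mul_assoc, ← X_E, ← mul_assoc, ← mul_assoc, X_up]

theorem EE_X1 (n : ℕ) : EE C n * up C (n + 1) (X C n) = up C (n + 1) (X C n) * EE C n := by
  unfold EE
  rw [Finset.sum_mul, Finset.mul_sum]
  refine Finset.sum_congr rfl fun j _ => ?_
  rw [mul_assoc, E_up, ← mul_assoc, ← map_mul, ← X_E, map_mul, mul_assoc]

theorem EE_T (n : ℕ) : EE C n * T C n = T C n * EE C n := by
  unfold EE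
  rw [Finset.sum_mul, Finset.mul_sum]
  refine Finset.sum_congr rfl fun j _ => ?_
  rw [mul_assoc, ← T_E', ← mul_assoc, ← T_E, mul_assoc, ← E_up]

end KLR


namespace KLR

set_option linter.unusedSectionVars false
set_option linter.unusedSimpArgs false
set_option autoImplicit false

variable {k : Type} [Field k] {I : Type} [Fintype I] [DecidableEq I] (C : CartanDatum k I)

theorem cXu {n : ℕ} (y : RA C n) : Commute (X C n) (up C n y) := X_up C y
theorem cEu {n : ℕ} (j : I) (y : RA C n) : Commute (E C n j) (up C n y) := E_up C j y
theorem cXE {n : ℕ} (j : I) : Commute (X C n) (E C n j) := X_E C j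
theorem cTuu {n : ℕ} (y : RA C n) : Commute (T C n) (up C (n + 1) (up C n y)) := T_upup C y

/-- The standard spanning monomials of the polynomial-type part. -/
noncomputable def pm {n : ℕ} (r : RA C n) (m : ℕ) (j : I) : RA C (n + 1) :=
  up C n r * (X C n ^ m * E C n j)

theorem pm_mul {n : ℕ} (r r' : RA C n) (m m' : ℕ) (j j' : I) :
    pm C r m j * pm C r' m' j' = if j = j' then pm C (r * r') (m + m') j else 0 := by
  have : pm C r m j * pm C r' m' j' =
      up C n (r * r') * (X C n ^ (m + m') * (E C n j * E C n j')) := by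
    unfold pm
    rw [map_mul, pow_add]
    have h1 := ((cXu C r').pow_left m).eq
    have h2 := (cEu C j r').eq
    have h3 := ((cXE (n := n) C j).pow_left m').eq
    simp only [mul_assoc]
    rw [← mul_assoc (E C n j) (up C n r'), h2]
    simp only [mul_assoc]
    rw [← mul_assoc (X C n ^ m) (up C n r'), h1]
    simp only [mul_assoc]
    rw [← mul_assoc (E C n j) (X C n ^ m'), ← h3]
    simp only [mul_assoc]
  rw [this, E_E]
  split_ifs
  · rfl
  · simp

/-- The span of the monomials. -/
noncomputable def PS (n : ℕ) : Submodule k (RA C (n + 1)) :=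
  Submodule.span k {y | ∃ (r : RA C n) (m : ℕ) (j : I), y = pm C r m j}

theorem pm_mem {n : ℕ} (r : RA C n) (m : ℕ) (j : I) : pm C r m j ∈ PS C n :=
  Submodule.subset_span ⟨r, m, j, rfl⟩

theorem upX_mem {n : ℕ} (r : RA C n) (m : ℕ) : up C n r * X C n ^ m ∈ PS C n := by
  have : up C n r * X C n ^ m = ∑ j, pm C r m j := by
    unfold pm
    rw [← Finset.mul_sum, ← Finset.mul_sum, E_sum, mul_one]
  rw [this]
  exact Submodule.sum_mem _ fun j _ => pm_mem C r m j

/-- The subalgebra generated by `R(n)` and the last polynomial generator and idempotents. -/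
noncomputable def P (n : ℕ) : Subalgebra k (RA C (n + 1)) :=
  (PS C n).toSubalgebra (by simpa using upX_mem C (1 : RA C n) 0) (by
    intro x y hx hy
    induction hx using Submodule.span_induction with
    | mem x hx =>
      obtain ⟨r, m, j, rfl⟩ := hx
      induction hy using Submodule.span_induction with
      | mem y hy =>
        obtain ⟨r', m', j', rfl⟩ := hy
        rw [pm_mul]
        split_ifs
        · exact pm_mem C _ _ _
        · exact Submodule.zero_mem _
      | zero => simp
      | add _ _ _ _ h1 h2 => rw [mul_add]; exact Submodule.add_mem _ h1 h2
      | smul c _ _ h => rw [mul_smul_comm]; exact Submodule.smul_mem _ _ h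
    | zero => simp
    | add _ _ _ _ h1 h2 => rw [add_mul]; exact Submodule.add_mem _ h1 h2
    | smul c _ _ h => rw [smul_mul_assoc]; exact Submodule.smul_mem _ _ h)

theorem mem_P {n : ℕ} {y : RA C (n + 1)} : y ∈ P C n ↔ y ∈ PS C n := Iff.rfl

@[elab_as_elim]
theorem P_induction {n : ℕ} {p : RA C (n + 1) → Prop} (hpm : ∀ r m j, p (pm C r m j))
    (h0 : p 0) (hadd : ∀ x y, p x → p y → p (x + y)) (hsmul : ∀ (c : k) x, p x → p (c • x))
    {y : RA C (n + 1)} (hy : y ∈ P C n) : p y := by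
  have hy' : y ∈ PS C n := hy
  clear hy
  induction hy' using Submodule.span_induction with
  | mem x hx => obtain ⟨r, m, j, rfl⟩ := hx; exact hpm r m j
  | zero => exact h0
  | add x y _ _ hx hy => exact hadd x y hx hy
  | smul c x _ hx => exact hsmul c x hx

theorem up_mem_P {n : ℕ} (r : RA C n) : up C n r ∈ P C n := (mem_P C).2 <| by
  simpa using upX_mem C r 0
theorem X_mem_P (n : ℕ) : X C n ∈ P C n := (mem_P C).2 <| by
  simpa using upX_mem C (1 : RA C n) 1
theorem E_mem_P (n : ℕ) (j : I) : E C n j ∈ P C n := (mem_P C).2 <| by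
  simpa [pm] using pm_mem C (1 : RA C n) 0 j

/-- A subalgebra containing the generators contains `P`. -/
theorem P_le {n : ℕ} (S : Subalgebra k (RA C (n + 1))) (hu : ∀ y, up C n y ∈ S)
    (hX : X C n ∈ S) (hE : ∀ j, E C n j ∈ S) {y : RA C (n + 1)} (hy : y ∈ P C n) : y ∈ S := by
  refine P_induction C ?_ S.zero_mem (fun _ _ => S.add_mem) (fun c _ h => S.smul_mem h c) hy
  intro r m j
  exact S.mul_mem (hu r) (S.mul_mem (S.pow_mem hX m) (hE j))

theorem EE_mem_P (n : ℕ) : EE C n ∈ P C (n + 1) :=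
  Subalgebra.sum_mem _ fun j _ => Subalgebra.mul_mem _ (up_mem_P C _) (E_mem_P C _ j)

theorem Qel_mem {A : Type} [Ring A] [Algebra k A] (S : Subalgebra k A) (i j : I) {u v : A}
    (hu : u ∈ S) (hv : v ∈ S) : Qel C i j u v ∈ S := by
  unfold Qel
  split_ifs
  · exact S.zero_mem
  · refine S.sum_mem fun p _ => S.sum_mem fun q _ => ?_
    split_ifs
    · exact S.smul_mem (S.mul_mem (S.pow_mem hu _) (S.pow_mem hv _)) _
    · exact S.zero_mem

theorem Qdiff_mem {A : Type} [Ring A] [Algebra k A] (S : Subalgebra k A) (i j : I) {u v w : A}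
    (hu : u ∈ S) (hv : v ∈ S) (hw : w ∈ S) : Qdiff C i j u v w ∈ S := by
  unfold Qdiff
  split_ifs
  · exact S.zero_mem
  · refine S.sum_mem fun p _ => S.sum_mem fun q _ => ?_
    split_ifs
    · exact S.smul_mem (S.mul_mem (S.sum_mem fun c _ => S.mul_mem (S.pow_mem hu _)
        (S.pow_mem hw _)) (S.pow_mem hv _)) _
    · exact S.zero_mem

theorem TT_eq (n : ℕ) : T C n * T C n = ∑ a, ∑ b,
    Qel C a b (up C (n + 1) (X C n)) (X C (n + 1)) *
      (up C (n + 1) (E C n a) * E C (n + 1) b) := by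
  simp only [← T_sq, ← Finset.mul_sum]
  simp only [E_sum, mul_one, ← Finset.sum_mul, ← map_sum, map_one]

theorem TT_mem (n : ℕ) : T C n * T C n ∈ P C (n + 1) := by
  rw [TT_eq]
  exact Subalgebra.sum_mem _ fun a _ => Subalgebra.sum_mem _ fun b _ => Subalgebra.mul_mem _
    (Qel_mem C _ _ _ (up_mem_P C _) (X_mem_P C _))
    (Subalgebra.mul_mem _ (up_mem_P C _) (E_mem_P C _ _))

theorem Dd_mem (n : ℕ) : Dd C n ∈ P C (n + 2) := by
  unfold Dd
  exact Subalgebra.sum_mem _ fun a _ => Subalgebra.sum_mem _ fun b _ => Subalgebra.mul_mem _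
    (Qdiff_mem C _ _ _ (up_mem_P C _) (up_mem_P C _) (X_mem_P C _))
    (Subalgebra.mul_mem _ (up_mem_P C _) (Subalgebra.mul_mem _ (up_mem_P C _) (E_mem_P C _ _)))

/-- Moving `τ` past `P` to the right. -/
theorem T_P {n : ℕ} {p : RA C (n + 1)} (hp : p ∈ P C n) :
    ∃ q ∈ P C (n + 1), ∃ q' ∈ P C (n + 1), T C n * up C (n + 1) p = q * T C n + q' := by
  let S : Subalgebra k (RA C (n + 1)) :=
  { carrier := {p | ∃ q ∈ P C (n + 1), ∃ q' ∈ P C (n + 1),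
      T C n * up C (n + 1) p = q * T C n + q'}
    mul_mem' := by
      rintro a b ⟨q, hq, q', hq', h⟩ ⟨s, hs, s', hs', h'⟩
      refine ⟨q * s, mul_mem hq hs, q * s' + q' * up C (n + 1) b,
        add_mem (mul_mem hq hs') (mul_mem hq' (up_mem_P C _)), ?_⟩
      rw [map_mul, ← mul_assoc, h, add_mul, mul_assoc, h', mul_add]
      noncomm_ring
    add_mem' := by
      rintro a b ⟨q, hq, q', hq', h⟩ ⟨s, hs, s', hs', h'⟩
      refine ⟨q + s, add_mem hq hs, q' + s', add_mem hq' hs', ?_⟩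
      rw [map_add, mul_add, h, h']
      noncomm_ring
    algebraMap_mem' := by
      intro r
      refine ⟨algebraMap k _ r, Subalgebra.algebraMap_mem _ _, 0, Subalgebra.zero_mem _, ?_⟩
      rw [AlgHom.commutes, add_zero, Algebra.commutes] }
  refine P_le C S ?_ ?_ ?_ hp
  · intro y
    exact ⟨_, up_mem_P C _, 0, Subalgebra.zero_mem _, by rw [T_upup, add_zero]⟩
  · exact ⟨_, X_mem_P C _, -EE C n, neg_mem (EE_mem_P C n), by rw [T_X1, sub_eq_add_neg]⟩
  · intro j
    exact ⟨_, E_mem_P C _ j, 0, Subalgebra.zero_mem _, by rw [T_E', add_zero]⟩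

/-- Moving `τ` past `P` to the left. -/
theorem P_T {n : ℕ} {p : RA C (n + 1)} (hp : p ∈ P C n) :
    ∃ q ∈ P C (n + 1), ∃ q' ∈ P C (n + 1), up C (n + 1) p * T C n = T C n * q + q' := by
  let S : Subalgebra k (RA C (n + 1)) :=
  { carrier := {p | ∃ q ∈ P C (n + 1), ∃ q' ∈ P C (n + 1),
      up C (n + 1) p * T C n = T C n * q + q'}
    mul_mem' := by
      rintro a b ⟨q, hq, q', hq', h⟩ ⟨s, hs, s', hs', h'⟩
      refine ⟨q * s, mul_mem hq hs, q' * s + up C (n + 1) a * s',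
        add_mem (mul_mem hq' hs) (mul_mem (up_mem_P C _) hs'), ?_⟩
      rw [map_mul, mul_assoc, h', mul_add, ← mul_assoc, h]
      noncomm_ring
    add_mem' := by
      rintro a b ⟨q, hq, q', hq', h⟩ ⟨s, hs, s', hs', h'⟩
      refine ⟨q + s, add_mem hq hs, q' + s', add_mem hq' hs', ?_⟩
      rw [map_add, add_mul, h, h']
      noncomm_ring
    algebraMap_mem' := by
      intro r
      refine ⟨algebraMap k _ r, Subalgebra.algebraMap_mem _ _, 0, Subalgebra.zero_mem _, ?_⟩
      rw [AlgHom.commutes, add_zero, Algebra.commutes] }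
  refine P_le C S ?_ ?_ ?_ hp
  · intro y
    exact ⟨_, up_mem_P C _, 0, Subalgebra.zero_mem _, by rw [T_upup, add_zero]⟩
  · exact ⟨_, X_mem_P C _, -EE C n, neg_mem (EE_mem_P C n), by
      rw [T_X2, add_neg_cancel_right]⟩
  · intro j
    exact ⟨_, E_mem_P C _ j, 0, Subalgebra.zero_mem _, by rw [T_E, add_zero]⟩

/-- The candidate decomposition of `R(n+2)`. -/
noncomputable def VS (n : ℕ) : Submodule k (RA C (n + 2)) :=
  PS C (n + 1) ⊔ Submodule.span k {y | ∃ r s : RA C (n + 1), y = up C _ r * T C n * up C _ s}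

@[elab_as_elim]
theorem VS_induction {n : ℕ} {p : RA C (n + 2) → Prop} (hpm : ∀ r m j, p (pm C r m j))
    (ht : ∀ r s, p (up C _ r * T C n * up C _ s))
    (h0 : p 0) (hadd : ∀ x y, p x → p y → p (x + y)) (hsmul : ∀ (c : k) x, p x → p (c • x))
    {y : RA C (n + 2)} (hy : y ∈ VS C n) : p y := by
  obtain ⟨a, ha, b, hb, rfl⟩ := Submodule.mem_sup.1 hy
  refine hadd _ _ (P_induction C hpm h0 hadd hsmul ha) ?_
  clear hy
  induction hb using Submodule.span_induction with
  | mem x hx => obtain ⟨r, s, rfl⟩ := hx; exact ht r s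
  | zero => exact h0
  | add x y _ _ hx hy => exact hadd x y hx hy
  | smul c x _ hx => exact hsmul c x hx

theorem P_mem_VS {n : ℕ} {y : RA C (n + 2)} (hy : y ∈ P C (n + 1)) : y ∈ VS C n :=
  Submodule.mem_sup_left hy
theorem T_mem_VS {n : ℕ} (r s : RA C (n + 1)) : up C _ r * T C n * up C _ s ∈ VS C n :=
  Submodule.mem_sup_right (Submodule.subset_span ⟨r, s, rfl⟩)

theorem VS_up {n : ℕ} (r : RA C (n + 1)) {y : RA C (n + 2)} (hy : y ∈ VS C n) :
    y * up C _ r ∈ VS C n := by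
  refine VS_induction C ?_ ?_ ?_ ?_ ?_ hy
  · intro s m j
    exact P_mem_VS C (mul_mem (mem_P C |>.2 (pm_mem C _ _ _)) (up_mem_P C _))
  · intro s s'
    rw [mul_assoc, ← map_mul]; exact T_mem_VS C _ _
  · simp
  · intro a b ha hb; rw [add_mul]; exact add_mem ha hb
  · intro c a ha; rw [smul_mul_assoc]; exact Submodule.smul_mem _ _ ha

theorem VS_X {n : ℕ} {y : RA C (n + 2)} (hy : y ∈ VS C n) : y * X C (n + 1) ∈ VS C n := by
  refine VS_induction C ?_ ?_ ?_ ?_ ?_ hy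
  · intro s m j
    exact P_mem_VS C (mul_mem (mem_P C |>.2 (pm_mem C _ _ _)) (X_mem_P C _))
  · intro s s'
    rw [mul_assoc, ← X_up, mul_assoc, ← mul_assoc (T C n), T_X2, add_mul, mul_add]
    refine add_mem ?_ ?_
    · rw [← mul_assoc, ← mul_assoc, ← map_mul]; exact T_mem_VS C _ _
    · exact P_mem_VS C (mul_mem (up_mem_P C _) (mul_mem (EE_mem_P C _) (up_mem_P C _)))
  · simp
  · intro a b ha hb; rw [add_mul]; exact add_mem ha hb
  · intro c a ha; rw [smul_mul_assoc]; exact Submodule.smul_mem _ _ ha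

theorem VS_E {n : ℕ} (j : I) {y : RA C (n + 2)} (hy : y ∈ VS C n) :
    y * E C (n + 1) j ∈ VS C n := by
  refine VS_induction C ?_ ?_ ?_ ?_ ?_ hy
  · intro s m j
    exact P_mem_VS C (mul_mem (mem_P C |>.2 (pm_mem C _ _ _)) (E_mem_P C _ _))
  · intro s s'
    rw [mul_assoc, ← E_up, mul_assoc, ← mul_assoc (T C n), T_E]
    rw [← mul_assoc, ← mul_assoc, ← map_mul]; exact T_mem_VS C _ _
  · simp
  · intro a b ha hb; rw [add_mul]; exact add_mem ha hb
  · intro c a ha; rw [smul_mul_assoc]; exact Submodule.smul_mem _ _ ha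

theorem up_VS {n : ℕ} (r : RA C (n + 1)) {y : RA C (n + 2)} (hy : y ∈ VS C n) :
    up C _ r * y ∈ VS C n := by
  refine VS_induction C ?_ ?_ ?_ ?_ ?_ hy
  · intro s m j
    exact P_mem_VS C (mul_mem (up_mem_P C _) (mem_P C |>.2 (pm_mem C _ _ _)))
  · intro s s'
    rw [← mul_assoc, ← mul_assoc, ← map_mul]; exact T_mem_VS C _ _
  · simp
  · intro a b ha hb; rw [mul_add]; exact add_mem ha hb
  · intro c a ha; rw [mul_smul_comm]; exact Submodule.smul_mem _ _ ha

theorem X_VS {n : ℕ} {y : RA C (n + 2)} (hy : y ∈ VS C n) : X C (n + 1) * y ∈ VS C n := by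
  refine VS_induction C ?_ ?_ ?_ ?_ ?_ hy
  · intro s m j
    exact P_mem_VS C (mul_mem (X_mem_P C _) (mem_P C |>.2 (pm_mem C _ _ _)))
  · intro s s'
    rw [← mul_assoc, ← mul_assoc, X_up, mul_assoc (up C _ s), ← add_sub_cancel_right (X C _ * _) (EE C n)]
    rw [add_sub_right_comm, ← T_X1, mul_add, add_mul]
    refine add_mem ?_ ?_
    · simp only [mul_assoc]; rw [← map_mul, ← mul_assoc]; exact T_mem_VS C _ _
    · exact P_mem_VS C (mul_mem (mul_mem (up_mem_P C _) (EE_mem_P C _)) (up_mem_P C _))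
  · simp
  · intro a b ha hb; rw [mul_add]; exact add_mem ha hb
  · intro c a ha; rw [mul_smul_comm]; exact Submodule.smul_mem _ _ ha

theorem E_VS {n : ℕ} (j : I) {y : RA C (n + 2)} (hy : y ∈ VS C n) :
    E C (n + 1) j * y ∈ VS C n := by
  refine VS_induction C ?_ ?_ ?_ ?_ ?_ hy
  · intro s m j
    exact P_mem_VS C (mul_mem (E_mem_P C _ _) (mem_P C |>.2 (pm_mem C _ _ _)))
  · intro s s'
    rw [← mul_assoc, ← mul_assoc, E_up, mul_assoc (up C _ s), ← T_E']
    simp only [mul_assoc]; rw [← map_mul, ← mul_assoc]; exact T_mem_VS C _ _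
  · simp
  · intro a b ha hb; rw [mul_add]; exact add_mem ha hb
  · intro c a ha; rw [mul_smul_comm]; exact Submodule.smul_mem _ _ ha

theorem P_VS {n : ℕ} {p : RA C (n + 2)} (hp : p ∈ P C (n + 1)) :
    ∀ y : RA C (n + 2), y ∈ VS C n → p * y ∈ VS C n := by
  refine P_induction C ?_ ?_ ?_ ?_ hp
  · intro r m j y hy
    unfold pm
    rw [mul_assoc, mul_assoc]
    apply up_VS
    have := E_VS C j hy
    clear hy
    generalize E C (n + 1) j * y = z at this
    induction m with
    | zero => simpa
    | succ m ih => rw [pow_succ', mul_assoc]; exact X_VS C ih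
  · intro y hy; simp
  · intro a b ha hb y hy; rw [add_mul]; exact add_mem (ha _ hy) (hb _ hy)
  · intro c a ha y hy; rw [smul_mul_assoc]; exact Submodule.smul_mem _ _ (ha _ hy)

theorem VS_P {n : ℕ} {p : RA C (n + 2)} (hp : p ∈ P C (n + 1)) :
    ∀ y : RA C (n + 2), y ∈ VS C n → y * p ∈ VS C n := by
  refine P_induction C ?_ ?_ ?_ ?_ hp
  · intro r m j y hy
    unfold pm
    rw [← mul_assoc, ← mul_assoc]
    apply VS_E
    have := VS_up C r hy
    clear hy
    generalize y * up C (n + 1) r = z at this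
    induction m with
    | zero => simpa
    | succ m ih => rw [pow_succ, ← mul_assoc]; exact VS_X C ih
  · intro y hy; simp
  · intro a b ha hb y hy; rw [mul_add]; exact add_mem (ha _ hy) (hb _ hy)
  · intro c a ha y hy; rw [mul_smul_comm]; exact Submodule.smul_mem _ _ (ha _ hy)

theorem P_zero_top (y : RA C 1) : y ∈ P C 0 := alg_top_one C _ (X_mem_P C 0) (E_mem_P C 0) y

theorem T_VS_aux {n : ℕ} {s : RA C (n + 1)} {r : RA C (n + 1)} (hr : r ∈ P C n) :
    T C n * (up C _ r * T C n * up C _ s) ∈ VS C n := by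
  obtain ⟨q, hq, q', hq', h⟩ := T_P C hr
  rw [← mul_assoc, ← mul_assoc, h, add_mul, add_mul]
  refine add_mem ?_ ?_
  · rw [mul_assoc q]
    exact P_mem_VS C (mul_mem (mul_mem hq (TT_mem C n)) (up_mem_P C _))
  · rw [mul_assoc]
    refine P_VS C hq' _ ?_
    simpa using T_mem_VS C 1 s

theorem T_VS {n : ℕ} (hn : ∀ r : RA C (n + 1), ∀ s, T C n * (up C _ r * T C n * up C _ s) ∈ VS C n)
    {y : RA C (n + 2)} (hy : y ∈ VS C n) : T C n * y ∈ VS C n := by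
  refine VS_induction C ?_ ?_ ?_ ?_ ?_ hy
  · intro r m j
    have h1 : T C n * up C _ r ∈ VS C n := by simpa using T_mem_VS C 1 r
    have h2 : X C (n + 1) ^ m * E C (n + 1) j ∈ P C (n + 1) :=
      mul_mem (pow_mem (X_mem_P C _) _) (E_mem_P C _ _)
    unfold pm
    rw [← mul_assoc]
    exact VS_P C h2 _ h1
  · exact hn
  · simp
  · intro a b ha hb; rw [mul_add]; exact add_mem ha hb
  · intro c a ha; rw [mul_smul_comm]; exact Submodule.smul_mem _ _ ha

theorem VS_top_of {n : ℕ}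
    (hn : ∀ r : RA C (n + 1), ∀ s, T C n * (up C _ r * T C n * up C _ s) ∈ VS C n)
    (y : RA C (n + 2)) : y ∈ VS C n := by
  let S : Subalgebra k (RA C (n + 2)) :=
  { carrier := {y | ∀ z ∈ VS C n, y * z ∈ VS C n}
    mul_mem' := by
      intro a b ha hb z hz
      rw [mul_assoc]; exact ha _ (hb _ hz)
    add_mem' := by
      intro a b ha hb z hz
      rw [add_mul]; exact add_mem (ha _ hz) (hb _ hz)
    algebraMap_mem' := by
      intro r z hz
      rw [← Algebra.smul_def]; exact Submodule.smul_mem _ _ hz }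
  have := alg_top_succ C S (fun y z hz => up_VS C y hz) (fun z hz => X_VS C hz)
    (fun j z hz => E_VS C j hz) (fun z hz => T_VS C hn hz) y 1 (P_mem_VS C (one_mem _))
  simpa using this

theorem VS_top : ∀ (n : ℕ) (y : RA C (n + 2)), y ∈ VS C n := by
  intro n
  induction n with
  | zero =>
    apply VS_top_of
    intro r s
    exact T_VS_aux C (P_zero_top C r)
  | succ n ih =>
    apply VS_top_of
    intro r s
    refine VS_induction C ?_ ?_ ?_ ?_ ?_ (ih r)
    · intro r m j; exact T_VS_aux C (pm_mem C r m j)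
    · intro r0 s0
      have : T C (n + 1) * (up C (n + 1 + 1) (up C (n + 1) r0 * T C n * up C (n + 1) s0) *
          T C (n + 1) * up C (n + 1 + 1) s) = up C (n + 2) (up C (n + 1) r0) *
          (T C (n + 1) * up C (n + 2) (T C n) * T C (n + 1)) *
            up C (n + 2) (up C (n + 1) s0 * s) := by
        simp only [map_mul]
        have h1 := T_upup C r0
        have h2 := T_upup C s0
        simp only [mul_assoc]
        rw [← mul_assoc (T C (n + 1)) (up C _ (up C _ r0)), h1,
          ← mul_assoc (up C _ (up C _ s0)) (T C (n + 1)), ← h2]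
        simp only [mul_assoc]
      rw [this, braid', mul_add, add_mul]
      refine add_mem ?_ ?_
      · rw [mul_assoc (up C _ _) (T C _) _, ← mul_assoc, ← mul_assoc, ← map_mul, mul_assoc, ← map_mul]
        exact T_mem_VS C _ _
      · exact P_mem_VS C (mul_mem (mul_mem (up_mem_P C _) (Dd_mem C _)) (up_mem_P C _))
    · simp
    · intro a b ha hb
      simp only [map_add, mul_add, add_mul] at ha hb ⊢; exact add_mem ha hb
    · intro c a ha
      simp only [map_smul, mul_smul_comm, smul_mul_assoc] at ha ⊢
      exact Submodule.smul_mem _ _ ha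

end KLR


namespace KLR

set_option linter.unusedSectionVars false
set_option linter.unusedSimpArgs false
set_option autoImplicit false

variable {k : Type} [Field k] {I : Type} [Fintype I] [DecidableEq I] (C : CartanDatum k I)

theorem Qel_comm {A : Type} [CommRing A] [Algebra k A] (i j : I) (u v : A) :
    Qel C i j u v = Qel C j i v u := by
  unfold Qel
  by_cases h : i = j
  · simp [h]
  · rw [if_neg h, if_neg (Ne.symm h), Finset.sum_comm]
    refine Finset.sum_congr rfl fun q _ => Finset.sum_congr rfl fun p _ => ?_
    rw [C.t_symm i j, C.symmetrize i j, mul_comm (u ^ p), add_comm]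

theorem Qdiff_mul {A : Type} [CommRing A] [Algebra k A] (i j : I) (u v w : A) :
    Qdiff C i j u v w * (u - w) = Qel C i j u v - Qel C i j w v := by
  unfold Qdiff Qel
  by_cases h : i = j
  · simp [h]
  · simp only [if_neg h, Finset.sum_mul, ← Finset.sum_sub_distrib]
    refine Finset.sum_congr rfl fun p _ => Finset.sum_congr rfl fun q _ => ?_
    split_ifs
    · rw [smul_mul_assoc, ← Finset.sum_mul, mul_right_comm, Commute.geom_sum₂_mul (Commute.all _ _), ← smul_sub, sub_mul]
    · simp

/-- The big field. -/
abbrev KK (k : Type) [Field k] : Type := AlgebraicClosure k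

/-- Distinct scalars. -/
noncomputable def Xv (k : Type) [Field k] : ℕ ↪ KK k :=
  haveI : Infinite (KK k) := IsAlgClosed.instInfinite
  Infinite.natEmbedding (KK k)

/-- Letters. -/
abbrev Let (I : Type) := ℕ × I

/-- Words in letters with distinct indices. -/
abbrev Wd (I : Type) (n : ℕ) := {w : Fin n → Let I // Function.Injective (fun p => (w p).1)}

/-- Scalar of a letter. -/
noncomputable def xv (k : Type) [Field k] {I : Type} (a : Let I) : KK k := Xv k a.1

theorem xv_ne {a b : Let I} (h : a.1 ≠ b.1) : xv k a - xv k b ≠ 0 := by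
  rw [sub_ne_zero]; exact fun hq => h ((Xv k).injective hq)

/-- The coefficient `D`. -/
noncomputable def Dc (k : Type) [Field k] {I : Type} [DecidableEq I] (a b : Let I) : KK k :=
  if a.2 = b.2 then - (xv k a - xv k b)⁻¹ else 0

/-- The coefficient `G`. -/
noncomputable def Gc (a b : Let I) : KK k :=
  if a.1 < b.1 then 1 else
    if a.2 = b.2 then - ((xv k a - xv k b)⁻¹) ^ 2 else Qel C a.2 b.2 (xv k a) (xv k b)

theorem Dc_anti (a b : Let I) : Dc k b a = - Dc k a b := by
  unfold Dc
  by_cases h : a.2 = b.2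
  · rw [if_pos h, if_pos h.symm, ← inv_neg, neg_sub, neg_neg]
  · rw [if_neg h, if_neg (Ne.symm h), neg_zero]

theorem Gc_mul {a b : Let I} (h : a.1 ≠ b.1) :
    Gc C a b * Gc C b a = Qel C a.2 b.2 (xv k a) (xv k b) - (Dc k a b) ^ 2 := by
  unfold Gc Dc
  by_cases h2 : a.2 = b.2
  · have : Qel C a.2 b.2 (xv k a) (xv k b) = 0 := by simp [Qel, h2]
    have h3 : (xv k b - xv k a)⁻¹ = - (xv k a - xv k b)⁻¹ := by rw [← inv_neg, neg_sub]
    rw [this, if_pos h2, if_pos h2, if_pos h2.symm, h3]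
    rcases lt_or_gt_of_ne h with h | h
    · rw [if_pos h, if_neg (not_lt_of_gt h)]; ring
    · rw [if_pos h, if_neg (not_lt_of_gt h)]; ring
  · rw [if_neg h2, if_neg h2, if_neg (Ne.symm h2)]
    rcases lt_or_gt_of_ne h with h | h
    · rw [if_pos h, if_neg (not_lt_of_gt h), Qel_comm]; ring
    · rw [if_pos h, if_neg (not_lt_of_gt h)]; ring

theorem Dc_arnold {a b c : Let I} (hab : a.1 ≠ b.1) (hbc : b.1 ≠ c.1) (hac : a.1 ≠ c.1) :
    Dc k b c * Dc k a b - Dc k a c * Dc k b c = Dc k a b * Dc k a c := by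
  unfold Dc
  by_cases h1 : a.2 = b.2
  · by_cases h2 : b.2 = c.2
    · rw [if_pos h1, if_pos h2, if_pos (h1.trans h2)]
      have := xv_ne (k := k) hab
      have := xv_ne (k := k) hbc
      have := xv_ne (k := k) hac
      field_simp
      ring
    · rw [if_neg h2, if_neg (fun h => h2 (h1.symm.trans h))]; ring
  · by_cases h2 : b.2 = c.2
    · rw [if_neg h1, if_neg (show ¬ a.2 = c.2 from fun h => h1 (h.trans h2.symm))]; ring
    · rw [if_neg h1, if_neg h2]; ring

/-- The braid constant. -/
noncomputable def Brc (a b c : Let I) : KK k :=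
  if a.2 = c.2 then Qdiff C a.2 b.2 (xv k a) (xv k b) (xv k c) else 0

theorem Gc_braid {a b c : Let I} (hab : a.1 ≠ b.1) (hbc : b.1 ≠ c.1) (hac : a.1 ≠ c.1) :
    Gc C b c * Dc k a c * Gc C c b + Dc k b c * Dc k a b * Dc k b c
      - (Gc C a b * Dc k a c * Gc C b a + Dc k a b * Dc k b c * Dc k a b) = Brc C a b c := by
  have h1 := Gc_mul C hab
  have h2 := Gc_mul C hbc
  have h3 := Dc_arnold (k := k) hab hbc hac
  have h4 : Dc k a c * (Qel C b.2 c.2 (xv k b) (xv k c) - Qel C a.2 b.2 (xv k a) (xv k b)) =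
      Brc C a b c := by
    unfold Brc Dc
    by_cases h : a.2 = c.2
    · rw [if_pos h, if_pos h, Qel_comm C b.2, ← h]
      have := Qdiff_mul C a.2 b.2 (xv k a) (xv k b) (xv k c)
      have := xv_ne (k := k) hac
      field_simp
      linear_combination -(Qdiff_mul C a.2 b.2 (xv k a) (xv k b) (xv k c))
    · rw [if_neg h, if_neg h, zero_mul]
  linear_combination h4 + Dc k a c * h2 - Dc k a c * h1 + (Dc k b c - Dc k a b) * h3

/-- Swapping adjacent letters. -/
def sw {n : ℕ} (w : Wd I n) (p q : Fin n) : Wd I n :=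
  ⟨w.1 ∘ Equiv.swap p q, w.2.comp (Equiv.swap p q).injective⟩

theorem sw_val {n : ℕ} (w : Wd I n) (p q : Fin n) : (sw w p q).1 = w.1 ∘ Equiv.swap p q := rfl

/-- Multiplication operators. -/
noncomputable def mulOp {n : ℕ} : (Wd I n → KK k) →ₐ[k] Module.End k (Wd I n → KK k) :=
  Algebra.lmul k (Wd I n → KK k)

theorem mulOp_apply {n : ℕ} (g f : Wd I n → KK k) (w : Wd I n) : mulOp g f w = g w * f w := rfl

/-- Operators `x`, `e`, `τ`. -/
noncomputable def fx {n : ℕ} (a : Fin n) : Wd I n → KK k := fun w => xv k (w.1 a)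
noncomputable def fe {n : ℕ} (ν : Fin n → I) : Wd I n → KK k :=
  fun w => if (fun p => (w.1 p).2) = ν then 1 else 0
noncomputable def tauOp {n : ℕ} (p q : Fin n) : Module.End k (Wd I n → KK k) where
  toFun f := fun w => Gc C (w.1 p) (w.1 q) * f (sw w p q) + Dc k (w.1 p) (w.1 q) * f w
  map_add' f g := by ext w; simp only [Pi.add_apply]; ring
  map_smul' c f := by
    ext w
    simp only [Pi.smul_apply, RingHom.id_apply, mul_smul_comm, smul_add]

theorem tauOp_apply {n : ℕ} (p q : Fin n) (f : Wd I n → KK k) (w : Wd I n) : tauOp C p q f w =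
    Gc C (w.1 p) (w.1 q) * f (sw w p q) + Dc k (w.1 p) (w.1 q) * f w := rfl

theorem sw_sw {n : ℕ} (w : Wd I n) (p q : Fin n) : sw (sw w p q) p q = w := by
  apply Subtype.ext; ext1 x; simp [sw_val]

theorem Qel_op {n : ℕ} (i j : I) (a b : Fin n) (f : Wd I n → KK k) (w : Wd I n) :
    Qel C i j (mulOp (k := k) (fx a)) (mulOp (fx b)) f w =
      Qel C i j (xv k (w.1 a)) (xv k (w.1 b)) * f w := by
  rw [← map_Qel, mulOp_apply]
  congr 1
  exact map_Qel C (Pi.evalAlgHom k (fun _ : Wd I n => KK k) w) i j _ _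

theorem Qdiff_op {n : ℕ} (i j : I) (a b c : Fin n) (f : Wd I n → KK k) (w : Wd I n) :
    Qdiff C i j (mulOp (k := k) (fx a)) (mulOp (fx b)) (mulOp (fx c)) f w =
      Qdiff C i j (xv k (w.1 a)) (xv k (w.1 b)) (xv k (w.1 c)) * f w := by
  rw [← map_Qdiff, mulOp_apply]
  congr 1
  exact map_Qdiff C (Pi.evalAlgHom k (fun _ : Wd I n => KK k) w) i j _ _ _

theorem isRep_W (n : ℕ) : IsRep C n (A := Module.End k (Wd I n → KK k))
    (fun ν => mulOp (fe ν)) (fun a => mulOp (fx a))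
    (fun l h => tauOp C ⟨l, Nat.lt_of_succ_lt h⟩ ⟨l + 1, h⟩) where
  ee ν ν' := by
    rw [← map_mul]
    have : (fe ν * fe ν' : Wd I n → KK k) = if ν = ν' then fe ν else 0 := by
      ext w
      simp only [Pi.mul_apply, fe]
      by_cases h : ν = ν'
      · subst h; simp [fe]
      · by_cases h1 : (fun p => (w.1 p).2) = ν
        · simp [h1, h]
        · simp [h1, h]
    rw [this]; split_ifs <;> simp
  esum := by
    rw [← map_sum]
    have : (∑ ν, fe ν : Wd I n → KK k) = 1 := by
      ext w
      simp [fe]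
    rw [this, map_one]
  xx a b := by rw [← map_mul, ← map_mul, mul_comm]
  xe a b := by rw [← map_mul, ← map_mul, mul_comm]
  taue l h ν := by
    apply LinearMap.ext; intro f; ext w
    simp only [Module.End.mul_apply, tauOp_apply, mulOp_apply, fe]
    set s := Equiv.swap (⟨l, Nat.lt_of_succ_lt h⟩ : Fin n) ⟨l + 1, h⟩ with hs
    have h1 : ((fun p => (w.1 p).2) = ν ∘ s) ↔ ((fun p => ((sw w ⟨l, Nat.lt_of_succ_lt h⟩ ⟨l + 1, h⟩).1 p).2) = ν) := by
      rw [sw_val, ← hs]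
      constructor
      · intro hh; ext p
        have := congrFun hh (s p)
        simpa [hs] using this
      · intro hh; ext p
        have := congrFun hh (s p)
        simpa [hs] using this
    by_cases hc : (w.1 ⟨l, Nat.lt_of_succ_lt h⟩).2 = (w.1 ⟨l+1, h⟩).2
    · have h2 : (fun p => ((sw w ⟨l, Nat.lt_of_succ_lt h⟩ ⟨l + 1, h⟩).1 p).2) = (fun p => (w.1 p).2) := by
        ext p
        rw [sw_val]
        simp only [Function.comp]
        by_cases hp : p = ⟨l, Nat.lt_of_succ_lt h⟩
        · subst hp; rw [Equiv.swap_apply_left, hc]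
        · by_cases hp2 : p = ⟨l+1, h⟩
          · subst hp2; rw [Equiv.swap_apply_right, hc]
          · rw [Equiv.swap_apply_of_ne_of_ne hp hp2]
      simp only [h1, h2]
      ring
    · have : Dc k (w.1 ⟨l, Nat.lt_of_succ_lt h⟩) (w.1 ⟨l+1, h⟩) = 0 := by simp [Dc, hc]
      simp only [h1, this]
      ring
  tautau l h l' h' hl := by
    apply LinearMap.ext; intro f; ext w
    simp only [Module.End.mul_apply, tauOp_apply]
    have a1 : (⟨l', Nat.lt_of_succ_lt h'⟩ : Fin n) ≠ ⟨l, Nat.lt_of_succ_lt h⟩ := by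
      rw [Ne, Fin.mk.injEq]; omega
    have a2 : (⟨l', Nat.lt_of_succ_lt h'⟩ : Fin n) ≠ ⟨l+1, h⟩ := by
      rw [Ne, Fin.mk.injEq]; omega
    have a3 : (⟨l'+1, h'⟩ : Fin n) ≠ ⟨l, Nat.lt_of_succ_lt h⟩ := by
      rw [Ne, Fin.mk.injEq]; omega
    have a4 : (⟨l'+1, h'⟩ : Fin n) ≠ ⟨l+1, h⟩ := by
      rw [Ne, Fin.mk.injEq]; omega
    have hsw : sw (sw w ⟨l, Nat.lt_of_succ_lt h⟩ ⟨l + 1, h⟩) ⟨l', Nat.lt_of_succ_lt h'⟩ ⟨l' + 1, h'⟩ =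
        sw (sw w ⟨l', Nat.lt_of_succ_lt h'⟩ ⟨l' + 1, h'⟩) ⟨l, Nat.lt_of_succ_lt h⟩ ⟨l + 1, h⟩ := by
      apply Subtype.ext
      simp only [sw_val, Function.comp_assoc]
      congr 1
      ext x : 1
      simp only [Function.comp]
      have := Equiv.swap_apply_of_ne_of_ne a1 a2
      generalize (⟨l, Nat.lt_of_succ_lt h⟩ : Fin n) = A at *
      generalize (⟨l+1, h⟩ : Fin n) = B at *
      generalize (⟨l', Nat.lt_of_succ_lt h'⟩ : Fin n) = A' at *
      generalize (⟨l'+1, h'⟩ : Fin n) = B' at *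
      simp only [Equiv.swap_apply_def]
      grind
    rw [hsw]
    simp only [sw_val, Function.comp, Equiv.swap_apply_of_ne_of_ne a1 a2,
      Equiv.swap_apply_of_ne_of_ne a3 a4, Equiv.swap_apply_of_ne_of_ne a1.symm a3.symm,
      Equiv.swap_apply_of_ne_of_ne a2.symm a4.symm]
    ring
  tausq l h ν := by
    apply LinearMap.ext; intro f
    rw [pow_two, mul_assoc, Module.End.mul_apply, Module.End.mul_apply, Module.End.mul_apply]
    ext w
    rw [Qel_op]
    simp only [tauOp_apply, sw_sw]
    simp only [sw_val, Function.comp, Equiv.swap_apply_left, Equiv.swap_apply_right]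
    have hne : (w.1 ⟨l, Nat.lt_of_succ_lt h⟩).1 ≠ (w.1 ⟨l+1, h⟩).1 := by
      intro hh; have := w.2 hh; simp at this
    have h1 := Gc_mul C hne
    rw [Dc_anti (w.1 ⟨l, Nat.lt_of_succ_lt h⟩)]
    simp only [mulOp_apply, fe]
    by_cases hc : (fun p => (w.1 p).2) = ν
    · rw [if_pos hc, ← hc]
      linear_combination (f w) * h1
    · rw [if_neg hc]; ring
  taux l h m ν := by
    apply LinearMap.ext; intro f
    rw [Module.End.mul_apply]
    ext w
    have hne : (w.1 ⟨l, Nat.lt_of_succ_lt h⟩).1 ≠ (w.1 ⟨l+1, h⟩).1 := by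
      intro hh; have := w.2 hh; simp at this
    have hne' := xv_ne (k := k) hne
    have key : ∀ g : Wd I n → KK k, (show Module.End k (Wd I n → KK k) from tauOp C ⟨l, Nat.lt_of_succ_lt h⟩ ⟨l + 1, h⟩ * mulOp (fx m) -
        mulOp (fx ((Equiv.swap (⟨l, Nat.lt_of_succ_lt h⟩ : Fin n) ⟨l + 1, h⟩) m)) *
          tauOp C ⟨l, Nat.lt_of_succ_lt h⟩ ⟨l + 1, h⟩) g w =
        Dc k (w.1 ⟨l, Nat.lt_of_succ_lt h⟩) (w.1 ⟨l+1, h⟩) * (xv k (w.1 m) -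
          xv k (w.1 ((Equiv.swap (⟨l, Nat.lt_of_succ_lt h⟩ : Fin n) ⟨l + 1, h⟩) m))) * g w := by
      intro g
      rw [LinearMap.sub_apply, Module.End.mul_apply, Module.End.mul_apply, Pi.sub_apply]
      simp only [tauOp_apply, mulOp_apply, fx, sw_val, Function.comp]
      ring
    rw [key]
    have key2 : ∀ (P' P'' : Prop) [Decidable P'] [Decidable P''], ((if P' then - mulOp (fe ν) else if P'' then mulOp (fe ν) else 0 :
        Module.End k (Wd I n → KK k)) f w) = (if P' then - (fe ν w * f w) else
          if P'' then (fe ν w * f w) else 0) := by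
      intro P' P'' _ _
      split_ifs <;> rfl
    rw [key2]
    simp only [mulOp_apply, fe]
    by_cases hc : (fun p => (w.1 p).2) = ν
    · rw [if_pos hc, ← hc]
      simp only [Dc]
      by_cases hm : m = ⟨l, Nat.lt_of_succ_lt h⟩
      · subst hm
        rw [Equiv.swap_apply_left]
        simp only [true_and]
        have : (⟨l, Nat.lt_of_succ_lt h⟩ : Fin n) ≠ ⟨l+1, h⟩ := by simp
        simp only [this, false_and, if_false]
        split_ifs
        · field_simp
        · simp
      · by_cases hm' : m = ⟨l+1, h⟩
        · subst hm'
          rw [Equiv.swap_apply_right]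
          simp only [hm, false_and, if_false, true_and]
          split_ifs
          · field_simp; ring
          · simp
        · rw [Equiv.swap_apply_of_ne_of_ne hm hm']
          simp [hm, hm']
    · simp [hc]
  braid l h ν := by
    apply LinearMap.ext; intro f
    rw [Module.End.mul_apply]
    ext w
    have key2 : ∀ (P' : Prop) [Decidable P'] (A' : Module.End k (Wd I n → KK k)),
        ((if P' then A' else 0 :
        Module.End k (Wd I n → KK k)) f w) = (if P' then A' f w else 0) := by
      intro P' _ A'
      split_ifs <;> rfl
    rw [key2, Module.End.mul_apply, Qdiff_op]
    set a : Fin n := ⟨l, Nat.lt_of_succ_lt (Nat.lt_of_succ_lt h)⟩ with ha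
    set b : Fin n := ⟨l + 1, Nat.lt_of_succ_lt h⟩ with hb
    have hb' : (⟨l + 1, Nat.lt_of_succ_lt h⟩ : Fin n) = b := rfl
    set c : Fin n := ⟨l + 2, h⟩ with hcc
    have hab : a ≠ b := by simp [ha, hb]
    have hbc : b ≠ c := by simp [hcc, hb]
    have hac : a ≠ c := by simp [ha, hcc]
    have nab : (w.1 a).1 ≠ (w.1 b).1 := fun hh => hab (w.2 hh)
    have nbc : (w.1 b).1 ≠ (w.1 c).1 := fun hh => hbc (w.2 hh)
    have nac : (w.1 a).1 ≠ (w.1 c).1 := fun hh => hac (w.2 hh)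
    have e1 : (⟨l + 1 + 1, h⟩ : Fin n) = c := rfl
    try simp only [e1]
    clear_value a b c
    have hbr := Gc_braid C nab nbc nac
    have harn := Dc_arnold (k := k) nab nbc nac
    have hsw : sw (sw (sw w b c) a b) b c = sw (sw (sw w a b) b c) a b := by
      apply Subtype.ext
      simp only [sw_val, Function.comp_assoc]
      congr 1
      ext x : 1
      simp only [Function.comp, Equiv.swap_apply_def]
      grind
    have s1 : Equiv.swap a b c = c := Equiv.swap_apply_of_ne_of_ne hac.symm hbc.symm
    have s2 : Equiv.swap b c a = a := Equiv.swap_apply_of_ne_of_ne hab hac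
    set g := mulOp (fe ν) f with hg
    have : (if ν a = ν c then Qdiff C (ν a) (ν b) (xv k (w.1 a)) (xv k (w.1 b)) (xv k (w.1 c)) * g w else 0)
        = Brc C (w.1 a) (w.1 b) (w.1 c) * g w := by
      rw [hg, mulOp_apply]
      simp only [fe, Brc]
      by_cases hc : (fun p => (w.1 p).2) = ν
      · rw [if_pos hc, ← hc]
        split_ifs <;> simp
      · simp [hc]
    rw [this, ← hbr, LinearMap.sub_apply, Module.End.mul_apply, Module.End.mul_apply, Module.End.mul_apply,
      Module.End.mul_apply, Pi.sub_apply]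
    simp only [tauOp_apply, sw_sw, hsw]
    simp only [sw_val, Function.comp, Equiv.swap_apply_left, Equiv.swap_apply_right, s1, s2]
    rw [Dc_anti (w.1 a) (w.1 b), Dc_anti (w.1 b) (w.1 c)]
    linear_combination Gc C (w.1 b) (w.1 c) * g (sw w b c) * harn - Gc C (w.1 a) (w.1 b) * g (sw w a b) * harn

end KLR


namespace KLR

set_option linter.unusedSectionVars false
set_option linter.unusedSimpArgs false
set_option autoImplicit false

variable {k : Type} [Field k] {I : Type} [Fintype I] [DecidableEq I] (C : CartanDatum k I)

/-- The representation. -/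
noncomputable def rho (n : ℕ) : RA C n →ₐ[k] Module.End k (Wd I n → KK k) := liftA C (isRep_W C n)

theorem rho_x {n : ℕ} (a : Fin n) (f : Wd I n → KK k) (w : Wd I n) :
    rho C n (xx C a) f w = xv k (w.1 a) * f w := by
  unfold rho; rw [liftA_x]; rfl
theorem rho_e {n : ℕ} (ν : Fin n → I) (f : Wd I n → KK k) (w : Wd I n) :
    rho C n (ee C ν) f w = if (fun p => (w.1 p).2) = ν then f w else 0 := by
  unfold rho; rw [liftA_e, mulOp_apply, fe]; split_ifs <;> simp
theorem rho_t {n : ℕ} (l : ℕ) (h : l + 1 < n) (f : Wd I n → KK k) (w : Wd I n) :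
    rho C n (tt C l h) f w = Gc C (w.1 ⟨l, Nat.lt_of_succ_lt h⟩) (w.1 ⟨l+1, h⟩) *
      f (sw w ⟨l, Nat.lt_of_succ_lt h⟩ ⟨l+1, h⟩) +
      Dc k (w.1 ⟨l, Nat.lt_of_succ_lt h⟩) (w.1 ⟨l+1, h⟩) * f w := by
  unfold rho; rw [liftA_t]; rfl

theorem rho_X {n : ℕ} (f : Wd I (n + 1) → KK k) (w : Wd I (n + 1)) :
    rho C (n + 1) (X C n) f w = xv k (w.1 (Fin.last n)) * f w := rho_x C _ _ _

theorem rho_E {n : ℕ} (j : I) (f : Wd I (n + 1) → KK k) (w : Wd I (n + 1)) :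
    rho C (n + 1) (E C n j) f w = if (w.1 (Fin.last n)).2 = j then f w else 0 := by
  unfold E ec
  rw [map_sum, LinearMap.sum_apply, Finset.sum_apply]
  have : ∀ ν : Fin (n + 1) → I, rho C (n + 1) (if ν (Fin.last n) = j then ee C ν else 0) f w =
      if (fun p => (w.1 p).2) = ν then (if ν (Fin.last n) = j then f w else 0) else 0 := by
    intro ν
    by_cases h : ν (Fin.last n) = j
    · simp only [h, if_true, rho_e]
    · simp [h]
  simp only [this]
  rw [Finset.sum_ite_eq]
  simp

theorem rho_XE {n : ℕ} (m : ℕ) (j : I) (f : Wd I (n + 1) → KK k) (w : Wd I (n + 1)) :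
    rho C (n + 1) (X C n ^ m * E C n j) f w =
      (if (w.1 (Fin.last n)).2 = j then xv k (w.1 (Fin.last n)) ^ m else 0) * f w := by
  induction m generalizing w with
  | zero => rw [pow_zero, one_mul, rho_E]; simp
  | succ m ih =>
    rw [pow_succ', mul_assoc, map_mul, Module.End.mul_apply, rho_X, ih]
    split_ifs
    · ring
    · simp

/-- Restriction of a word. -/
def initW {n : ℕ} (w : Wd I (n + 1)) : Wd I n :=
  ⟨fun p => w.1 p.castSucc, fun a b h => by
    have := w.2 h
    simpa using this⟩

/-- Extension of a word. -/
def snocW {n : ℕ} (u : Wd I n) (ℓ : Let I) (h : ∀ p, (u.1 p).1 ≠ ℓ.1) : Wd I (n + 1) :=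
  ⟨Fin.snoc (α := fun _ => Let I) u.1 ℓ, by
    intro a b hab
    induction a using Fin.lastCases with
    | last =>
      induction b using Fin.lastCases with
      | last => rfl
      | cast b =>
        exfalso
        simp only [Fin.snoc_last, Fin.snoc_castSucc] at hab
        exact h b hab.symm
    | cast a =>
      induction b using Fin.lastCases with
      | last =>
        exfalso
        simp only [Fin.snoc_last, Fin.snoc_castSucc] at hab
        exact h a hab
      | cast b =>
        simp only [Fin.snoc_castSucc] at hab
        rw [u.2 hab]⟩

theorem initW_snocW {n : ℕ} (u : Wd I n) (ℓ : Let I) (h : ∀ p, (u.1 p).1 ≠ ℓ.1) :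
    initW (snocW u ℓ h) = u := by
  apply Subtype.ext; ext1 p; simp [initW, snocW]

theorem snocW_last {n : ℕ} (u : Wd I n) (ℓ : Let I) (h : ∀ p, (u.1 p).1 ≠ ℓ.1) :
    (snocW u ℓ h).1 (Fin.last n) = ℓ := by simp [snocW]
theorem snocW_castSucc {n : ℕ} (u : Wd I n) (ℓ : Let I) (h : ∀ p, (u.1 p).1 ≠ ℓ.1) (p : Fin n) :
    (snocW u ℓ h).1 p.castSucc = u.1 p := by simp [snocW]

theorem init_ne {n : ℕ} (w : Wd I (n + 1)) (p : Fin n) :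
    ((initW w).1 p).1 ≠ (w.1 (Fin.last n)).1 := by
  intro h
  have := w.2 h
  exact absurd this (Fin.castSucc_lt_last p).ne

theorem snocW_init {n : ℕ} (w : Wd I (n + 1)) : snocW (initW w) (w.1 (Fin.last n)) (init_ne w) = w := by
  apply Subtype.ext; ext1 p
  induction p using Fin.lastCases with
  | last => rw [snocW_last]
  | cast p => rw [snocW_castSucc]; rfl

/-- Compatibility of functions in `n+1` and `n` letters. -/
def RelF {n : ℕ} (A : Let I → Prop) (ℓ : Let I) (f : Wd I (n + 1) → KK k) (g : Wd I n → KK k) : Prop :=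
  ∀ w : Wd I (n + 1), w.1 (Fin.last n) = ℓ → (∀ p : Fin n, A (w.1 p.castSucc)) → f w = g (initW w)

theorem RelF_up {n : ℕ} (A : Let I → Prop) (ℓ : Let I) (y : RA C n) :
    ∀ (f : Wd I (n + 1) → KK k) (g : Wd I n → KK k), RelF A ℓ f g →
      RelF A ℓ (rho C (n + 1) (up C n y) f) (rho C n y g) := by
  let S : Subalgebra k (RA C n) :=
  { carrier := {y | ∀ (f : Wd I (n + 1) → KK k) (g : Wd I n → KK k), RelF A ℓ f g →
      RelF A ℓ (rho C (n + 1) (up C n y) f) (rho C n y g)}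
    mul_mem' := by
      intro a b ha hb f g h
      rw [map_mul, map_mul, map_mul]
      exact ha _ _ (hb _ _ h)
    add_mem' := by
      intro a b ha hb f g h w hw hA
      rw [map_add, map_add, map_add, LinearMap.add_apply, LinearMap.add_apply, Pi.add_apply,
        Pi.add_apply, ha _ _ h w hw hA, hb _ _ h w hw hA]
    algebraMap_mem' := by
      intro c f g h w hw hA
      rw [AlgHom.commutes, AlgHom.commutes, AlgHom.commutes, Module.algebraMap_end_apply,
        Module.algebraMap_end_apply, Pi.smul_apply, Pi.smul_apply, h w hw hA] }
  refine alg_top C S ?_ ?_ ?_ y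
  · intro ν f g h w hw hA
    rw [up_e, map_sum, LinearMap.sum_apply, Finset.sum_apply, rho_e]
    simp only [rho_e]
    have : ∀ j : I, ((fun p => (w.1 p).2) = (Fin.snoc ν j : Fin (n + 1) → I)) ↔
        ((fun p => ((initW w).1 p).2) = ν ∧ j = (w.1 (Fin.last n)).2) := by
      intro j
      constructor
      · intro hh
        constructor
        · ext p
          have := congrFun hh p.castSucc
          simpa [initW] using this
        · have := congrFun hh (Fin.last n)
          simpa using this.symm
      · rintro ⟨hh, rfl⟩
        ext p
        induction p using Fin.lastCases with
        | last => simp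
        | cast p => simp [← hh, initW]
    simp only [this]
    by_cases hc : (fun p => ((initW w).1 p).2) = ν
    · simp [hc, h w hw hA]
    · simp [hc]
  · intro a f g h w hw hA
    rw [up_x, rho_x, rho_x, h w hw hA]
    rfl
  · intro l hl f g h w hw hA
    rw [up_t, rho_t, rho_t, h w hw hA]
    rw [h]
    · have : initW (sw w ⟨l, Nat.lt_of_succ_lt (Nat.lt_succ_of_lt hl)⟩ ⟨l + 1, Nat.lt_succ_of_lt hl⟩) =
        sw (initW w) ⟨l, Nat.lt_of_succ_lt hl⟩ ⟨l + 1, hl⟩ := by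
        apply Subtype.ext; ext1 p
        have := swap_castSucc (⟨l, Nat.lt_of_succ_lt hl⟩ : Fin n) ⟨l + 1, hl⟩ p
        simp only [initW, sw_val, Function.comp]
        exact congrArg w.1 this
      rw [this]
      rfl
    · rw [sw_val, Function.comp, Equiv.swap_apply_of_ne_of_ne, hw]
      · rw [Ne, Fin.ext_iff]; simp; omega
      · rw [Ne, Fin.ext_iff]; simp; omega
    · intro p
      rw [sw_val, Function.comp]
      have := swap_castSucc (⟨l, Nat.lt_of_succ_lt hl⟩ : Fin n) ⟨l + 1, hl⟩ p
      have h2 := hA ((Equiv.swap (⟨l, Nat.lt_of_succ_lt hl⟩ : Fin n) ⟨l + 1, hl⟩) p)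
      rw [← this] at h2
      exact h2

/-- Index set of the basis. -/
def Idx (I : Type) : ℕ → Type
  | 0 => ℕ × I
  | n + 1 => (ℕ × I) ⊕ Idx I n

/-- Basis elements. -/
noncomputable def bb : (n : ℕ) → Idx I n → RA C (n + 1)
  | 0, α => X C 0 ^ (show ℕ × I from α).1 * E C 0 (show ℕ × I from α).2
  | _ + 1, Sum.inl α => X C _ ^ α.1 * E C _ α.2
  | n + 1, Sum.inr α => T C n * up C (n + 1) (bb n α)

/-- Level. -/
def lev : (n : ℕ) → Idx I n → ℕ
  | 0, _ => 0
  | n + 1, Sum.inl _ => n + 1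
  | n + 1, Sum.inr α => lev n α

/-- End letter. -/
def fin : (n : ℕ) → Idx I n → ℕ × I
  | 0, α => α
  | _ + 1, Sum.inl α => α
  | n + 1, Sum.inr α => fin n α

theorem lev_le : ∀ (n : ℕ) (α : Idx I n), lev n α ≤ n
  | 0, _ => le_refl _
  | _ + 1, Sum.inl _ => le_refl _
  | n + 1, Sum.inr α => (lev_le n α).trans (Nat.le_succ n)

theorem idx_inj : ∀ (n : ℕ) (α β : Idx I n), lev n α = lev n β → fin n α = fin n β → α = β
  | 0, _, _, _, h => h
  | _ + 1, Sum.inl _, Sum.inl _, _, h => congrArg Sum.inl h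
  | n + 1, Sum.inl _, Sum.inr β, h, _ => by
      have := lev_le n β
      simp only [lev] at h; omega
  | n + 1, Sum.inr β, Sum.inl _, h, _ => by
      have := lev_le n β
      simp only [lev] at h; omega
  | n + 1, Sum.inr α, Sum.inr β, h, h' => congrArg Sum.inr (idx_inj n α β h h')

theorem rho_top {n : ℕ} (Ω : Let I) (ft : Wd I n → KK k) (m : ℕ × I) (u : Wd I n)
    (hu : ∀ p, (u.1 p).1 < Ω.1) (f : Wd I (n + 1) → KK k)
    (hf : ∀ h, f (snocW u Ω h) = ft u) :
     rho C (n + 1) (X C n ^ m.1 * E C n m.2) f (snocW u Ω fun p => (hu p).ne) =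
      (if Ω.2 = m.2 then xv k Ω ^ m.1 else 0) * ft u := by
  rw [rho_XE, snocW_last, hf]

theorem rho_T {n : ℕ} (u : Wd I n) (ℓ Ω : Let I) (hℓ : ∀ p, (u.1 p).1 ≠ ℓ.1)
    (hu : ∀ p, ((snocW u ℓ hℓ).1 p).1 < Ω.1) (f : Wd I (n + 2) → KK k)
    (h1 : ∀ p, (u.1 p).1 ≠ Ω.1) (h2 : ∀ p, ((snocW u Ω h1).1 p).1 ≠ ℓ.1) :
    rho C (n + 2) (T C n) f (snocW (snocW u ℓ hℓ) Ω fun p => (hu p).ne) =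
      f (snocW (snocW u Ω h1) ℓ h2) +
      Dc k ℓ Ω * f (snocW (snocW u ℓ hℓ) Ω fun p => (hu p).ne) := by
  unfold T
  rw [rho_t]
  have e1 : (⟨n + 1, Nat.lt_succ_self _⟩ : Fin (n + 2)) = Fin.last (n + 1) := rfl
  have e2 : (⟨n, Nat.lt_of_succ_lt (Nat.lt_succ_self _)⟩ : Fin (n + 2)) = (Fin.last n).castSucc := rfl
  rw [e1, e2, snocW_last, snocW_castSucc, snocW_last]
  have hlt := hu (Fin.last n)
  rw [snocW_last] at hlt
  rw [Gc, if_pos hlt, one_mul]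
  congr 2
  apply Subtype.ext; ext1 p
  rw [sw_val, Function.comp]
  induction p using Fin.lastCases with
  | last => rw [Equiv.swap_apply_right, snocW_last, snocW_castSucc, snocW_last]
  | cast p =>
    induction p using Fin.lastCases with
    | last => rw [Equiv.swap_apply_left, snocW_last, snocW_castSucc, snocW_last]
    | cast p =>
      rw [Equiv.swap_apply_of_ne_of_ne]
      · simp only [snocW_castSucc]
      · intro h
        have := Fin.castSucc_injective _ h
        exact absurd this (Fin.castSucc_lt_last p).ne
      · exact (Fin.castSucc_lt_last _).ne

theorem exists_probe : ∀ (n κ : ℕ), κ ≤ n → ∀ (ft : Wd I n → KK k) (Ω : Let I),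
    ∃ f : Wd I (n + 1) → KK k, ∀ (u : Wd I n) (hu : ∀ p, (u.1 p).1 < Ω.1) (α : Idx I n),
      (lev n α = κ → rho C (n + 1) (bb C n α) f (snocW u Ω fun p => (hu p).ne) =
        (if Ω.2 = (fin n α).2 then xv k Ω ^ (fin n α).1 else 0) * ft u) ∧
      (κ < lev n α → rho C (n + 1) (bb C n α) f (snocW u Ω fun p => (hu p).ne) = 0) := by
  classical
  have top : ∀ (n : ℕ) (ft : Wd I n → KK k) (Ω : Let I), ∃ f : Wd I (n + 1) → KK k,
      (∀ (u : Wd I n) h, f (snocW u Ω h) = ft u) := by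
    intro n ft Ω
    refine ⟨fun v => ft (initW v), ?_⟩
    intro u h
    dsimp only
    rw [initW_snocW]
  have topr : ∀ (n : ℕ) (ft : Wd I n → KK k) (Ω : Let I), ∃ f : Wd I (n + 1) → KK k,
      (∀ (u : Wd I n) h, f (snocW u Ω h) = ft u) ∧ (∀ w, w.1 (Fin.last n) ≠ Ω → f w = 0) := by
    intro n ft Ω
    refine ⟨fun v => if v.1 (Fin.last n) = Ω then ft (initW v) else 0, ?_, ?_⟩
    · intro u h
      dsimp only
      rw [initW_snocW, snocW_last, if_pos rfl]
    · intro w hw; simp [hw]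
  intro n
  induction n with
  | zero =>
    intro κ hκ ft Ω
    obtain ⟨f, hf⟩ := top 0 ft Ω
    refine ⟨f, fun u hu α => ⟨fun _ => rho_top C Ω ft _ u hu f (hf u), fun h => ?_⟩⟩
    simp [lev] at h
  | succ n ih =>
    intro κ hκ ft Ω
    by_cases hk : κ = n + 1
    · obtain ⟨f, hf, hf0⟩ := topr (n + 1) ft Ω
      refine ⟨f, fun u hu α => ⟨fun hl => ?_, fun h => ?_⟩⟩
      · rcases α with α | α
        · exact rho_top C Ω ft _ u hu f (hf u)
        · have := lev_le n α
          simp only [lev] at hl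
          omega
      · have := lev_le _ α; omega
    · have hk' : κ ≤ n := by omega
      choose g hg using fun ℓ : Let I => ih κ hk'
        (fun u' => if h : ∀ p, (u'.1 p).1 ≠ ℓ.1 then ft (snocW u' ℓ h) else 0) Ω
      let f : Wd I (n + 2) → KK k := fun y => if y.1 (Fin.last (n + 1)) = Ω then 0 else
        g (y.1 (Fin.last (n + 1))) (initW y)
      have hfΩ : RelF (fun _ => True) Ω f 0 := by
        intro w hw _
        simp [f, hw]
      refine ⟨f, fun u hu α => ?_⟩
      rcases α with α | α
      · constructor
        · intro h
          simp only [lev] at h; omega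
        · intro _
          have := rho_top C Ω 0 α u hu f (by intro h; simp [f, snocW_last])
          exact this.trans (by simp)
      · obtain ⟨u', ℓ, hℓ, rfl⟩ : ∃ (u' : Wd I n) (ℓ : Let I) (hℓ : ∀ p, (u'.1 p).1 ≠ ℓ.1),
            u = snocW u' ℓ hℓ := ⟨initW u, u.1 (Fin.last n), init_ne u, (snocW_init u).symm⟩
        have hlt := hu (Fin.last n)
        rw [snocW_last] at hlt
        have hu' : ∀ p, (u'.1 p).1 < Ω.1 := by
          intro p
          have := hu p.castSucc
          rwa [snocW_castSucc] at this
        have h2 : ∀ p, ((snocW u' Ω fun p => (hu' p).ne).1 p).1 ≠ ℓ.1 := by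
          intro p
          induction p using Fin.lastCases with
          | last => rw [snocW_last]; exact hlt.ne'
          | cast p => rw [snocW_castSucc]; exact hℓ p
        have hfℓ : RelF (fun _ => True) ℓ f (g ℓ) := by
          intro w hw _
          have : ℓ ≠ Ω := by rintro rfl; exact lt_irrefl _ hlt
          simp [f, hw, this]
        have key : rho C (n + 2) (bb C (n + 1) (Sum.inr α)) f (snocW (snocW u' ℓ hℓ) Ω fun p => (hu p).ne) =
            rho C (n + 1) (bb C n α) (g ℓ) (snocW u' Ω fun p => (hu' p).ne) := by
          rw [show bb C (n + 1) (Sum.inr α) = T C n * up C (n + 1) (bb C n α) from rfl, map_mul,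
            Module.End.mul_apply, rho_T C u' ℓ Ω hℓ hu _ (fun p => (hu' p).ne) h2]
          rw [RelF_up C _ _ _ f _ hfℓ _ (snocW_last _ _ _) (fun _ => trivial),
            RelF_up C _ _ _ f _ hfΩ _ (snocW_last _ _ _) (fun _ => trivial), initW_snocW]
          simp
        have h3 := hg ℓ u' hu' α
        rw [dif_pos hℓ] at h3
        have e1 : lev (n + 1) (Sum.inr α : Idx I (n + 1)) = lev n α := rfl
        have e2 : fin (n + 1) (Sum.inr α : Idx I (n + 1)) = fin n α := rfl
        erw [e1, e2]
        constructor
        · intro h; exact key.trans (h3.1 h)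
        · intro h; exact key.trans (h3.2 h)

end KLR


namespace KLR

set_option linter.unusedSectionVars false
set_option linter.unusedSimpArgs false
set_option autoImplicit false

variable {k : Type} [Field k] {I : Type} [Fintype I] [DecidableEq I] (C : CartanDatum k I)

/-- The coordinate map of the basis `bb`. -/
noncomputable def Theta (n : ℕ) : (Idx I n →₀ RA C n) →ₗ[k] RA C (n + 1) :=
  Finsupp.lsum k fun α => (LinearMap.mulRight k (bb C n α)).comp (up C n).toLinearMap

theorem Theta_single {n : ℕ} (α : Idx I n) (r : RA C n) :
    Theta C n (Finsupp.single α r) = up C n r * bb C n α := by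
  unfold Theta; simp

theorem Theta_apply {n : ℕ} (c : Idx I n →₀ RA C n) :
    Theta C n c = c.sum fun α r => up C n r * bb C n α := by
  unfold Theta; simp; rfl

/-- Top index. -/
def topI : (n : ℕ) → ℕ → I → Idx I n
  | 0, m, j => (m, j)
  | _ + 1, m, j => Sum.inl (m, j)

/-- Lower indices. -/
def tauI {n : ℕ} (α : Idx I n) : Idx I (n + 1) := Sum.inr α

theorem bb_topI (n m : ℕ) (j : I) : bb C n (topI n m j) = X C n ^ m * E C n j := by
  cases n <;> rfl
theorem bb_tauI {n : ℕ} (α : Idx I n) : bb C (n + 1) (tauI α) = T C n * up C (n + 1) (bb C n α) := rfl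

theorem snocW_init' {n : ℕ} (w : Wd I (n + 1)) (Ω : Let I) (hw : w.1 (Fin.last n) = Ω)
    (h : ∀ p, ((initW w).1 p).1 ≠ Ω.1) : snocW (initW w) Ω h = w := by
  subst hw; exact snocW_init w

theorem Theta_surj (n : ℕ) : ∀ y, y ∈ LinearMap.range (Theta C n) := by
  induction n with
  | zero =>
    intro y
    refine P_induction C ?_ ?_ ?_ ?_ (P_zero_top C y)
    · intro r m j
      exact ⟨Finsupp.single (topI 0 m j) r, by rw [Theta_single, bb_topI]; rfl⟩
    · exact zero_mem _
    · intro a b; exact add_mem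
    · intro c a h; exact Submodule.smul_mem _ _ h
  | succ n ih =>
    intro y
    refine VS_induction C ?_ ?_ ?_ ?_ ?_ (VS_top C n y)
    · intro r m j
      exact ⟨Finsupp.single (topI (n + 1) m j) r, by rw [Theta_single, bb_topI]; rfl⟩
    · intro r s
      obtain ⟨c, rfl⟩ := ih s
      induction c using Finsupp.induction_linear with
      | zero => simp
      | add f g hf hg => rw [map_add, map_add, mul_add]; exact add_mem hf hg
      | single α r0 =>
        refine ⟨Finsupp.single (tauI α) (r * up C n r0), ?_⟩
        rw [Theta_single, Theta_single, map_mul, map_mul, bb_tauI]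
        rw [mul_assoc, mul_assoc, ← mul_assoc _ (T C n), ← T_upup, ← mul_assoc (T C n)]
    · exact zero_mem _
    · intro a b; exact add_mem
    · intro c a h; exact Submodule.smul_mem _ _ h

/-- `rho` is `K`-linear. -/
theorem RelF_lin {n : ℕ} (y : RA C n) : ∀ (s : KK k) (ft : Wd I n → KK k),
    rho C n y (s • ft) = s • rho C n y ft := by
  let S : Subalgebra k (RA C n) :=
  { carrier := {y | ∀ (s : KK k) (ft : Wd I n → KK k), rho C n y (s • ft) = s • rho C n y ft}
    mul_mem' := by
      intro a b ha hb s f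
      rw [map_mul, Module.End.mul_apply, Module.End.mul_apply, hb, ha]
    add_mem' := by
      intro a b ha hb s f
      rw [map_add, LinearMap.add_apply, LinearMap.add_apply, hb, ha, smul_add]
    algebraMap_mem' := by
      intro c s f
      rw [AlgHom.commutes, Module.algebraMap_end_apply, Module.algebraMap_end_apply, smul_comm] }
  refine alg_top C S ?_ ?_ ?_ y
  · intro ν s f; ext w
    rw [rho_e, Pi.smul_apply, Pi.smul_apply, rho_e]; split_ifs <;> simp
  · intro a s f; ext w
    rw [rho_x, Pi.smul_apply, Pi.smul_apply, rho_x, smul_eq_mul, smul_eq_mul]; ring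
  · intro l h s f; ext w
    rw [rho_t, Pi.smul_apply, Pi.smul_apply, Pi.smul_apply, rho_t]
    simp only [smul_eq_mul]; ring

theorem Theta_ker (n : ℕ) (hf : ∀ y : RA C n, rho C n y = 0 → y = 0) (c : Idx I n →₀ RA C n)
    (hc : rho C (n + 1) (Theta C n c) = 0) : c = 0 := by
  classical
  by_contra hne
  have hsup : c.support.Nonempty := Finsupp.support_nonempty_iff.2 hne
  obtain ⟨α0, hα0, hmin⟩ := Finset.exists_min_image c.support (lev n) hsup
  apply Finsupp.mem_support_iff.1 hα0
  apply hf
  apply LinearMap.ext; intro ft; ext u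
  rw [LinearMap.zero_apply, Pi.zero_apply]
  set κ := lev n α0 with hκ
  have key : ∀ N : ℕ, (∀ p, (u.1 p).1 < N) →
      ∑ α ∈ c.support with lev n α = κ ∧ (fin n α).2 = (fin n α0).2,
        Xv k N ^ (fin n α).1 * rho C n (c α) ft u = 0 := by
    intro N hN
    let Ω : Let I := (N, (fin n α0).2)
    obtain ⟨f, hfp⟩ := exists_probe C n κ (lev_le n α0) ft Ω
    have hu : ∀ p, (u.1 p).1 < Ω.1 := hN
    have h0 := congrFun (LinearMap.congr_fun hc f) (snocW u Ω fun p => (hu p).ne)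
    rw [Theta_apply, Finsupp.sum, map_sum, LinearMap.sum_apply, Finset.sum_apply] at h0
    rw [LinearMap.zero_apply, Pi.zero_apply] at h0
    rw [← h0, Finset.sum_filter]
    refine Finset.sum_congr rfl fun α hα => ?_
    rw [map_mul, Module.End.mul_apply]
    have hge := hmin α hα
    by_cases hl : lev n α = κ
    · have hrel : RelF (fun a => a.1 < Ω.1) Ω (rho C (n + 1) (bb C n α) f)
          ((if Ω.2 = (fin n α).2 then xv k Ω ^ (fin n α).1 else 0) • ft) := by
        intro w hw hA
        have := (hfp (initW w) hA α).1 hl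
        have e := snocW_init' w Ω hw (fun p => (hA p).ne)
        rw [e] at this
        rw [this]; rfl
      have := RelF_up C _ _ (c α) _ _ hrel (snocW u Ω fun p => (hu p).ne) (snocW_last _ _ _)
        (by intro p; rw [snocW_castSucc]; exact hu p)
      rw [this, initW_snocW]
      have lin : ∀ (y : RA C n) (s : KK k), rho C n y (s • ft) u = s * rho C n y ft u := by
        intro y s
        have := RelF_lin C y s ft
        rw [this]; rfl
      rw [lin]
      by_cases hcol : (fin n α).2 = (fin n α0).2
      · rw [if_pos ⟨hl, hcol⟩, if_pos hcol.symm]; rfl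
      · rw [if_neg (fun h => hcol h.2), if_neg (Ne.symm hcol), zero_mul]
    · have hlt : κ < lev n α := lt_of_le_of_ne hge (Ne.symm hl)
      have hrel : RelF (fun a => a.1 < Ω.1) Ω (rho C (n + 1) (bb C n α) f) 0 := by
        intro w hw hA
        have := (hfp (initW w) hA α).2 hlt
        have e := snocW_init' w Ω hw (fun p => (hA p).ne)
        rw [e] at this
        rw [this]; rfl
      have := RelF_up C _ _ (c α) _ _ hrel (snocW u Ω fun p => (hu p).ne) (snocW_last _ _ _)
        (by intro p; rw [snocW_castSucc]; exact hu p)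
      rw [this, if_neg (fun h => hl h.1)]
      simp
  let p : Polynomial (KK k) := ∑ α ∈ c.support with lev n α = κ ∧ (fin n α).2 = (fin n α0).2,
        Polynomial.monomial (fin n α).1 (rho C n (c α) ft u)
  obtain ⟨M, hM⟩ : ∃ M, ∀ p, (u.1 p).1 < M :=
    ⟨(Finset.univ.sup fun p => (u.1 p).1) + 1, fun p => Nat.lt_succ_of_le
      (Finset.le_sup (f := fun p => (u.1 p).1) (Finset.mem_univ p))⟩
  have hp : p = 0 := by
    apply Polynomial.eq_zero_of_infinite_isRoot
    refine Set.Infinite.mono (s := Set.range (fun t : ℕ => Xv k (M + t))) ?_ ?_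
    · rintro _ ⟨t, rfl⟩
      have := key (M + t) (fun p => lt_of_lt_of_le (hM p) (Nat.le_add_right _ _))
      simp only [Set.mem_ofPred_eq, Polynomial.IsRoot, p, Polynomial.eval_finsetSum,
        Polynomial.eval_monomial]
      rw [← this]
      exact Finset.sum_congr rfl fun _ _ => mul_comm _ _
    · apply Set.infinite_range_of_injective
      intro a b h
      have := (Xv k).injective h
      omega
  have hcoef : p.coeff (fin n α0).1 = rho C n (c α0) ft u := by
    simp only [p, Polynomial.finsetSum_coeff, Polynomial.coeff_monomial]
    rw [Finset.sum_eq_single α0]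
    · simp
    · intro α hα hne
      rw [Finset.mem_filter] at hα
      rw [if_neg]
      intro h
      exact hne (idx_inj n α α0 hα.2.1 (Prod.ext h hα.2.2))
    · intro h
      exact absurd (Finset.mem_filter.2 ⟨hα0, rfl, rfl⟩) h
  rw [← hcoef, hp, Polynomial.coeff_zero]

theorem rho_faithful (n : ℕ) : ∀ y : RA C n, rho C n y = 0 → y = 0 := by
  induction n with
  | zero =>
    intro y hy
    obtain ⟨c, rfl⟩ := alg_zero C y
    rw [AlgHom.commutes] at hy
    let w : Wd I 0 := ⟨Fin.elim0, fun a => a.elim0⟩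
    have := congrFun (LinearMap.congr_fun hy (fun _ => 1)) w
    rw [Module.algebraMap_end_apply, Pi.smul_apply, LinearMap.zero_apply, Pi.zero_apply,
      ← Algebra.algebraMap_eq_smul_one] at this
    have h0 : c = 0 := by simpa using this
    rw [h0, map_zero]
  | succ n ih =>
    intro y hy
    obtain ⟨c, rfl⟩ := Theta_surj C n y
    rw [Theta_ker C n ih c hy, map_zero]

theorem Theta_inj (n : ℕ) : Function.Injective (Theta C n) := by
  rw [← LinearMap.ker_eq_bot, LinearMap.ker_eq_bot']
  intro c hc
  exact Theta_ker C n (rho_faithful C n) c (by rw [hc, map_zero])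

/-- The freeness isomorphism. -/
noncomputable def ThetaE (n : ℕ) : (Idx I n →₀ RA C n) ≃ₗ[k] RA C (n + 1) :=
  LinearEquiv.ofBijective (Theta C n) ⟨Theta_inj C n, fun y => Theta_surj C n y⟩

theorem ThetaE_symm_bb {n : ℕ} (α : Idx I n) (r : RA C n) :
    (ThetaE C n).symm (up C n r * bb C n α) = Finsupp.single α r := by
  rw [LinearEquiv.symm_apply_eq]
  exact (Theta_single C α r).symm

theorem ThetaE_apply {n : ℕ} (c : Idx I n →₀ RA C n) : ThetaE C n c = Theta C n c := rfl

end KLR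


namespace KLR

set_option linter.unusedSectionVars false
set_option linter.unusedSimpArgs false
set_option autoImplicit false

variable {k : Type} [Field k] {I : Type} [Fintype I] [DecidableEq I] (C : CartanDatum k I)
variable (L : I → ℕ)

/-- The cyclotomic element. -/
noncomputable def aL : (n : ℕ) → RA C n
  | 0 => 0
  | n + 1 => ∑ ν : Fin (n + 1) → I, xx C (0 : Fin (n + 1)) ^ (L (ν 0)) * ee C ν

theorem aL_up (n : ℕ) : up C (n + 1) (aL C L (n + 1)) = aL C L (n + 2) := by
  apply ext_e
  intro μ
  have h1 : aL C L (n + 2) * ee C μ = xx C 0 ^ (L (μ 0)) * ee C μ := by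
    unfold aL
    rw [Finset.sum_mul, Finset.sum_eq_single μ]
    · rw [mul_assoc, ee_mul, if_pos rfl]
    · intro b _ hb; rw [mul_assoc, ee_mul, if_neg hb, mul_zero]
    · simp
  rw [h1]
  unfold aL
  rw [map_sum, Finset.sum_mul, Finset.sum_eq_single (Fin.init μ)]
  · rw [map_mul, map_pow, up_x, mul_assoc, up_e_mul, if_pos rfl]
    rfl
  · intro b _ hb
    rw [map_mul, mul_assoc, up_e_mul, if_neg (Ne.symm hb), mul_zero]
  · simp

/-- The cyclotomic ideal. -/
noncomputable def J (n : ℕ) : Submodule k (RA C n) :=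
  Submodule.span k {y | ∃ r s, y = r * aL C L n * s}

variable {L}

theorem J_mul_left {n : ℕ} (r : RA C n) {y : RA C n} (hy : y ∈ J C L n) : r * y ∈ J C L n := by
  induction hy using Submodule.span_induction with
  | mem x hx =>
    obtain ⟨a, b, rfl⟩ := hx
    exact Submodule.subset_span ⟨r * a, b, by simp only [mul_assoc]⟩
  | zero => simp
  | add _ _ _ _ h1 h2 => rw [mul_add]; exact add_mem h1 h2
  | smul c _ _ h => rw [mul_smul_comm]; exact Submodule.smul_mem _ _ h

theorem J_mul_right {n : ℕ} (r : RA C n) {y : RA C n} (hy : y ∈ J C L n) : y * r ∈ J C L n := by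
  induction hy using Submodule.span_induction with
  | mem x hx =>
    obtain ⟨a, b, rfl⟩ := hx
    exact Submodule.subset_span ⟨a, b * r, by simp only [mul_assoc]⟩
  | zero => simp
  | add _ _ _ _ h1 h2 => rw [add_mul]; exact add_mem h1 h2
  | smul c _ _ h => rw [smul_mul_assoc]; exact Submodule.smul_mem _ _ h

theorem aL_mem (n : ℕ) : aL C L n ∈ J C L n := Submodule.subset_span ⟨1, 1, by simp⟩

theorem J_up {n : ℕ} {y : RA C n} (hy : y ∈ J C L n) : up C n y ∈ J C L (n + 1) := by
  induction hy using Submodule.span_induction with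
  | mem x hx =>
    obtain ⟨a, b, rfl⟩ := hx
    cases n with
    | zero => simp [aL]
    | succ n =>
      rw [map_mul, map_mul, aL_up]
      exact Submodule.subset_span ⟨_, _, rfl⟩
  | zero => simp
  | add _ _ _ _ h1 h2 => rw [map_add]; exact add_mem h1 h2
  | smul c _ _ h => rw [map_smul]; exact Submodule.smul_mem _ _ h

variable (L) in
/-- The elements `z_n`. -/
noncomputable def zz : (n : ℕ) → RA C (n + 1)
  | 0 => aL C L 1
  | n + 1 => T C n * up C (n + 1) (zz n) * T C n

theorem zz_succ (n : ℕ) : zz C L (n + 1) = T C n * up C (n + 1) (zz C L n) * T C n := rfl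

theorem zz_mem : ∀ n, zz C L n ∈ J C L (n + 1)
  | 0 => aL_mem C 1
  | n + 1 => J_mul_right C _ (J_mul_left C _ (J_up C (zz_mem n)))

variable (L) in
/-- The sub-bimodule generated by the smaller ideal. -/
noncomputable def Ks (n : ℕ) : Submodule k (RA C (n + 1)) :=
  Submodule.span k ({y | ∃ j ∈ J C L n, ∃ r, y = up C n j * r} ∪ {y | ∃ j ∈ J C L n, ∃ r, y = r * up C n j})

theorem Ks_l {n : ℕ} {j : RA C n} (hj : j ∈ J C L n) (r : RA C (n + 1)) : up C n j * r ∈ Ks C L n :=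
  Submodule.subset_span (Or.inl ⟨j, hj, r, rfl⟩)
theorem Ks_r {n : ℕ} {j : RA C n} (hj : j ∈ J C L n) (r : RA C (n + 1)) : r * up C n j ∈ Ks C L n :=
  Submodule.subset_span (Or.inr ⟨j, hj, r, rfl⟩)

@[elab_as_elim]
theorem Ks_induction {n : ℕ} {p : RA C (n + 1) → Prop}
    (hl : ∀ j r, j ∈ J C L n → p (up C n j * r)) (hr : ∀ j r, j ∈ J C L n → p (r * up C n j))
    (h0 : p 0) (hadd : ∀ x y, p x → p y → p (x + y)) (hsmul : ∀ (c : k) x, p x → p (c • x))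
    {y : RA C (n + 1)} (hy : y ∈ Ks C L n) : p y := by
  induction hy using Submodule.span_induction with
  | mem x hx =>
    rcases hx with ⟨j, hj, r, rfl⟩ | ⟨j, hj, r, rfl⟩
    · exact hl j r hj
    · exact hr j r hj
  | zero => exact h0
  | add x y _ _ hx hy => exact hadd x y hx hy
  | smul c x _ hx => exact hsmul c x hx

theorem P_Ks {n : ℕ} {p : RA C (n + 1)} (hp : p ∈ P C n) {y : RA C (n + 1)} (hy : y ∈ Ks C L n) :
    p * y ∈ Ks C L n := by
  refine Ks_induction C ?_ ?_ ?_ ?_ ?_ hy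
  · intro j r hj
    revert hj j
    refine P_induction C ?_ ?_ ?_ ?_ hp
    · intro s m i j hj
      unfold pm
      have h1 := ((cXu C j).pow_left m).eq
      have h2 := (cEu C i j).eq
      have : up C n s * (X C n ^ m * E C n i) * (up C n j * r) =
          up C n (s * j) * (X C n ^ m * E C n i * r) := by
        simp only [mul_assoc, map_mul]
        rw [← mul_assoc (E C n i) (up C n j), h2, ← mul_assoc (X C n ^ m), ← mul_assoc (X C n ^ m), h1]
        simp only [mul_assoc]
      rw [this]
      exact Ks_l C (J_mul_left C _ hj) _
    · intro j _; simp
    · intro a b ha hb j hj; rw [add_mul]; exact add_mem (ha j hj) (hb j hj)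
    · intro c a ha j hj; rw [smul_mul_assoc]; exact Submodule.smul_mem _ _ (ha j hj)
  · intro j r hj
    rw [← mul_assoc]; exact Ks_r C hj _
  · simp
  · intro a b ha hb; rw [mul_add]; exact add_mem ha hb
  · intro c a ha; rw [mul_smul_comm]; exact Submodule.smul_mem _ _ ha

theorem Ks_P {n : ℕ} {p : RA C (n + 1)} (hp : p ∈ P C n) {y : RA C (n + 1)} (hy : y ∈ Ks C L n) :
    y * p ∈ Ks C L n := by
  refine Ks_induction C ?_ ?_ ?_ ?_ ?_ hy
  · intro j r hj
    rw [mul_assoc]; exact Ks_l C hj _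
  · intro j r hj
    revert hj j
    refine P_induction C ?_ ?_ ?_ ?_ hp
    · intro s m i j hj
      unfold pm
      have h1 := ((cXu C (j * s)).pow_left m).eq
      have h2 := (cEu C i (j * s)).eq
      have : r * up C n j * (up C n s * (X C n ^ m * E C n i)) =
          r * (X C n ^ m * E C n i) * up C n (j * s) := by
        rw [mul_assoc, ← mul_assoc (up C n j), ← map_mul, mul_assoc, mul_assoc, h2,
          ← mul_assoc (X C n ^ m), h1]
        simp only [mul_assoc]
      rw [this]
      exact Ks_r C (J_mul_right C _ hj) _
    · intro j _; simp
    · intro a b ha hb j hj; rw [mul_add]; exact add_mem (ha j hj) (hb j hj)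
    · intro c a ha j hj; rw [mul_smul_comm]; exact Submodule.smul_mem _ _ (ha j hj)
  · simp
  · intro a b ha hb; rw [add_mul]; exact add_mem ha hb
  · intro c a ha; rw [smul_mul_assoc]; exact Submodule.smul_mem _ _ ha

theorem T_Ks_T {n : ℕ} {y : RA C (n + 1)} (hy : y ∈ Ks C L n) :
    T C n * up C (n + 1) y * T C n ∈ Ks C L (n + 1) := by
  refine Ks_induction C ?_ ?_ ?_ ?_ ?_ hy
  · intro j r hj
    rw [map_mul, ← mul_assoc, T_upup, mul_assoc, mul_assoc]
    exact Ks_l C (J_up C hj) _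
  · intro j r hj
    rw [map_mul, ← mul_assoc, mul_assoc, ← T_upup, ← mul_assoc]
    exact Ks_r C (J_up C hj) _
  · simp
  · intro a b ha hb; rw [map_add, mul_add, add_mul]; exact add_mem ha hb
  · intro c a ha; rw [map_smul, mul_smul_comm, smul_mul_assoc]; exact Submodule.smul_mem _ _ ha

/-- `z` is central modulo `Ks` for `P`. -/
theorem P_zz (n : ℕ) : ∀ p ∈ P C n, p * zz C L n - zz C L n * p ∈ Ks C L n := by
  have main : ∀ n, (∀ r, up C n r * zz C L n - zz C L n * up C n r ∈ Ks C L n) →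
      (X C n * zz C L n - zz C L n * X C n ∈ Ks C L n) →
      (∀ j, E C n j * zz C L n - zz C L n * E C n j ∈ Ks C L n) →
      ∀ p ∈ P C n, p * zz C L n - zz C L n * p ∈ Ks C L n := by
    intro n h1 h2 h3 p hp
    let S : Subalgebra k (RA C (n + 1)) :=
    { carrier := {p | p ∈ P C n ∧ p * zz C L n - zz C L n * p ∈ Ks C L n}
      mul_mem' := by
        rintro a b ⟨ha, ha'⟩ ⟨hb, hb'⟩
        refine ⟨mul_mem ha hb, ?_⟩
        have : a * b * zz C L n - zz C L n * (a * b) = a * (b * zz C L n - zz C L n * b) +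
          (a * zz C L n - zz C L n * a) * b := by noncomm_ring
        rw [this]
        exact add_mem (P_Ks C ha hb') (Ks_P C hb ha')
      add_mem' := by
        rintro a b ⟨ha, ha'⟩ ⟨hb, hb'⟩
        refine ⟨add_mem ha hb, ?_⟩
        have : (a + b) * zz C L n - zz C L n * (a + b) = (a * zz C L n - zz C L n * a) +
          (b * zz C L n - zz C L n * b) := by noncomm_ring
        rw [this]
        exact add_mem ha' hb'
      algebraMap_mem' := by
        intro c
        refine ⟨Subalgebra.algebraMap_mem _ c, ?_⟩
        rw [Algebra.commutes, sub_self]; exact zero_mem _ }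
    exact (P_le C S (fun y => ⟨up_mem_P C y, h1 y⟩) ⟨X_mem_P C n, h2⟩ (fun j => ⟨E_mem_P C n j, h3 j⟩) hp).2
  have comS : ∀ n, (∃ S : Subalgebra k (RA C n), ∀ r, r ∈ S ↔
      up C n r * zz C L n - zz C L n * up C n r ∈ Ks C L n) := by
    intro n
    refine ⟨{ carrier := {r | up C n r * zz C L n - zz C L n * up C n r ∈ Ks C L n}
              mul_mem' := ?_
              add_mem' := ?_
              algebraMap_mem' := ?_ }, fun r => Iff.rfl⟩
    · intro a b ha hb
      have : up C n (a * b) * zz C L n - zz C L n * up C n (a * b) =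
          up C n a * (up C n b * zz C L n - zz C L n * up C n b) +
          (up C n a * zz C L n - zz C L n * up C n a) * up C n b := by
        rw [map_mul]; noncomm_ring
      show _ ∈ Ks C L n
      rw [this]
      exact add_mem (P_Ks C (up_mem_P C _) hb) (Ks_P C (up_mem_P C _) ha)
    · intro a b ha hb
      have : up C n (a + b) * zz C L n - zz C L n * up C n (a + b) =
          (up C n a * zz C L n - zz C L n * up C n a) +
          (up C n b * zz C L n - zz C L n * up C n b) := by
        rw [map_add]; noncomm_ring
      show _ ∈ Ks C L n
      rw [this]
      exact add_mem ha hb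
    · intro c
      show _ ∈ Ks C L n
      rw [AlgHom.commutes, Algebra.commutes, sub_self]; exact zero_mem _
  induction n with
  | zero =>
    have hx : ∀ y : RA C 1, y * zz C L 0 - zz C L 0 * y = 0 := by
      have hE : ∀ ν : Fin 1 → I, ∀ j, Commute (E C 0 j) (ee C ν) := fun ν j => (ee_ec_comm C _ j ν).symm
      let S : Subalgebra k (RA C 1) := Subalgebra.centralizer k {zz C L 0}
      have : ∀ y, y ∈ S := by
        refine alg_top_one C S ?_ ?_
        · rw [Subalgebra.mem_centralizer_iff]
          rintro _ rfl
          refine (Commute.sum_left _ _ _ fun ν _ => Commute.mul_left ?_ ?_).eq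
          · exact Commute.pow_left ((isRep_alg C 1).xx _ _) _
          · exact ((isRep_alg C 1).xe _ _).symm
        · intro j
          rw [Subalgebra.mem_centralizer_iff]
          rintro _ rfl
          refine (Commute.sum_left _ _ _ fun ν _ => Commute.mul_left ?_ ?_).eq
          · exact Commute.pow_left (xx_ec_comm C _ _ _) _
          · exact (hE ν j).symm
      intro y
      have := Subalgebra.mem_centralizer_iff k |>.1 (this y) _ rfl
      rw [this, sub_self]
    intro p _
    rw [hx]; exact zero_mem _
  | succ n ih =>
    have hz := zz_mem (L := L) C n
    have zT : up C (n + 1) (zz C L n) * T C n ∈ Ks C L (n + 1) := Ks_l C hz _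
    have Tz : T C n * up C (n + 1) (zz C L n) ∈ Ks C L (n + 1) := Ks_r C hz _
    have hX1 : up C (n + 1) (X C n) * zz C L (n + 1) - zz C L (n + 1) * up C (n + 1) (X C n) ∈ Ks C L (n + 1) := by
      have e1 := T_X1 C n
      have e2 := T_X2 C n
      have e3 := X_up C (zz C L n)
      have : up C (n + 1) (X C n) * zz C L (n + 1) - zz C L (n + 1) * up C (n + 1) (X C n) =
          T C n * up C (n + 1) (zz C L n) * EE C n - EE C n * (up C (n + 1) (zz C L n) * T C n) := by
        rw [zz_succ]
        have e2' : up C (n + 1) (X C n) * T C n = T C n * X C (n + 1) - EE C n := by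
          rw [e2, add_sub_cancel_right]
        calc _ = (up C (n + 1) (X C n) * T C n) * up C (n + 1) (zz C L n) * T C n -
              T C n * up C (n + 1) (zz C L n) * (T C n * up C (n + 1) (X C n)) := by noncomm_ring
          _ = T C n * (X C (n + 1) * up C (n + 1) (zz C L n)) * T C n
              - EE C n * (up C (n + 1) (zz C L n) * T C n)
              - T C n * up C (n + 1) (zz C L n) * X C (n + 1) * T C n
              + T C n * up C (n + 1) (zz C L n) * EE C n := by rw [e1, e2']; noncomm_ring
          _ = _ := by rw [e3]; noncomm_ring
      rw [this]
      exact sub_mem (Ks_P C (EE_mem_P C n) Tz) (P_Ks C (EE_mem_P C n) zT)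
    have hX2 : X C (n + 1) * zz C L (n + 1) - zz C L (n + 1) * X C (n + 1) ∈ Ks C L (n + 1) := by
      have e1 := T_X1 C n
      have e2 := T_X2 C n
      have : X C (n + 1) * zz C L (n + 1) - zz C L (n + 1) * X C (n + 1) =
          T C n * up C (n + 1) (X C n * zz C L n - zz C L n * X C n) * T C n +
          EE C n * (up C (n + 1) (zz C L n) * T C n) - T C n * up C (n + 1) (zz C L n) * EE C n := by
        rw [zz_succ, map_sub, map_mul, map_mul]
        have e1' : X C (n + 1) * T C n = T C n * up C (n + 1) (X C n) + EE C n := by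
          rw [e1, sub_add_cancel]
        calc _ = (X C (n + 1) * T C n) * up C (n + 1) (zz C L n) * T C n -
              T C n * up C (n + 1) (zz C L n) * (T C n * X C (n + 1)) := by noncomm_ring
          _ = _ := by rw [e1', e2]; noncomm_ring
      rw [this]
      exact sub_mem (add_mem (T_Ks_T C (ih _ (X_mem_P C n))) (P_Ks C (EE_mem_P C n) zT))
        (Ks_P C (EE_mem_P C n) Tz)
    have hE1 : ∀ j, up C (n + 1) (E C n j) * zz C L (n + 1) - zz C L (n + 1) * up C (n + 1) (E C n j) ∈ Ks C L (n + 1) := by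
      intro j
      have : up C (n + 1) (E C n j) * zz C L (n + 1) = zz C L (n + 1) * up C (n + 1) (E C n j) := by
        rw [zz_succ]
        rw [← mul_assoc, ← mul_assoc, ← T_E, mul_assoc (T C n) (E C _ _), E_up, mul_assoc _ (T C n) (up C _ _), T_E']
        simp only [mul_assoc]
      rw [this, sub_self]; exact zero_mem _
    have hE2 : ∀ j, E C (n + 1) j * zz C L (n + 1) - zz C L (n + 1) * E C (n + 1) j ∈ Ks C L (n + 1) := by
      intro j
      have : E C (n + 1) j * zz C L (n + 1) - zz C L (n + 1) * E C (n + 1) j =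
          T C n * up C (n + 1) (E C n j * zz C L n - zz C L n * E C n j) * T C n := by
        rw [zz_succ, map_sub, map_mul, map_mul]
        calc _ = (E C (n + 1) j * T C n) * up C (n + 1) (zz C L n) * T C n -
              T C n * up C (n + 1) (zz C L n) * (T C n * E C (n + 1) j) := by noncomm_ring
          _ = _ := by rw [← T_E', T_E]; noncomm_ring
      rw [this]
      exact T_Ks_T C (ih _ (E_mem_P C n j))
    refine main _ ?_ hX2 hE2
    intro r
    obtain ⟨S, hS⟩ := comS (n + 1)
    rw [← hS]
    cases n with
    | zero => exact alg_top_one C S ((hS _).2 hX1) (fun j => (hS _).2 (hE1 j)) r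
    | succ n =>
      refine alg_top_succ C S ?_ ((hS _).2 hX1) (fun j => (hS _).2 (hE1 j)) ((hS _).2 ?_) r
      · intro y
        rw [hS]
        have : up C (n + 1 + 1) (up C (n + 1) y) * zz C L (n + 1 + 1) - zz C L (n + 1 + 1) * up C (n + 1 + 1) (up C (n + 1) y) =
            T C (n + 1) * up C (n + 1 + 1) (up C (n + 1) y * zz C L (n + 1) - zz C L (n + 1) * up C (n + 1) y) * T C (n + 1) := by
          rw [zz_succ C (n + 1), map_sub, map_mul, map_mul]
          have e := T_upup C y
          calc _ = (up C (n + 1 + 1) (up C (n + 1) y) * T C (n + 1)) * up C _ (zz C L (n + 1)) * T C (n + 1) -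
                T C (n + 1) * up C _ (zz C L (n + 1)) * (T C (n + 1) * up C (n + 1 + 1) (up C (n + 1) y)) := by noncomm_ring
            _ = (T C (n + 1) * up C (n + 1 + 1) (up C (n + 1) y)) * up C _ (zz C L (n + 1)) * T C (n + 1) -
                T C (n + 1) * up C _ (zz C L (n + 1)) * (up C (n + 1 + 1) (up C (n + 1) y) * T C (n + 1)) := by simp only [e]
            _ = _ := by noncomm_ring
        rw [this]
        exact T_Ks_T C (ih _ (up_mem_P C y))
      · have hb := braid' C n
        have hz' := J_up C (zz_mem (L := L) C n)
        have hc := T_upup C (zz C L n)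
        set t := T C (n + 1)
        set t' := up C (n + 2) (T C n)
        set ζ := up C (n + 2) (up C (n + 1) (zz C L n)) with hζ
        have hzz : zz C L (n + 1 + 1) = t * (t' * ζ * t') * t := by
          rw [zz_succ, zz_succ, map_mul, map_mul]
        have : t' * zz C L (n + 1 + 1) - zz C L (n + 1 + 1) * t' =
            t * t' * ζ * Dd C n - Dd C n * (ζ * t' * t) := by
          rw [hzz]
          have hb' : t' * t * t' = t * t' * t - Dd C n := by rw [hb, add_sub_cancel_right]
          calc _ = (t' * t * t') * ζ * t' * t - t * t' * ζ * (t' * t * t') := by noncomm_ring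
            _ = t * t' * (t * ζ) * t' * t - Dd C n * (ζ * t' * t) - t * t' * ζ * (t * t' * t)
                + t * t' * ζ * Dd C n := by rw [hb']; noncomm_ring
            _ = _ := by rw [hc]; noncomm_ring
        rw [this]
        refine sub_mem (Ks_P C (Dd_mem C n) (Ks_r C hz' _)) (P_Ks C (Dd_mem C n) ?_)
        rw [mul_assoc]
        exact Ks_l C hz' _

variable (L) in
/-- `Ks + P z`. -/
noncomputable def Zs (n : ℕ) : Submodule k (RA C (n + 1)) where
  carrier := {y | ∃ p ∈ P C n, y - p * zz C L n ∈ Ks C L n}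
  zero_mem' := ⟨0, zero_mem _, by simp⟩
  add_mem' := by
    rintro a b ⟨p, hp, h⟩ ⟨q, hq, h'⟩
    refine ⟨p + q, add_mem hp hq, ?_⟩
    have : a + b - (p + q) * zz C L n = (a - p * zz C L n) + (b - q * zz C L n) := by noncomm_ring
    rw [this]; exact add_mem h h'
  smul_mem' := by
    rintro c a ⟨p, hp, h⟩
    refine ⟨c • p, Subalgebra.smul_mem _ hp c, ?_⟩
    rw [smul_mul_assoc, ← smul_sub]; exact Submodule.smul_mem _ _ h

theorem mem_Zs {n : ℕ} {y : RA C (n + 1)} : y ∈ Zs C L n ↔ ∃ p ∈ P C n, y - p * zz C L n ∈ Ks C L n := Iff.rfl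

theorem Ks_Zs {n : ℕ} {y : RA C (n + 1)} (h : y ∈ Ks C L n) : y ∈ Zs C L n :=
  ⟨0, zero_mem _, by simpa using h⟩

theorem P_Zs {n : ℕ} {p : RA C (n + 1)} (hp : p ∈ P C n) {y : RA C (n + 1)} (hy : y ∈ Zs C L n) :
    p * y ∈ Zs C L n := by
  obtain ⟨q, hq, h⟩ := hy
  refine ⟨p * q, mul_mem hp hq, ?_⟩
  rw [mul_assoc, ← mul_sub]; exact P_Ks C hp h

theorem Zs_P {n : ℕ} {p : RA C (n + 1)} (hp : p ∈ P C n) {y : RA C (n + 1)} (hy : y ∈ Zs C L n) :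
    y * p ∈ Zs C L n := by
  obtain ⟨q, hq, h⟩ := hy
  refine ⟨q * p, mul_mem hq hp, ?_⟩
  have : y * p - q * p * zz C L n = (y - q * zz C L n) * p - q * (p * zz C L n - zz C L n * p) := by
    noncomm_ring
  rw [this]
  exact sub_mem (Ks_P C hp h) (P_Ks C hq (P_zz C n p hp))

theorem zz_Zs (n : ℕ) : zz C L n ∈ Zs C L n := ⟨1, one_mem _, by simp⟩

theorem T_Zs_T {n : ℕ} {y : RA C (n + 1)} (hy : y ∈ Zs C L n) :
    T C n * up C (n + 1) y * T C n ∈ Zs C L (n + 1) := by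
  obtain ⟨p, hp, h⟩ := hy
  obtain ⟨q, hq, q', hq', hT⟩ := T_P C hp
  have : T C n * up C (n + 1) y * T C n = T C n * up C (n + 1) (y - p * zz C L n) * T C n +
      q * zz C L (n + 1) + q' * (up C (n + 1) (zz C L n) * T C n) := by
    rw [map_sub, map_mul, mul_sub, ← mul_assoc (T C n) (up C _ p), hT, zz_succ]
    noncomm_ring
  rw [this]
  refine add_mem (add_mem (Ks_Zs C (T_Ks_T C h)) (P_Zs C hq (zz_Zs C _))) (P_Zs C hq' (Ks_Zs C ?_))
  exact Ks_l C (zz_mem C n) _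

theorem J_le_Zs (n : ℕ) : ∀ y ∈ J C L (n + 1), y ∈ Zs C L n := by
  induction n with
  | zero =>
    intro y hy
    induction hy using Submodule.span_induction with
    | mem x hx =>
      obtain ⟨a, b, rfl⟩ := hx
      exact Zs_P C (P_zero_top C b) (P_Zs C (P_zero_top C a) (zz_Zs C 0))
    | zero => exact zero_mem _
    | add _ _ _ _ h1 h2 => exact add_mem h1 h2
    | smul c _ _ h => exact Submodule.smul_mem _ _ h
  | succ n ih =>
    intro y hy
    induction hy using Submodule.span_induction with
    | mem x hx =>
      obtain ⟨a, b, rfl⟩ := hx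
      rw [← aL_up]
      have ha := aL_mem (L := L) C (n + 1)
      refine VS_induction C (p := fun a => a * up C (n + 1) (aL C L (n + 1)) * b ∈ Zs C L (n + 1))
        ?_ ?_ ?_ ?_ ?_ (VS_top C n a)
      · intro r m j
        rw [mul_assoc]
        exact P_Zs C (pm_mem C r m j) (Ks_Zs C (Ks_l C ha b))
      · intro r s
        refine VS_induction C (p := fun b => up C (n + 1) r * T C n * up C (n + 1) s *
          up C (n + 1) (aL C L (n + 1)) * b ∈ Zs C L (n + 1)) ?_ ?_ ?_ ?_ ?_ (VS_top C n b)
        · intro r m j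
          exact Zs_P C (pm_mem C r m j) (Ks_Zs C (Ks_r C ha _))
        · intro r' s'
          have : up C (n + 1) r * T C n * up C (n + 1) s * up C (n + 1) (aL C L (n + 1)) *
              (up C (n + 1) r' * T C n * up C (n + 1) s') = up C (n + 1) r *
              (T C n * up C (n + 1) (s * aL C L (n + 1) * r') * T C n) * up C (n + 1) s' := by
            simp only [map_mul, mul_assoc]
          rw [this]
          exact Zs_P C (up_mem_P C _) (P_Zs C (up_mem_P C _) (T_Zs_T C (ih _
            (J_mul_right C _ (J_mul_left C _ ha)))))
        · simp
        · intro a b ha hb; rw [mul_add]; exact add_mem ha hb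
        · intro c a ha; rw [mul_smul_comm]; exact Submodule.smul_mem _ _ ha
      · simp
      · intro a b ha hb; rw [add_mul, add_mul]; exact add_mem ha hb
      · intro c a ha; rw [smul_mul_assoc, smul_mul_assoc]; exact Submodule.smul_mem _ _ ha
    | zero => exact zero_mem _
    | add _ _ _ _ h1 h2 => exact add_mem h1 h2
    | smul c _ _ h => exact Submodule.smul_mem _ _ h

end KLR


namespace KLR

set_option linter.unusedSectionVars false
set_option linter.unusedSimpArgs false
set_option autoImplicit false

variable {k : Type} [Field k] {I : Type} [Fintype I] [DecidableEq I] (C : CartanDatum k I)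
variable {L : I → ℕ}

/-- The elements `ι(r) τ ι(s)`. -/
def IsTau : (n : ℕ) → RA C (n + 1) → Prop
  | 0, _ => False
  | n + 1, y => ∃ r s : RA C (n + 1), y = up C (n + 1) r * T C n * up C (n + 1) s

theorem R_ind {n : ℕ} {p : RA C (n + 1) → Prop} (hpm : ∀ r m j, p (pm C r m j))
    (ht : ∀ y, IsTau C n y → p y)
    (h0 : p 0) (hadd : ∀ x y, p x → p y → p (x + y)) (hsmul : ∀ (c : k) x, p x → p (c • x))
    (y : RA C (n + 1)) : p y := by
  cases n with
  | zero => exact P_induction C hpm h0 hadd hsmul (P_zero_top C y)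
  | succ n => exact VS_induction C hpm (fun r s => ht _ ⟨r, s, rfl⟩) h0 hadd hsmul (VS_top C n y)

theorem IsTau_up_left {n : ℕ} (r : RA C n) {y : RA C (n + 1)} (h : IsTau C n y) :
    IsTau C n (up C n r * y) := by
  cases n with
  | zero => exact h.elim
  | succ n =>
    obtain ⟨a, b, rfl⟩ := h
    exact ⟨r * a, b, by rw [map_mul]; simp only [mul_assoc]⟩

theorem IsTau_up_right {n : ℕ} (r : RA C n) {y : RA C (n + 1)} (h : IsTau C n y) :
    IsTau C n (y * up C n r) := by
  cases n with
  | zero => exact h.elim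
  | succ n =>
    obtain ⟨a, b, rfl⟩ := h
    exact ⟨a, b * r, by rw [map_mul]; simp only [mul_assoc]⟩

theorem IsTau_E_left {n : ℕ} (j : I) {y : RA C (n + 1)} (h : IsTau C n y) :
    IsTau C n (E C n j * y) := by
  cases n with
  | zero => exact h.elim
  | succ n =>
    obtain ⟨a, b, rfl⟩ := h
    refine ⟨a, E C n j * b, ?_⟩
    calc _ = (E C (n + 1) j * up C (n + 1) a) * T C n * up C (n + 1) b := by simp only [mul_assoc]
      _ = up C (n + 1) a * (E C (n + 1) j * T C n) * up C (n + 1) b := by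
        rw [E_up]; simp only [mul_assoc]
      _ = _ := by rw [← T_E', map_mul]; simp only [mul_assoc]

theorem IsTau_E_right {n : ℕ} (j : I) {y : RA C (n + 1)} (h : IsTau C n y) :
    IsTau C n (y * E C n j) := by
  cases n with
  | zero => exact h.elim
  | succ n =>
    obtain ⟨a, b, rfl⟩ := h
    refine ⟨a * E C n j, b, ?_⟩
    calc _ = up C (n + 1) a * T C n * (up C (n + 1) b * E C (n + 1) j) := by simp only [mul_assoc]
      _ = up C (n + 1) a * (T C n * E C (n + 1) j) * up C (n + 1) b := by
        rw [← E_up]; simp only [mul_assoc]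
      _ = _ := by rw [T_E, map_mul]; simp only [mul_assoc]

theorem topI_inj {n m m' : ℕ} {j j' : I} (h : topI n m j = topI n m' j') : m = m' ∧ j = j' := by
  cases n with
  | zero => exact Prod.mk.inj h
  | succ n => exact Prod.mk.inj (Sum.inl_injective h)

theorem tauI_ne {n m : ℕ} {j : I} (α : Idx I n) : tauI α ≠ topI (n + 1) m j := by
  intro h
  cases h

/-- The coordinate functional at `X^d E_i`. -/
noncomputable def Y (n : ℕ) (i : I) (d : ℕ) : RA C (n + 1) →ₗ[k] RA C n :=
  (Finsupp.lapply (topI n d i)).comp (ThetaE C n).symm.toLinearMap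

theorem Y_apply {n : ℕ} (i : I) (d : ℕ) (y : RA C (n + 1)) :
    Y C n i d y = (ThetaE C n).symm y (topI n d i) := rfl

theorem Y_pm {n : ℕ} (i : I) (d : ℕ) (r : RA C n) (m : ℕ) (j : I) :
    Y C n i d (pm C r m j) = if m = d ∧ j = i then r else 0 := by
  rw [Y_apply, pm, ← bb_topI, ThetaE_symm_bb]
  by_cases h : m = d ∧ j = i
  · rw [if_pos h, h.1, h.2, Finsupp.single_eq_same]
  · rw [if_neg h, Finsupp.single_eq_of_ne]
    intro h'
    obtain ⟨h1, h2⟩ := topI_inj h'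
    exact h ⟨h1.symm, h2.symm⟩

theorem up_T_up {n : ℕ} (r s : RA C (n + 1)) (p : RA C (n + 2) → Prop)
    (hp : ∀ r α, p (up C (n + 1) r * bb C (n + 1) (tauI α)))
    (h0 : p 0) (hadd : ∀ x y, p x → p y → p (x + y)) :
    p (up C (n + 1) r * T C n * up C (n + 1) s) := by
  obtain ⟨c, rfl⟩ := (ThetaE C n).surjective s
  rw [ThetaE_apply]
  induction c using Finsupp.induction_linear with
  | zero => rw [map_zero, map_zero, mul_zero]; exact h0
  | add f g hf hg => rw [map_add, map_add, mul_add]; exact hadd _ _ hf hg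
  | single α b =>
    rw [Theta_single, map_mul, mul_assoc, ← mul_assoc (T C n), T_upup, mul_assoc, ← mul_assoc,
      ← map_mul]
    exact hp _ _

theorem Y_tau {n : ℕ} (i : I) (d : ℕ) {y : RA C (n + 1)} (h : IsTau C n y) : Y C n i d y = 0 := by
  cases n with
  | zero => exact h.elim
  | succ n =>
    obtain ⟨r, s, rfl⟩ := h
    refine up_T_up C r s (fun y => Y C (n + 1) i d y = 0) ?_ (map_zero _) ?_
    · intro r α
      rw [Y_apply, ThetaE_symm_bb, Finsupp.single_eq_of_ne]
      exact (tauI_ne α).symm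
    · intro x y hx hy
      rw [map_add, hx, hy, add_zero]

theorem Y_up_left {n : ℕ} (i : I) (d : ℕ) (r : RA C n) (y : RA C (n + 1)) :
    Y C n i d (up C n r * y) = r * Y C n i d y := by
  refine R_ind C (p := fun y => Y C n i d (up C n r * y) = r * Y C n i d y) ?_ ?_ ?_ ?_ ?_ y
  · intro s m j
    have : up C n r * pm C s m j = pm C (r * s) m j := by
      rw [pm, pm, map_mul, mul_assoc]
    rw [this, Y_pm, Y_pm, mul_ite, mul_zero]
  · intro y h
    rw [Y_tau C i d h, Y_tau C i d (IsTau_up_left C r h), mul_zero]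
  · simp
  · intro x y hx hy; rw [mul_add, map_add, map_add, hx, hy, mul_add]
  · intro c x hx; rw [mul_smul_comm, map_smul, map_smul, hx, mul_smul_comm]

theorem pm_up {n : ℕ} (s r : RA C n) (m : ℕ) (j : I) : pm C s m j * up C n r = pm C (s * r) m j := by
  have h : Commute (X C n ^ m * E C n j) (up C n r) :=
    ((cXu C r).pow_left m).mul_left (cEu C j r)
  rw [pm, pm, map_mul, mul_assoc, h.eq, mul_assoc]

theorem Y_up_right {n : ℕ} (i : I) (d : ℕ) (r : RA C n) (y : RA C (n + 1)) :
    Y C n i d (y * up C n r) = Y C n i d y * r := by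
  refine R_ind C (p := fun y => Y C n i d (y * up C n r) = Y C n i d y * r) ?_ ?_ ?_ ?_ ?_ y
  · intro s m j
    rw [pm_up, Y_pm, Y_pm, ite_mul, zero_mul]
  · intro y h
    rw [Y_tau C i d h, Y_tau C i d (IsTau_up_right C r h), zero_mul]
  · simp
  · intro x y hx hy; rw [add_mul, map_add, map_add, hx, hy, add_mul]
  · intro c x hx; rw [smul_mul_assoc, map_smul, map_smul, hx, smul_mul_assoc]

theorem pm_E {n : ℕ} (s : RA C n) (m : ℕ) (j j' : I) :
    pm C s m j * E C n j' = if j = j' then pm C s m j else 0 := by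
  rw [pm, mul_assoc, mul_assoc, E_E]
  split_ifs <;> simp

theorem E_pm {n : ℕ} (s : RA C n) (m : ℕ) (j j' : I) :
    E C n j' * pm C s m j = if j = j' then pm C s m j else 0 := by
  have h : Commute (E C n j') (up C n s * X C n ^ m) :=
    (cEu C j' s).mul_right ((cXE C j').symm.pow_right m)
  rw [pm, ← mul_assoc, ← mul_assoc, mul_assoc (E C n j'), h.eq, mul_assoc, E_E]
  split_ifs with h1 h2 h2
  · rw [h1, mul_assoc]
  · exact absurd h1.symm h2
  · exact absurd h2.symm h1
  · simp

theorem X_pm {n : ℕ} (s : RA C n) (m : ℕ) (j : I) :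
    X C n * pm C s m j = pm C s (m + 1) j := by
  rw [pm, ← mul_assoc, X_up, pm, pow_succ']
  simp only [mul_assoc]

theorem Y_E_left {n : ℕ} (i j : I) (d : ℕ) (y : RA C (n + 1)) :
    Y C n i d (E C n j * y) = if j = i then Y C n i d y else 0 := by
  refine R_ind C (p := fun y => Y C n i d (E C n j * y) = if j = i then Y C n i d y else 0) ?_ ?_ ?_ ?_ ?_ y
  · intro s m j'
    rw [E_pm]
    by_cases h1 : j' = j
    · subst h1
      rw [if_pos rfl, Y_pm]
      by_cases h2 : j' = i <;> simp [h2]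
    · rw [if_neg h1, map_zero, Y_pm]
      by_cases h2 : j = i
      · subst h2; simp [h1]
      · simp [h2]
  · intro y h
    rw [Y_tau C i d h, Y_tau C i d (IsTau_E_left C j h)]; simp
  · simp
  · intro x y hx hy; rw [mul_add, map_add, map_add, hx, hy]; split_ifs <;> simp
  · intro c x hx; rw [mul_smul_comm, map_smul, map_smul, hx]; split_ifs <;> simp

theorem Y_E_right {n : ℕ} (i j : I) (d : ℕ) (y : RA C (n + 1)) :
    Y C n i d (y * E C n j) = if j = i then Y C n i d y else 0 := by
  refine R_ind C (p := fun y => Y C n i d (y * E C n j) = if j = i then Y C n i d y else 0) ?_ ?_ ?_ ?_ ?_ y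
  · intro s m j'
    rw [pm_E]
    by_cases h1 : j' = j
    · subst h1
      rw [if_pos rfl, Y_pm]
      by_cases h2 : j' = i <;> simp [h2]
    · rw [if_neg h1, map_zero, Y_pm]
      by_cases h2 : j = i
      · subst h2; simp [h1]
      · simp [h2]
  · intro y h
    rw [Y_tau C i d h, Y_tau C i d (IsTau_E_right C j h)]; simp
  · simp
  · intro x y hx hy; rw [add_mul, map_add, map_add, hx, hy]; split_ifs <;> simp
  · intro c x hx; rw [smul_mul_assoc, map_smul, map_smul, hx]; split_ifs <;> simp

theorem X_tau {n : ℕ} {y : RA C (n + 1)} (h : IsTau C n y) :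
    ∃ y' : RA C (n + 1), IsTau C n y' ∧ ∃ f : I → RA C n, X C n * y = y' + ∑ j, pm C (f j) 0 j := by
  cases n with
  | zero => exact h.elim
  | succ n =>
    obtain ⟨a, b, rfl⟩ := h
    refine ⟨up C (n + 1) a * T C n * up C (n + 1) (X C n * b), ⟨_, _, rfl⟩,
      fun j => a * E C n j * b, ?_⟩
    have e1 : ∀ j, pm C (a * E C n j * b) 0 j = up C (n + 1) a * (up C (n + 1) (E C n j) * E C (n + 1) j) * up C (n + 1) b := by
      intro j
      rw [pm, pow_zero, one_mul, map_mul, map_mul]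
      simp only [mul_assoc]
      rw [E_up]
    calc _ = (X C (n + 1) * up C (n + 1) a) * T C n * up C (n + 1) b := by simp only [mul_assoc]
      _ = up C (n + 1) a * (X C (n + 1) * T C n) * up C (n + 1) b := by
        rw [X_up]; simp only [mul_assoc]
      _ = up C (n + 1) a * (T C n * up C (n + 1) (X C n) + EE C n) * up C (n + 1) b := by
        rw [T_X1, sub_add_cancel]
      _ = _ := by
        simp only [e1]
        rw [← Finset.sum_mul, ← Finset.mul_sum, map_mul]
        unfold EE
        noncomm_ring

theorem Y_X {n : ℕ} (i : I) (d : ℕ) (y : RA C (n + 1)) :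
    Y C n i (d + 1) (X C n * y) = Y C n i d y := by
  refine R_ind C (p := fun y => Y C n i (d + 1) (X C n * y) = Y C n i d y) ?_ ?_ ?_ ?_ ?_ y
  · intro s m j
    rw [X_pm, Y_pm, Y_pm]; simp
  · intro y h
    obtain ⟨y', h', f, hf⟩ := X_tau C h
    rw [hf, map_add, Y_tau C i _ h', map_sum, Y_tau C i _ h]
    simp [Y_pm]
  · simp
  · intro x y hx hy; rw [mul_add, map_add, map_add, hx, hy]
  · intro c x hx; rw [mul_smul_comm, map_smul, map_smul, hx]

theorem Y_Xpow {n : ℕ} (i : I) (d b : ℕ) (y : RA C (n + 1)) :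
    Y C n i (d + b) (X C n ^ b * y) = Y C n i d y := by
  induction b with
  | zero => simp
  | succ b ih => rw [pow_succ', mul_assoc, ← add_assoc, Y_X, ih]

theorem Y_fin {n : ℕ} (i : I) (y : RA C (n + 1)) : ∃ N, ∀ d ≥ N, Y C n i d y = 0 := by
  refine R_ind C (p := fun y => ∃ N, ∀ d ≥ N, Y C n i d y = 0) ?_ ?_ ?_ ?_ ?_ y
  · intro s m j
    refine ⟨m + 1, fun d hd => ?_⟩
    rw [Y_pm, if_neg]; omega
  · intro y h
    exact ⟨0, fun d _ => Y_tau C i d h⟩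
  · exact ⟨0, by simp⟩
  · rintro x y ⟨N, hN⟩ ⟨N', hN'⟩
    refine ⟨max N N', fun d hd => ?_⟩
    rw [map_add, hN d (le_trans (le_max_left _ _) hd), hN' d (le_trans (le_max_right _ _) hd), add_zero]
  · rintro c x ⟨N, hN⟩
    exact ⟨N, fun d hd => by rw [map_smul, hN d hd, smul_zero]⟩

end KLR


namespace KLR

set_option linter.unusedSectionVars false
set_option linter.unusedSimpArgs false
set_option autoImplicit false

variable {k : Type} [Field k] {I : Type} [Fintype I] [DecidableEq I] (C : CartanDatum k I)
variable {L : I → ℕ}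

theorem T_Xpow (n m : ℕ) : T C n * up C (n + 1) (X C n) ^ m = X C (n + 1) ^ m * T C n -
    ∑ q ∈ Finset.range m, up C (n + 1) (X C n) ^ (m - 1 - q) * X C (n + 1) ^ q * EE C n := by
  induction m with
  | zero => simp
  | succ m ih =>
    rw [pow_succ, ← mul_assoc, ih, sub_mul, mul_assoc, T_X1, Finset.sum_range_succ, Finset.sum_mul]
    have : ∀ q ∈ Finset.range m, up C (n + 1) (X C n) ^ (m - 1 - q) * X C (n + 1) ^ q * EE C n *
        up C (n + 1) (X C n) = up C (n + 1) (X C n) ^ (m + 1 - 1 - q) * X C (n + 1) ^ q * EE C n := by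
      intro q hq
      have hq' := Finset.mem_range.1 hq
      have h : m + 1 - 1 - q = (m - 1 - q) + 1 := by omega
      have hc := ((cXu C (X C n)).pow_left q).eq
      rw [h, pow_succ, mul_assoc, EE_X1]
      simp only [mul_assoc]
      rw [← mul_assoc (X C (n + 1) ^ q), hc]
      simp only [mul_assoc]
    rw [Finset.sum_congr rfl this, pow_succ]
    simp only [Nat.add_sub_cancel, Nat.sub_self, pow_zero, one_mul]
    noncomm_ring

/-- Vanishing of the braid correction. -/
theorem Y_Dd (n : ℕ) (i j : I) (D : ℕ) (h : i = j ∨ (-(C.a i j)).toNat ≤ D) :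
    Y C (n + 2) i D (Dd C n) * E C (n + 1) j = 0 := by
  have term : ∀ (a b : I) (c e q : ℕ),
      Y C (n + 2) i D (((up C (n + 2) (up C (n + 1) (X C n))) ^ c * X C (n + 2) ^ e * (up C (n + 2) (X C (n + 1))) ^ q) *
      (up C (n + 2) (up C (n + 1) (E C n a)) * (up C (n + 2) (E C (n + 1) b) * E C (n + 2) a))) =
      if e = D ∧ a = i then (up C (n + 1) (X C n)) ^ c * X C (n + 1) ^ q * (up C (n + 1) (E C n a) * E C (n + 1) b) else 0 := by
    intro a b c e q
    rw [← Y_pm]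
    congr 1
    rw [pm]
    simp only [map_mul, map_pow, mul_assoc]
    congr 1
    have h1 := ((cXu C (X C (n + 1) ^ q * (up C (n + 1) (E C n a) * E C (n + 1) b))).pow_left e).eq
    simp only [map_mul, map_pow, mul_assoc] at h1
    rw [← mul_assoc (up C (n + 2) (E C (n + 1) b))]
    rw [← mul_assoc (up C (n + 2) (up C (n + 1) (E C n a)))]
    rw [← mul_assoc (up C (n + 2) (X C (n + 1)) ^ q)]
    rw [← mul_assoc (X C (n+2) ^ e), h1]
    simp only [mul_assoc]
  unfold Dd
  rw [map_sum, Finset.sum_mul]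
  refine Finset.sum_eq_zero fun a _ => ?_
  rw [map_sum, Finset.sum_mul]
  refine Finset.sum_eq_zero fun b _ => ?_
  unfold Qdiff
  split_ifs with hab
  · simp
  simp only [Finset.sum_mul, map_sum]
  refine Finset.sum_eq_zero fun p hp => ?_
  refine Finset.sum_eq_zero fun q hq => ?_
  split_ifs with hcond
  swap
  · simp
  rw [smul_mul_assoc, map_smul, smul_mul_assoc, Finset.sum_mul, map_sum, Finset.sum_mul,
    Finset.sum_eq_zero, smul_zero]
  intro c hc
  rw [term]
  split_ifs with h1
  swap
  · simp
  obtain ⟨h1, rfl⟩ := h1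
  rw [mul_assoc, mul_assoc, mul_assoc, E_E]
  by_cases hbj : b = j
  · subst hbj
    exfalso
    rcases h with h | h
    · exact hab h
    · have := Finset.mem_range.1 hc
      have := Finset.mem_range.1 hp
      omega
  · rw [if_neg hbj]; simp

theorem TyT_tau {n : ℕ} (i j : I) (D : ℕ) (h : i = j ∨ (-(C.a i j)).toNat ≤ D) {y : RA C (n + 1)}
    (hy : IsTau C n y) : Y C (n + 1) i D (T C n * up C (n + 1) y * T C n) * E C n j = 0 := by
  cases n with
  | zero => exact hy.elim
  | succ n =>
    obtain ⟨r, s, rfl⟩ := hy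
    have e : T C (n + 1) * up C (n + 2) (up C (n + 1) r * T C n * up C (n + 1) s) * T C (n + 1) =
        up C (n + 2) (up C (n + 1) r) * (up C (n + 2) (T C n) * T C (n + 1) * up C (n + 2) (T C n) + Dd C n) *
          up C (n + 2) (up C (n + 1) s) := by
      rw [← braid', map_mul, map_mul]
      calc _ = (T C (n + 1) * up C (n + 2) (up C (n + 1) r)) * up C (n + 2) (T C n) * (up C (n + 2) (up C (n + 1) s) * T C (n + 1)) := by
            simp only [mul_assoc]
        _ = _ := by
          have e1 := T_upup C (n := n + 1) r
          have e2 := T_upup C (n := n + 1) s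
          rw [e1, ← e2]
          simp only [mul_assoc]
    rw [e, Y_up_right, Y_up_left, map_add, Y_tau C (n := n + 2) i D (show IsTau C (n + 2) _ from ⟨_, _, rfl⟩), zero_add, mul_assoc, ← E_up,
      ← mul_assoc, mul_assoc (up C (n + 1) r), Y_Dd C n i j D h]
    simp

/-- Reduction for monomials. -/
theorem TyT_pm {n : ℕ} (i j : I) (D : ℕ) (r : RA C n) (m : ℕ) (l : I) :
    Y C (n + 1) i D (T C n * up C (n + 1) (pm C r m l) * T C n) * E C n j =
      if l = i then up C n r * Y C (n + 1) i D (T C n * up C (n + 1) (X C n) ^ m *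
        (up C (n + 1) (E C n i) * E C (n + 1) j) * T C n) else 0 := by
  have hT : T C n * (up C (n + 1) (E C n j) * E C (n + 1) i) =
      (up C (n + 1) (E C n i) * E C (n + 1) j) * T C n := by
    rw [← mul_assoc, T_E', mul_assoc, T_E, ← mul_assoc, E_up]
  have h1 : Y C (n + 1) i D (T C n * up C (n + 1) (pm C r m l) * T C n) * E C n j =
      Y C (n + 1) i D (T C n * up C (n + 1) (pm C r m l) * T C n * up C (n + 1) (E C n j) * E C (n + 1) i) := by
    rw [Y_E_right, if_pos rfl, Y_up_right]
  have h2 : T C n * up C (n + 1) (pm C r m l) * T C n * up C (n + 1) (E C n j) * E C (n + 1) i =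
      up C (n + 1) (up C n r) * (T C n * up C (n + 1) (X C n) ^ m * (up C (n + 1) (E C n l * E C n i) * E C (n + 1) j) * T C n) := by
    rw [pm, map_mul, map_mul, map_pow, ← mul_assoc, T_upup]
    calc _ = up C (n + 1) (up C n r) * (T C n * (up C (n + 1) (X C n) ^ m * up C (n + 1) (E C n l)) * (T C n * (up C (n + 1) (E C n j) * E C (n + 1) i))) := by
          simp only [mul_assoc]
      _ = _ := by rw [hT, map_mul]; simp only [mul_assoc]
  rw [h1, h2, Y_up_left, E_E]
  split_ifs with h
  · rw [h]
  · simp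

/-- The formula in the case `j ≠ i`. -/
theorem formA {n : ℕ} (i j : I) (hij : j ≠ i) (D : ℕ) (hD : (-(C.a i j)).toNat ≤ D) (y : RA C (n + 1)) :
    Y C (n + 1) i D (T C n * up C (n + 1) y * T C n) * E C n j =
    ∑ p ∈ Finset.range ((-(C.a j i)).toNat + 1), ∑ q ∈ Finset.range ((-(C.a i j)).toNat + 1),
      if C.d j * (p : ℤ) + C.d i * (q : ℤ) = -(C.d j * C.a j i) then
        C.t j i p q • (up C n (Y C n i (D - q) y) * (X C n ^ p * E C n j)) else 0 := by
  refine R_ind C (p := fun y => Y C (n + 1) i D (T C n * up C (n + 1) y * T C n) * E C n j =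
    ∑ p ∈ Finset.range ((-(C.a j i)).toNat + 1), ∑ q ∈ Finset.range ((-(C.a i j)).toNat + 1),
      if C.d j * (p : ℤ) + C.d i * (q : ℤ) = -(C.d j * C.a j i) then
        C.t j i p q • (up C n (Y C n i (D - q) y) * (X C n ^ p * E C n j)) else 0) ?_ ?_ ?_ ?_ ?_ y
  · intro r m l
    rw [TyT_pm]
    by_cases hl : l = i
    swap
    · rw [if_neg hl]
      symm
      refine Finset.sum_eq_zero fun p _ => Finset.sum_eq_zero fun q _ => ?_
      have : Y C n i (D - q) (pm C r m l) = 0 := by rw [Y_pm, if_neg (fun h => hl h.2)]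
      rw [this]; simp
    rw [if_pos hl]
    subst hl
    have h1 : T C n * up C (n + 1) (X C n) ^ m * (up C (n + 1) (E C n l) * E C (n + 1) j) * T C n =
        X C (n + 1) ^ m * (Qel C j l (up C (n + 1) (X C n)) (X C (n + 1)) * (up C (n + 1) (E C n j) * E C (n + 1) l)) := by
      rw [T_Xpow, sub_mul, Finset.sum_mul, Finset.sum_eq_zero, sub_zero]
      · rw [← T_sq]
        have hT : (up C (n + 1) (E C n l) * E C (n + 1) j) * T C n =
            T C n * (up C (n + 1) (E C n j) * E C (n + 1) l) := by
          rw [mul_assoc, ← T_E', ← mul_assoc, ← T_E, mul_assoc, E_up]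
        rw [mul_assoc, hT]
        simp only [mul_assoc]
      · intro q _
        rw [mul_assoc, EE_up_E, if_neg (fun h => hij h.symm), mul_zero]
    rw [h1, Qel, if_neg hij]
    simp only [Finset.sum_mul, Finset.mul_sum, map_sum]
    refine Finset.sum_congr rfl fun p _ => Finset.sum_congr rfl fun q hq => ?_
    have hq' := Finset.mem_range.1 hq
    split_ifs with hc
    swap
    · simp
    rw [smul_mul_assoc, mul_smul_comm, map_smul, mul_smul_comm]
    have h2 : X C (n + 1) ^ m * (up C (n + 1) (X C n) ^ p * X C (n + 1) ^ q * (up C (n + 1) (E C n j) * E C (n + 1) l)) =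
        pm C (X C n ^ p * E C n j) (m + q) l := by
      rw [pm, map_mul, map_pow, pow_add]
      have c1 : Commute (X C (n + 1) ^ m) (up C (n + 1) (X C n) ^ p) := ((cXu C (X C n)).pow_left m).pow_right p
      have c2 : Commute (X C (n + 1) ^ q) (up C (n + 1) (E C n j)) := ((cXu C (E C n j)).pow_left q)
      have c3 : Commute (X C (n + 1) ^ m) (up C (n + 1) (E C n j)) := ((cXu C (E C n j)).pow_left m)
      calc _ = (X C (n + 1) ^ m * up C (n + 1) (X C n) ^ p) * (X C (n + 1) ^ q * up C (n + 1) (E C n j)) * E C (n + 1) l := by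
            simp only [mul_assoc]
        _ = up C (n + 1) (X C n) ^ p * (X C (n + 1) ^ m * up C (n + 1) (E C n j)) * X C (n + 1) ^ q * E C (n + 1) l := by
            rw [c1.eq, c2.eq]; simp only [mul_assoc]
        _ = _ := by rw [c3.eq]; simp only [mul_assoc]
    rw [h2, Y_pm, Y_pm]
    by_cases h3 : m + q = D
    · rw [if_pos ⟨h3, rfl⟩, if_pos ⟨by omega, rfl⟩]
    · rw [if_neg (fun h => h3 h.1), if_neg (fun h => h3 (by omega))]; simp
  · intro y hy
    rw [TyT_tau C i j D (Or.inr hD) hy]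
    symm
    refine Finset.sum_eq_zero fun p _ => Finset.sum_eq_zero fun q _ => ?_
    rw [Y_tau C i _ hy]; simp
  · simp
  · intro x y hx hy
    rw [map_add, mul_add, add_mul, map_add, add_mul, hx, hy, ← Finset.sum_add_distrib]
    refine Finset.sum_congr rfl fun p _ => ?_
    rw [← Finset.sum_add_distrib]
    refine Finset.sum_congr rfl fun q _ => ?_
    split_ifs
    · rw [map_add, map_add, add_mul, smul_add]
    · simp
  · intro c x hx
    rw [map_smul, mul_smul_comm, smul_mul_assoc, map_smul, smul_mul_assoc, hx, Finset.smul_sum]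
    refine Finset.sum_congr rfl fun p _ => ?_
    rw [Finset.smul_sum]
    refine Finset.sum_congr rfl fun q _ => ?_
    split_ifs
    · rw [map_smul, map_smul, smul_mul_assoc, smul_comm]
    · simp

theorem Y_T (n : ℕ) (i : I) (D : ℕ) : Y C (n + 1) i D (T C n) = 0 :=
  Y_tau C i D (n := n + 1) ⟨1, 1, by simp⟩

theorem Y_XqT0 (n : ℕ) (i : I) (q : ℕ) :
    Y C (n + 1) i 0 (X C (n + 1) ^ (q + 1) * T C n) * E C n i = X C n ^ q * E C n i := by
  have step : ∀ q, X C (n + 1) ^ (q + 1) * T C n = X C (n + 1) ^ q * T C n * up C (n + 1) (X C n) +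
      ∑ j, pm C (E C n j) q j := by
    intro q
    have h : X C (n + 1) * T C n = T C n * up C (n + 1) (X C n) + EE C n := by
      rw [T_X1, sub_add_cancel]
    rw [pow_succ, mul_assoc, h, mul_add, mul_assoc]
    congr 1
    unfold EE
    rw [Finset.mul_sum]
    refine Finset.sum_congr rfl fun j _ => ?_
    rw [pm, ← mul_assoc, ((cXu C (E C n j)).pow_left q).eq, mul_assoc]
  induction q with
  | zero =>
    rw [step, map_add, Y_up_right, pow_zero, one_mul, Y_T, zero_mul, zero_add, map_sum,
      Finset.sum_eq_single i]
    · rw [Y_pm, if_pos ⟨rfl, rfl⟩, pow_zero, one_mul, E_E, if_pos rfl]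
    · intro b _ hb; rw [Y_pm, if_neg (fun h => hb h.2)]
    · simp
  | succ q ih =>
    rw [step, map_add, Y_up_right, add_mul, mul_assoc, X_E, ← mul_assoc, ih, map_sum,
      Finset.sum_eq_zero, zero_mul, add_zero, mul_assoc, ← X_E, ← mul_assoc, pow_succ]
    intro b _
    rw [Y_pm, if_neg (fun h => by omega)]

theorem Y_XqT (n : ℕ) (i : I) (q D : ℕ) :
    Y C (n + 1) i D (X C (n + 1) ^ q * T C n) * E C n i =
      if D < q then X C n ^ (q - 1 - D) * E C n i else 0 := by
  split_ifs with h
  · have := Y_Xpow C (n := n + 1) i 0 D (X C (n + 1) ^ (q - D) * T C n)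
    rw [← mul_assoc, ← pow_add, zero_add, Nat.add_sub_cancel' h.le] at this
    have h2 : q - D = (q - 1 - D) + 1 := by omega
    rw [this, h2, Y_XqT0]
  · have := Y_Xpow C (n := n + 1) i (D - q) q (T C n)
    rw [Nat.sub_add_cancel (by omega)] at this
    rw [this, Y_T, zero_mul]

/-- The formula in the case `j = i`. -/
theorem formB {n : ℕ} (i : I) (D : ℕ) (y : RA C (n + 1)) : ∃ N, ∀ N' ≥ N,
    Y C (n + 1) i D (T C n * up C (n + 1) y * T C n) * E C n i =
    - ∑ s ∈ Finset.range N', (s + 1) • (up C n (Y C n i (D + 2 + s) y) * (X C n ^ s * E C n i)) := by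
  refine R_ind C (p := fun y => ∃ N, ∀ N' ≥ N,
    Y C (n + 1) i D (T C n * up C (n + 1) y * T C n) * E C n i =
    - ∑ s ∈ Finset.range N', (s + 1) • (up C n (Y C n i (D + 2 + s) y) * (X C n ^ s * E C n i))) ?_ ?_ ?_ ?_ ?_ y
  · intro r m l
    refine ⟨m, fun N' hN' => ?_⟩
    rw [TyT_pm]
    split_ifs with hl
    swap
    · symm
      rw [Finset.sum_eq_zero, neg_zero]
      intro s _
      rw [Y_pm, if_neg (fun h => hl h.2)]; simp
    subst hl
    have h0 : T C n * T C n * (up C (n + 1) (E C n l) * E C (n + 1) l) = 0 := by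
      rw [T_sq, Qel, if_pos rfl, zero_mul]
    have hT : (up C (n + 1) (E C n l) * E C (n + 1) l) * T C n =
        T C n * (up C (n + 1) (E C n l) * E C (n + 1) l) := by
      rw [mul_assoc, ← T_E', ← mul_assoc, ← T_E, mul_assoc, E_up]
    have h1 : T C n * up C (n + 1) (X C n) ^ m * (up C (n + 1) (E C n l) * E C (n + 1) l) * T C n =
        - ∑ q ∈ Finset.range m, up C (n + 1) (X C n ^ (m - 1 - q)) * (X C (n + 1) ^ q * T C n *
          up C (n + 1) (E C n l) * E C (n + 1) l) := by
      rw [T_Xpow, sub_mul, mul_assoc, sub_mul, mul_assoc, mul_assoc, hT, ← mul_assoc (T C n), h0, mul_zero,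
        zero_sub, Finset.sum_mul, Finset.sum_mul]
      congr 1
      refine Finset.sum_congr rfl fun q _ => ?_
      rw [mul_assoc _ (EE C n), EE_up_E, if_pos rfl, mul_assoc, hT, map_pow]
      simp only [mul_assoc]
    rw [h1, map_neg, map_sum, mul_neg]
    congr 1
    have h2 : ∀ q ∈ Finset.range m, Y C (n + 1) l D (up C (n + 1) (X C n ^ (m - 1 - q)) * (X C (n + 1) ^ q * T C n *
          up C (n + 1) (E C n l) * E C (n + 1) l)) = if D < q then X C n ^ (m - 2 - D) * E C n l else 0 := by
      intro q hq
      have := Finset.mem_range.1 hq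
      rw [Y_up_left, Y_E_right, if_pos rfl, Y_up_right, Y_XqT]
      split_ifs with h
      · rw [← mul_assoc, ← pow_add]
        congr 2; omega
      · simp
    rw [Finset.sum_congr rfl h2, ← Finset.sum_filter, Finset.sum_const]
    have h3 : (Finset.filter (fun q => D < q) (Finset.range m)).card = m - 1 - D := by
      have : Finset.filter (fun q => D < q) (Finset.range m) = Finset.Ico (D + 1) m := by
        ext q; simp; omega
      rw [this, Nat.card_Ico]; omega
    rw [h3]
    by_cases h4 : D + 2 ≤ m
    · rw [Finset.sum_eq_single (m - 2 - D)]
      · rw [Y_pm, if_pos ⟨by omega, rfl⟩, mul_smul_comm]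
        congr 1; omega
      · intro s _ hs
        rw [Y_pm, if_neg (fun h => hs (by omega))]; simp
      · intro h; exact absurd (Finset.mem_range.2 (by omega)) h
    · rw [show m - 1 - D = 0 by omega, zero_smul, mul_zero, Finset.sum_eq_zero]
      intro s _
      rw [Y_pm, if_neg (fun h => by omega)]; simp
  · intro y hy
    refine ⟨0, fun N' _ => ?_⟩
    rw [TyT_tau C i i D (Or.inl rfl) hy]
    symm
    rw [Finset.sum_eq_zero, neg_zero]
    intro s _
    rw [Y_tau C i _ hy]; simp
  · exact ⟨0, by simp⟩
  · rintro x y ⟨N, hx⟩ ⟨M, hy⟩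
    refine ⟨max N M, fun N' hN' => ?_⟩
    rw [map_add, mul_add, add_mul, map_add, add_mul, hx N' (le_trans (le_max_left _ _) hN'),
      hy N' (le_trans (le_max_right _ _) hN'), ← neg_add, ← Finset.sum_add_distrib]
    congr 1
    refine Finset.sum_congr rfl fun p _ => ?_
    rw [map_add, map_add, add_mul, smul_add]
  · rintro c x ⟨N, hx⟩
    refine ⟨N, fun N' hN' => ?_⟩
    rw [map_smul, mul_smul_comm, smul_mul_assoc, map_smul, smul_mul_assoc, hx N' hN', smul_neg, Finset.smul_sum]
    congr 1
    refine Finset.sum_congr rfl fun p _ => ?_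
    rw [map_smul, map_smul, smul_mul_assoc, smul_comm]

end KLR


namespace KLR

set_option linter.unusedSectionVars false
set_option linter.unusedSimpArgs false
set_option autoImplicit false

variable {k : Type} [Field k] {I : Type} [Fintype I] [DecidableEq I] (C : CartanDatum k I)
variable {L : I → ℕ}

variable (L) in
/-- The weight pairing along a word. -/
def wt (i : I) {n : ℕ} (ν : Fin n → I) : ℤ := (L i : ℤ) - ∑ p, C.a i (ν p)

/-- Leading coefficient of one letter. -/
def g1 (i j : I) : k := if j = i then -1 else C.t i j (-(C.a i j)).toNat 0

/-- Leading coefficient of a word. -/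
def gam (i : I) {n : ℕ} (ν : Fin n → I) : k := ∏ p, g1 C i (ν p)

theorem gam_ne (i : I) {n : ℕ} (ν : Fin n → I) : gam C i ν ≠ 0 := by
  unfold gam
  rw [Finset.prod_ne_zero_iff]
  intro p _
  unfold g1
  split_ifs with h
  · exact neg_ne_zero.2 one_ne_zero
  · exact C.t_lead _ _ (Ne.symm h)

theorem shiftJ {n : ℕ} (i : I) (D m : ℕ) : ∀ {z : RA C (n + 1)}, z ∈ J C L (n + 1) →
    Y C (n + 1) i D (X C (n + 1) ^ m * (T C n * up C (n + 1) z * T C n)) -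
      Y C (n + 1) i D (T C n * up C (n + 1) (X C n ^ m * z) * T C n) ∈ J C L (n + 1) := by
  induction m with
  | zero => intro z hz; simp
  | succ m ih =>
    intro z hz
    have h1 := ih (J_mul_left C (X C n) hz)
    rw [← mul_assoc (X C n ^ m), ← pow_succ] at h1
    have h : X C (n + 1) * T C n = T C n * up C (n + 1) (X C n) + EE C n := by
      rw [T_X1, sub_add_cancel]
    have h2 : X C (n + 1) ^ (m + 1) * (T C n * up C (n + 1) z * T C n) =
        X C (n + 1) ^ m * (T C n * up C (n + 1) (X C n * z) * T C n) +
        ∑ j, up C (n + 1) (E C n j * z) * (X C (n + 1) ^ m * E C (n + 1) j * T C n) := by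
      have h3 : ∀ j, up C (n + 1) (E C n j * z) * (X C (n + 1) ^ m * E C (n + 1) j * T C n) =
          X C (n + 1) ^ m * (up C (n + 1) (E C n j) * E C (n + 1) j) * (up C (n + 1) z * T C n) := by
        intro j
        have c1 := ((cXu C (E C n j * z)).pow_left m).eq
        have c2 := (cEu C (n := n + 1) j z).eq
        rw [← mul_assoc, ← mul_assoc, ← c1, map_mul]
        simp only [mul_assoc]
        rw [← mul_assoc (up C (n + 1) z), ← c2]
        simp only [mul_assoc]
      simp only [h3]
      rw [← Finset.sum_mul, ← Finset.mul_sum, pow_succ, mul_assoc, ← mul_assoc (X C (n + 1)),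
        ← mul_assoc (X C (n + 1)), h, map_mul]
      unfold EE
      noncomm_ring
    rw [h2, map_add, map_sum, add_sub_right_comm]
    refine add_mem h1 (Submodule.sum_mem _ fun j _ => ?_)
    rw [Y_up_left]
    exact J_mul_right C _ (J_mul_left C _ hz)

theorem zz_zero : zz C L 0 = ∑ j, X C 0 ^ (L j) * E C 0 j := by
  apply ext_e
  intro μ
  have h1 : zz C L 0 * ee C μ = xx C 0 ^ (L (μ 0)) * ee C μ := by
    show aL C L 1 * ee C μ = _
    unfold aL
    rw [Finset.sum_mul, Finset.sum_eq_single μ]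
    · rw [mul_assoc, ee_mul, if_pos rfl]
    · intro b _ hb; rw [mul_assoc, ee_mul, if_neg hb, mul_zero]
    · simp
  rw [h1, Finset.sum_mul, Finset.sum_eq_single (μ 0)]
  · rw [mul_assoc, E, ec_mul_ee, if_pos (by rfl)]; rfl
  · intro b _ hb
    rw [mul_assoc, E, ec_mul_ee, if_neg (fun h => hb h.symm), mul_zero]
  · simp

set_option maxHeartbeats 1000000 in
/-- The leading coefficient theorem. -/
theorem lead (i : I) : ∀ (n : ℕ) (ν : Fin n → I) (m D : ℕ),
    (wt C L i ν + m < D → Y C n i D (X C n ^ m * zz C L n) * ee C ν ∈ J C L n) ∧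
    (wt C L i ν + m = D → Y C n i D (X C n ^ m * zz C L n) * ee C ν - gam C i ν • ee C ν ∈ J C L n) := by
  intro n
  induction n with
  | zero =>
    intro ν m D
    have h1 : Y C 0 i D (X C 0 ^ m * zz C L 0) = if m + L i = D then 1 else 0 := by
      rw [zz_zero, Finset.mul_sum, map_sum, Finset.sum_eq_single i]
      · rw [← mul_assoc, ← pow_add]
        have : X C 0 ^ (m + L i) * E C 0 i = pm C 1 (m + L i) i := by rw [pm, map_one, one_mul]
        rw [this, Y_pm]; simp
      · intro j _ hj
        rw [← mul_assoc, ← pow_add]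
        have : X C 0 ^ (m + L j) * E C 0 j = pm C 1 (m + L j) j := by rw [pm, map_one, one_mul]
        rw [this, Y_pm, if_neg (fun h => hj h.2)]
      · simp
    rw [h1]
    unfold wt gam
    simp only [Finset.univ_eq_empty, Finset.sum_empty, Finset.prod_empty, sub_zero, one_smul]
    constructor
    · intro h; rw [if_neg (by omega), zero_mul]; exact zero_mem _
    · intro h; rw [if_pos (by omega), one_mul, sub_self]; exact zero_mem _
  | succ n ih =>
    intro ν
    set j := ν (Fin.last n) with hj
    set ν' := Fin.init ν with hν'
    have hwt : wt C L i ν = wt C L i ν' - C.a i j := by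
      unfold wt
      rw [Fin.sum_univ_castSucc, hν', hj]
      simp only [Fin.init]
      ring
    have hgam : gam C i ν = gam C i ν' * g1 C i j := by
      unfold gam
      rw [Fin.prod_univ_castSucc]; rfl
    have hee : ee C ν = up C n (ee C ν') * E C n j := ee_eq C n ν
    -- reduction
    suffices H : ∀ m D : ℕ, (-(C.a i j)).toNat ≤ D →
        (wt C L i ν + m < D → Y C (n + 1) i D (T C n * up C (n + 1) (X C n ^ m * zz C L n) * T C n) *
          E C n j * up C n (ee C ν') ∈ J C L (n + 1)) ∧
        (wt C L i ν + m = D → Y C (n + 1) i D (T C n * up C (n + 1) (X C n ^ m * zz C L n) * T C n) *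
          E C n j * up C n (ee C ν') - gam C i ν • ee C ν ∈ J C L (n + 1)) by
      intro m D
      have hsh := Y_Xpow C (n := n + 1) i D ((-(C.a i j)).toNat) (X C (n + 1) ^ m * zz C L (n + 1))
      rw [← mul_assoc, ← pow_add] at hsh
      rw [← hsh]
      obtain ⟨H1, H2⟩ := H ((-(C.a i j)).toNat + m) (D + (-(C.a i j)).toNat) (by omega)
      have hs := J_mul_right C (ee C ν) (shiftJ C (L := L) i (D + (-(C.a i j)).toNat) ((-(C.a i j)).toNat + m) (zz_mem C n))
      rw [← zz_succ, sub_mul, hee, ← E_up, ← mul_assoc, ← mul_assoc] at hs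
      rw [hee] at H2
      rw [hee, ← E_up, ← mul_assoc]
      constructor
      · intro h
        have := add_mem hs (H1 (by push_cast; omega))
        rwa [sub_add_cancel] at this
      · intro h
        have := add_mem hs (H2 (by push_cast; omega))
        rw [← add_sub_assoc, sub_add_cancel, ← E_up] at this
        exact this
    intro m D hD
    set y := X C n ^ m * zz C L n with hy
    have hterm : ∀ (r : RA C n) (p : ℕ), up C n r * (X C n ^ p * E C n j) * up C n (ee C ν') =
        up C n (r * ee C ν') * (X C n ^ p * E C n j) := by
      intro r p
      have : Commute (X C n ^ p * E C n j) (up C n (ee C ν')) :=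
        ((cXu C _).pow_left p).mul_left (cEu C j _)
      rw [mul_assoc, this.eq, map_mul, mul_assoc]
    by_cases hij : j = i
    · -- the case j = i
      have haij : C.a i j = 2 := by rw [hij]; exact C.a_diag i
      rw [haij] at hwt
      obtain ⟨N, hN⟩ := formB C i D y
      have hN1 : Y C (n + 1) i D (T C n * up C (n + 1) y * T C n) * E C n j =
          - ∑ s ∈ Finset.range (N + 1), (s + 1) • (up C n (Y C n i (D + 2 + s) y) * (X C n ^ s * E C n j)) := by
        have := hN (N + 1) (by omega)
        rw [hij]; exact this
      rw [hN1, neg_mul, Finset.sum_mul]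
      have hin : ∀ s : ℕ, wt C L i ν' + m < (D + 2 + s : ℕ) →
          (s + 1) • (up C n (Y C n i (D + 2 + s) y) * (X C n ^ s * E C n j)) * up C n (ee C ν') ∈ J C L (n + 1) := by
        intro s h
        rw [smul_mul_assoc, hterm]
        exact Submodule.smul_of_tower_mem _ _ (J_mul_right C _ (J_up C ((ih ν' m (D + 2 + s)).1 h)))
      constructor
      · intro h
        refine neg_mem (Submodule.sum_mem _ fun s _ => hin s ?_)
        push_cast; omega
      · intro h
        rw [Finset.sum_range_succ', neg_add, add_sub_assoc]
        refine add_mem (neg_mem (Submodule.sum_mem _ fun s _ => hin _ ?_)) ?_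
        · push_cast; omega
        · have h2 := (ih ν' m (D + 2)).2 (by push_cast; omega)
          have h3 := neg_mem (J_mul_right C (E C n j) (J_up C h2))
          have e : -((0 + 1) • (up C n (Y C n i (D + 2 + 0) y) * (X C n ^ 0 * E C n j)) * up C n (ee C ν')) -
              gam C i ν • ee C ν = -(up C n (Y C n i (D + 2) y * ee C ν' - gam C i ν' • ee C ν') * E C n j) := by
            rw [zero_add, one_smul, hterm, hgam, g1, if_pos hij, hee, map_sub, map_smul]
            simp only [add_zero, pow_zero, one_mul, mul_neg, mul_one, neg_smul, sub_mul, smul_mul_assoc]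
            abel
          rw [e]; exact h3
    · have hneg := C.a_nonpos i j (Ne.symm hij)
      set N := (-(C.a i j)).toNat with hNdef
      have hN : (N : ℤ) = -(C.a i j) := Int.toNat_of_nonneg (by omega)
      rw [formA C i j hij D hD y]
      have hmul : (∑ p ∈ Finset.range ((-(C.a j i)).toNat + 1), ∑ q ∈ Finset.range (N + 1),
          if C.d j * (p : ℤ) + C.d i * (q : ℤ) = -(C.d j * C.a j i) then
          C.t j i p q • (up C n (Y C n i (D - q) y) * (X C n ^ p * E C n j)) else 0) * up C n (ee C ν') =
          ∑ p ∈ Finset.range ((-(C.a j i)).toNat + 1), ∑ q ∈ Finset.range (N + 1),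
          if C.d j * (p : ℤ) + C.d i * (q : ℤ) = -(C.d j * C.a j i) then
          C.t j i p q • (up C n (Y C n i (D - q) y * ee C ν') * (X C n ^ p * E C n j)) else 0 := by
        rw [Finset.sum_mul]
        refine Finset.sum_congr rfl fun p _ => ?_
        rw [Finset.sum_mul]
        refine Finset.sum_congr rfl fun q _ => ?_
        split_ifs
        · rw [smul_mul_assoc, hterm]
        · simp
      rw [hmul]
      have hin : ∀ p q : ℕ, q ≤ D → wt C L i ν' + m < (D - q : ℤ) →
          (if C.d j * (p : ℤ) + C.d i * (q : ℤ) = -(C.d j * C.a j i) then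
          C.t j i p q • (up C n (Y C n i (D - q) y * ee C ν') * (X C n ^ p * E C n j)) else 0) ∈ J C L (n + 1) := by
        intro p q hq h
        split_ifs
        · exact Submodule.smul_mem _ _ (J_mul_right C _ (J_up C ((ih ν' m (D - q)).1 (by omega))))
        · exact zero_mem _
      constructor
      · intro h
        refine Submodule.sum_mem _ fun p _ => Submodule.sum_mem _ fun q hq => hin p q ?_ ?_
        · have := Finset.mem_range.1 hq; omega
        · have := Finset.mem_range.1 hq; omega
      · intro h
        have hsym := C.symmetrize i j
        have hdj := C.d_pos j
        rw [Finset.sum_eq_sum_sdiff_singleton_add (Finset.mem_range.2 (Nat.succ_pos _) : 0 ∈ Finset.range ((-(C.a j i)).toNat + 1)),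
          Finset.sum_range_succ, add_sub_assoc, add_sub_assoc]
        refine add_mem (Submodule.sum_mem _ fun p hp => Submodule.sum_mem _ fun q hq => ?_) (add_mem (Submodule.sum_mem _ fun q hq => hin _ q ?_ ?_) ?_)
        · have hq' := Finset.mem_range.1 hq
          by_cases hqN : q = N
          · rw [if_neg]
            · exact zero_mem _
            · rw [hqN, hN]
              have hp0 : (p : ℤ) ≠ 0 := by
                simp at hp; omega
              intro hc
              have : C.d j * (p : ℤ) = 0 := by linarith
              rcases mul_eq_zero.1 this with h | h
              · omega
              · exact hp0 h
          · exact hin p q (by omega) (by omega)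
        · have := Finset.mem_range.1 hq; omega
        · have := Finset.mem_range.1 hq; omega
        · rw [if_pos (by rw [hN]; push_cast; linarith)]
          have h2 := (ih ν' m (D - N)).2 (by omega)
          have h3 := Submodule.smul_mem _ (g1 C i j) (J_mul_right C (E C n j) (J_up C h2))
          have e : C.t j i 0 N • (up C n (Y C n i (D - N) y * ee C ν') * (X C n ^ 0 * E C n j)) -
              gam C i ν • ee C ν = g1 C i j • (up C n (Y C n i (D - N) y * ee C ν' - gam C i ν' • ee C ν') * E C n j) := by
            rw [hgam, g1, if_neg hij, hee, map_sub, map_smul, C.t_symm j i]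
            simp only [pow_zero, one_mul, sub_mul, smul_mul_assoc, smul_sub, smul_smul]
            rw [mul_comm]
          rw [e]; exact h3

end KLR


namespace KLR

set_option linter.unusedSectionVars false
set_option linter.unusedSimpArgs false
set_option autoImplicit false

open scoped TensorProduct

section OTlemmas

variable {k : Type} [Field k] {S B M : Type} [Ring S] [Algebra k S] [Ring B] [Algebra k B]
  [AddCommGroup M] [Module k M] [Module S M] [IsScalarTower k S M] (φ : S →ₙₐ[k] B)

variable (M) in
/-- The class of a pure tensor, as a bilinear map. -/
noncomputable def om : B →ₗ[k] M →ₗ[k] OT k S B M φ :=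
  (TensorProduct.mk k B M).compr₂ ((TRel k S B M φ).mkQ.restrictScalars k)

theorem om_apply (b : B) (m : M) : om M φ b m = OTmk k S B M φ (b ⊗ₜ[k] m) := rfl

theorem om_smul (b' b : B) (m : M) : b' • om M φ b m = om M φ (b' * b) m := by
  rw [om_apply, om_apply]
  unfold OTmk
  rw [← Submodule.Quotient.mk_smul, TensorProduct.smul_tmul', smul_eq_mul]

theorem om_bal (b : B) (r : S) (m : M) : om M φ (b * φ r) m = om M φ b (r • m) := by
  rw [om_apply, om_apply]
  unfold OTmk
  rw [Submodule.Quotient.eq]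
  exact Submodule.subset_span ⟨b, r, m, rfl⟩

theorem OT_ind {p : OT k S B M φ → Prop} (h : ∀ b m, p (om M φ b m)) (h0 : p 0)
    (hadd : ∀ x y, p x → p y → p (x + y)) (z : OT k S B M φ) : p z := by
  obtain ⟨w, rfl⟩ := Submodule.Quotient.mk_surjective _ z
  induction w using TensorProduct.induction_on with
  | zero => rw [Submodule.Quotient.mk_zero]; exact h0
  | tmul b m => exact h b m
  | add x y hx hy => rw [Submodule.Quotient.mk_add]; exact hadd _ _ hx hy

/-- Descending a balanced bilinear map. -/
noncomputable def omLift {V : Type} [AddCommGroup V] [Module k V] (g : B →ₗ[k] M →ₗ[k] V)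
    (hg : ∀ b r m, g (b * φ r) m = g b (r • m)) : OT k S B M φ →ₗ[k] V where
  toFun := Quotient.lift (TensorProduct.lift g) (by
    intro x y hxy
    have h1 : x - y ∈ TRel k S B M φ := (Submodule.quotientRel_def _).1 hxy
    have h2 : ∀ z ∈ TRel k S B M φ, TensorProduct.lift g z = 0 := by
      intro z hz
      unfold TRel at hz
      have h3 : ∀ b : B, TensorProduct.lift g (b • z) = 0 := by
        induction hz using Submodule.span_induction with
        | mem z hz =>
          obtain ⟨b, r, m, rfl⟩ := hz
          intro b'
          rw [smul_sub, TensorProduct.smul_tmul', TensorProduct.smul_tmul', map_sub,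
            TensorProduct.lift.tmul, TensorProduct.lift.tmul, smul_eq_mul, smul_eq_mul,
            ← mul_assoc, hg, sub_self]
        | zero => intro b; rw [smul_zero, map_zero]
        | add x y _ _ hx hy => intro b; rw [smul_add, map_add, hx, hy, add_zero]
        | smul c x _ hx => intro b; rw [← mul_smul]; exact hx _
      simpa using h3 1
    have h4 := h2 _ h1
    rw [map_sub, sub_eq_zero] at h4
    exact h4)
  map_add' x y := by
    obtain ⟨x, rfl⟩ := Submodule.Quotient.mk_surjective _ x
    obtain ⟨y, rfl⟩ := Submodule.Quotient.mk_surjective _ y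
    exact map_add (TensorProduct.lift g) x y
  map_smul' c x := by
    obtain ⟨x, rfl⟩ := Submodule.Quotient.mk_surjective _ x
    exact map_smul (TensorProduct.lift g) c x

theorem omLift_om {V : Type} [AddCommGroup V] [Module k V] (g : B →ₗ[k] M →ₗ[k] V)
    (hg : ∀ b r m, g (b * φ r) m = g b (r • m)) (b : B) (m : M) :
    omLift φ g hg (om M φ b m) = g b m :=
  TensorProduct.lift.tmul b m

theorem om_phi_one (b : B) (m : M) : om M φ (b * φ 1) m = om M φ b m := by
  rw [om_bal, one_smul]

end OTlemmas

variable {k : Type} [Field k] {I : Type} [Fintype I] [DecidableEq I] (C : CartanDatum k I)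

/-- The setting of the comparison between two consecutive cyclotomic quotients. -/
structure Ctx (L : I → ℕ) (N : ℕ) (i : I) (a : ℕ) (S B : Type) [Ring S] [Algebra k S]
    [Ring B] [Algebra k B] where
  pS : RA C N →ₐ[k] S
  pB : RA C (N + 1) →ₐ[k] B
  φ : S →ₙₐ[k] B
  pS_surj : Function.Surjective pS
  pB_surj : Function.Surjective pB
  hφ : ∀ r, φ (pS r) = pB (up C N r * E C N i)
  pS_J : ∀ y ∈ J C L N, pS y = 0
  pB_J : ∀ y ∈ J C L (N + 1), pB y = 0
  ker : ∀ (V : Type) [AddCommGroup V] [Module k V] (ψ : RA C (N + 1) →ₗ[k] V),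
    (∀ y ∈ J C L (N + 1), ψ y = 0) →
    (∀ y j ν, (j ≠ i ∨ pS (ee C ν) = 0) → ψ (y * (up C N (ee C ν) * E C N j)) = 0) →
    ∀ y, pB y = 0 → ψ y = 0
  u : Sˣ
  lead0 : ∀ m D, a + m < D → pS (Y C N i D (X C N ^ m * zz C L N)) = 0
  lead1 : ∀ m, pS (Y C N i (a + m) (X C N ^ m * zz C L N)) = u

/-- The data of the `τ`-component. -/
structure XDat {L : I → ℕ} {N : ℕ} {i : I} {a : ℕ} {S B : Type} [Ring S] [Algebra k S]
    [Ring B] [Algebra k B] (c : Ctx C L N i a S B) (M Xb : Type)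
    [AddCommGroup M] [Module k M] [Module S M] [IsScalarTower k S M]
    [AddCommGroup Xb] [Module k Xb] [Module S Xb] [IsScalarTower k S Xb] where
  psi : RA C (N + 1) →ₗ[k] M →ₗ[k] Xb
  gam : Xb →ₗ[k] OT k S B M c.φ
  upl : ∀ r y v, psi (up C N r * y) v = c.pS r • psi y v
  upr : ∀ r y v, psi (y * up C N r) v = psi y (c.pS r • v)
  El : ∀ j y v, psi (E C N j * y) v = if j = i then psi y v else 0
  Er : ∀ j y v, psi (y * E C N j) v = if j = i then psi y v else 0
  hpm : ∀ r m j, psi (pm C r m j) = 0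
  gam_smul : ∀ s ξ, gam (s • ξ) = c.φ s • gam ξ
  gam_tau : ∀ y, IsTau C N y → ∀ v,
    om M c.φ (c.pB (E C N i * y * E C N i)) v = gam (psi y v)
  span : ∀ p : Xb → Prop, (∀ y v, IsTau C N y → p (psi y v)) → p 0 →
    (∀ x y, p x → p y → p (x + y)) → ∀ ξ, p ξ

end KLR


namespace KLR

set_option linter.unusedSectionVars false
set_option linter.unusedSimpArgs false
set_option autoImplicit false

open scoped TensorProduct

variable {k : Type} [Field k] {I : Type} [Fintype I] [DecidableEq I] {C : CartanDatum k I}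
variable {L : I → ℕ} {N : ℕ} {i : I} {a : ℕ} {S B : Type} [Ring S] [Algebra k S]
    [Ring B] [Algebra k B] {c : Ctx C L N i a S B} {M Xb : Type}
    [AddCommGroup M] [Module k M] [Module S M] [IsScalarTower k S M]
    [AddCommGroup Xb] [Module k Xb] [Module S Xb] [IsScalarTower k S Xb] (x : XDat C c M Xb)

/-- All coordinates at once. -/
noncomputable def hat : RA C (N + 1) →ₗ[k] M →ₗ[k] (Xb × (ℕ → M)) :=
  LinearMap.mk₂ k (fun y v => (x.psi y v, fun d => c.pS (Y C N i d y) • v))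
    (by
      intro y y' v
      ext d
      · simp
      · simp [add_smul])
    (by
      intro r y v
      ext d
      · simp
      · simp [map_smul, smul_assoc])
    (by
      intro y v v'
      ext d
      · simp
      · simp [smul_add])
    (by
      intro r y v
      ext d
      · simp
      · simp only [Prod.smul_mk, Pi.smul_apply]
        rw [← algebraMap_smul S r v, ← mul_smul, ← Algebra.commutes, mul_smul,
          algebraMap_smul])

theorem hat_apply (y : RA C (N + 1)) (v : M) :
    hat x y v = (x.psi y v, fun d => c.pS (Y C N i d y) • v) := rfl

theorem hat_upl (r : RA C N) (y : RA C (N + 1)) (v : M) :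
    hat x (up C N r * y) v = c.pS r • hat x y v := by
  rw [hat_apply, hat_apply, x.upl, Prod.smul_mk]
  congr 1
  funext d
  rw [Y_up_left, map_mul, mul_smul]
  rfl

theorem hat_upr (r : RA C N) (y : RA C (N + 1)) (v : M) :
    hat x (y * up C N r) v = hat x y (c.pS r • v) := by
  rw [hat_apply, hat_apply, x.upr]
  congr 1
  funext d
  rw [Y_up_right, map_mul, mul_smul]

theorem hat_El (j : I) (y : RA C (N + 1)) (v : M) :
    hat x (E C N j * y) v = if j = i then hat x y v else 0 := by
  rw [hat_apply, hat_apply, x.El]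
  split_ifs with h
  · congr 1
    funext d
    rw [Y_E_left, if_pos h]
  · refine Prod.ext rfl ?_
    funext d
    show c.pS (Y C N i d (E C N j * y)) • v = 0
    rw [Y_E_left, if_neg h, map_zero, zero_smul]

theorem hat_Er (j : I) (y : RA C (N + 1)) (v : M) :
    hat x (y * E C N j) v = if j = i then hat x y v else 0 := by
  rw [hat_apply, hat_apply, x.Er]
  split_ifs with h
  · congr 1
    funext d
    rw [Y_E_right, if_pos h]
  · refine Prod.ext rfl ?_
    funext d
    show c.pS (Y C N i d (y * E C N j)) • v = 0
    rw [Y_E_right, if_neg h, map_zero, zero_smul]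

theorem hat_Ks {y : RA C (N + 1)} (hy : y ∈ Ks C L N) : hat x y = 0 := by
  refine Ks_induction C (p := fun y => hat x y = 0) ?_ ?_ ?_ ?_ ?_ hy
  · intro j r hj
    ext1 v
    rw [hat_upl, c.pS_J j hj, zero_smul]
    rfl
  · intro j r hj
    ext1 v
    rw [hat_upr, c.pS_J j hj, zero_smul, map_zero]
    rfl
  · exact map_zero _
  · intro y y' h h'
    rw [map_add, h, h', add_zero]
  · intro r y h
    rw [map_smul, h, smul_zero]

/-- The relations coming from the cyclotomic ideal. -/
noncomputable def Zm : (ℕ →₀ M) →ₗ[k] (Xb × (ℕ → M)) :=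
  Finsupp.lsum k (fun m => hat x (X C N ^ m * zz C L N))

theorem Zm_single (m : ℕ) (v : M) :
    Zm x (Finsupp.single m v) = hat x (X C N ^ m * zz C L N) v := by
  unfold Zm
  rw [Finsupp.lsum_single]

theorem X_pow_mem (m : ℕ) : X C N ^ m ∈ P C N := (P C N).pow_mem (X_mem_P C N) m

theorem hat_pm_zz (r : RA C N) (m : ℕ) (j : I) (v : M) :
    hat x (pm C r m j * zz C L N) v ∈ LinearMap.range (Zm x) := by
  have h1 : pm C r m j * zz C L N = E C N j * (up C N r * (X C N ^ m * zz C L N)) := by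
    unfold pm
    rw [((cXE C j).pow_left m).eq, ← mul_assoc, ← (cEu C j r).eq]
    simp only [mul_assoc]
  rw [h1, hat_El]
  split_ifs with h
  · have h2 : up C N r * (X C N ^ m * zz C L N) - X C N ^ m * zz C L N * up C N r ∈ Ks C L N := by
      have h3 := P_Ks C (X_pow_mem (C := C) m) (P_zz C (L := L) N _ (up_mem_P C r))
      rw [mul_sub, ← mul_assoc, ((cXu C r).pow_left m).eq] at h3
      rw [← mul_assoc, mul_assoc (X C N ^ m)]
      exact h3
    have h4 := hat_Ks x h2
    rw [map_sub, sub_eq_zero] at h4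
    rw [h4, hat_upr, ← Zm_single]
    exact ⟨_, rfl⟩
  · exact Submodule.zero_mem _

theorem hat_J {y : RA C (N + 1)} (hy : y ∈ J C L (N + 1)) (v : M) :
    hat x y v ∈ LinearMap.range (Zm x) := by
  obtain ⟨p, hp, hk⟩ := (mem_Zs C).1 (J_le_Zs C N y hy)
  have h4 := hat_Ks x hk
  rw [map_sub, sub_eq_zero] at h4
  rw [h4]
  refine P_induction C (p := fun p => hat x (p * zz C L N) v ∈ LinearMap.range (Zm x))
    ?_ ?_ ?_ ?_ hp
  · intro r m j
    exact hat_pm_zz x r m j v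
  · rw [zero_mul, map_zero]; exact Submodule.zero_mem _
  · intro p q hp hq
    rw [add_mul, map_add]
    exact Submodule.add_mem _ hp hq
  · intro r p hp
    rw [smul_mul_assoc, map_smul]
    exact Submodule.smul_mem _ _ hp

/-- The quotient receiving the comparison map. -/
abbrev QQ : Type := (Xb × (ℕ → M)) ⧸ LinearMap.range (Zm x)

/-- `hat` modulo the relations. -/
noncomputable def hatQ : RA C (N + 1) →ₗ[k] M →ₗ[k] QQ x :=
  (hat x).compr₂ (LinearMap.range (Zm x)).mkQ

theorem hatQ_apply (y : RA C (N + 1)) (v : M) :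
    hatQ x y v = (LinearMap.range (Zm x)).mkQ (hat x y v) := rfl

theorem hatQ_ker : LinearMap.ker c.pB.toLinearMap ≤ LinearMap.ker (hatQ x) := by
  intro y hy
  refine c.ker _ (hatQ x) ?_ ?_ y hy
  · intro y hy
    ext1 v
    rw [hatQ_apply]
    exact (Submodule.Quotient.mk_eq_zero _).2 (hat_J x hy v)
  · intro y j ν h
    ext1 v
    rw [hatQ_apply, ← mul_assoc, hat_Er]
    split_ifs with hj
    · have h2 : c.pS (ee C ν) = 0 := by
        rcases h with h | h
        · exact absurd hj h
        · exact h
      rw [hat_upr, h2, zero_smul, map_zero, map_zero]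
      rfl
    · rw [map_zero]
      rfl

/-- `hatQ` on the quotient algebra. -/
noncomputable def hatB : B →ₗ[k] M →ₗ[k] QQ x :=
  ((LinearMap.ker c.pB.toLinearMap).liftQ (hatQ x) (hatQ_ker x)).comp
    (c.pB.toLinearMap.quotKerEquivOfSurjective c.pB_surj).symm.toLinearMap

theorem hatB_apply (y : RA C (N + 1)) : hatB x (c.pB y) = hatQ x y := by
  unfold hatB
  rw [LinearMap.comp_apply]
  have h : (c.pB.toLinearMap.quotKerEquivOfSurjective c.pB_surj).symm (c.pB y)
      = Submodule.Quotient.mk y := by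
    rw [LinearEquiv.symm_apply_eq]
    rfl
  erw [h]
  exact Submodule.liftQ_apply _ _ _

/-- The comparison map out of the balanced tensor product. -/
noncomputable def Om : OT k S B M c.φ →ₗ[k] QQ x :=
  omLift c.φ (hatB x) (by
    intro b r m
    obtain ⟨y, rfl⟩ := c.pB_surj b
    obtain ⟨r, rfl⟩ := c.pS_surj r
    rw [c.hφ, ← map_mul, hatB_apply, hatB_apply, hatQ_apply, hatQ_apply, ← mul_assoc, hat_Er,
      if_pos rfl, hat_upr])

theorem Om_om (y : RA C (N + 1)) (v : M) :
    Om x (om M c.φ (c.pB y) v) = (LinearMap.range (Zm x)).mkQ (hat x y v) := by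
  unfold Om
  rw [omLift_om, hatB_apply, hatQ_apply]

/-- The decomposition map. -/
noncomputable def GG : (Xb × (Fin a → M)) →ₗ[k] OT k S B M c.φ :=
  x.gam.comp (LinearMap.fst k Xb (Fin a → M)) +
    (∑ q : Fin a, (om M c.φ (c.pB (X C N ^ (q : ℕ) * E C N i))).comp (LinearMap.proj q)).comp
      (LinearMap.snd k Xb (Fin a → M))

theorem GG_apply (ξ : Xb) (m : Fin a → M) :
    GG x (ξ, m) = x.gam ξ + ∑ q : Fin a, om M c.φ (c.pB (X C N ^ (q : ℕ) * E C N i)) (m q) := by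
  simp [GG]

theorem hat_XE (d : ℕ) (v : M) : hat x (X C N ^ d * E C N i) v = (0, Pi.single d v) := by
  have h : X C N ^ d * E C N i = pm C 1 d i := by
    unfold pm
    rw [map_one, one_mul]
  rw [h, hat_apply, x.hpm]
  refine Prod.ext rfl ?_
  funext d'
  show c.pS (Y C N i d' (pm C 1 d i)) • v = _
  rw [Y_pm]
  by_cases hd : d = d'
  · subst hd
    rw [if_pos ⟨rfl, rfl⟩, map_one, one_smul]
    exact (Pi.single_eq_same (M := fun _ => M) d v).symm
  · rw [if_neg (fun h => hd h.1), map_zero, zero_smul]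
    exact (Pi.single_eq_of_ne (M := fun _ => M) (Ne.symm hd) v).symm

theorem Om_gam (ξ : Xb) : Om x (x.gam ξ) = (LinearMap.range (Zm x)).mkQ (ξ, 0) := by
  refine x.span (fun ξ => Om x (x.gam ξ) = (LinearMap.range (Zm x)).mkQ (ξ, 0)) ?_ ?_ ?_ ξ
  · intro y v hy
    rw [← x.gam_tau y hy, Om_om, hat_Er, if_pos rfl, hat_El, if_pos rfl, hat_apply]
    congr 2
    funext d
    rw [Y_tau C i d hy, map_zero, zero_smul]
    rfl
  · rw [map_zero, map_zero]
    exact (map_zero _).symm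
  · intro ξ η h h'
    rw [map_add, map_add, h, h', ← map_add]
    congr 1
    rw [Prod.mk_add_mk, add_zero]

theorem Om_GG (ξ : Xb) (m : Fin a → M) :
    Om x (GG x (ξ, m)) = (LinearMap.range (Zm x)).mkQ
      (ξ, ∑ q : Fin a, (Pi.single (q : ℕ) (m q) : ℕ → M)) := by
  rw [GG_apply, map_add, Om_gam, map_sum]
  have h : ∀ q : Fin a, Om x (om M c.φ (c.pB (X C N ^ (q : ℕ) * E C N i)) (m q))
      = (LinearMap.range (Zm x)).mkQ (0, Pi.single (q : ℕ) (m q)) := by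
    intro q
    rw [Om_om, hat_XE]
  simp only [h]
  rw [← map_sum, ← map_add]
  congr 1
  refine Prod.ext ?_ ?_
  · simp [Prod.fst_sum]
  · simp [Prod.snd_sum]

theorem sum_single_apply (m : Fin a → M) (d : ℕ) :
    (∑ q : Fin a, (Pi.single (q : ℕ) (m q) : ℕ → M)) d = if h : d < a then m ⟨d, h⟩ else 0 := by
  rw [Finset.sum_apply]
  split_ifs with h
  · rw [Finset.sum_eq_single ⟨d, h⟩]
    · exact Pi.single_eq_same _ _
    · intro q _ hq
      refine Pi.single_eq_of_ne ?_ _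
      intro h'
      exact hq (Fin.ext h'.symm)
    · intro h'
      exact absurd (Finset.mem_univ _) h'
  · refine Finset.sum_eq_zero ?_
    intro q _
    refine Pi.single_eq_of_ne ?_ _
    intro h'
    exact h (h' ▸ q.2)

theorem Zm_top (f : ℕ →₀ M) (m : ℕ) (hm : ∀ m' ∈ f.support, m' ≤ m) :
    (Zm x f).2 (a + m) = (c.u : S) • f m := by
  have h1 : Zm x f = f.sum (fun m' v => hat x (X C N ^ m' * zz C L N) v) := by
    unfold Zm
    rw [Finsupp.lsum_apply]
  rw [h1, Finsupp.sum, Prod.snd_sum, Finset.sum_apply, Finset.sum_eq_single m]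
  · rw [hat_apply]
    show c.pS (Y C N i (a + m) _) • f m = _
    rw [c.lead1]
  · intro m' hm' hne
    rw [hat_apply]
    show c.pS (Y C N i (a + m) _) • f m' = _
    rw [c.lead0, zero_smul]
    have := hm m' hm'
    omega
  · intro h
    rw [Finsupp.notMem_support_iff.1 h, map_zero]
    rfl

theorem GG_inj : Function.Injective (GG x) := by
  rw [injective_iff_map_eq_zero]
  rintro ⟨ξ, m⟩ h
  have h1 := Om_GG x ξ m
  rw [h, map_zero] at h1
  have h2 := (Submodule.Quotient.mk_eq_zero _).1 h1.symm
  obtain ⟨f, hf⟩ := h2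
  have hf0 : f = 0 := by
    by_contra hne
    have hs : f.support.Nonempty := Finsupp.support_nonempty_iff.2 hne
    have h3 := Zm_top x f (f.support.max' hs) (fun m' hm' => Finset.le_max' _ _ hm')
    rw [hf] at h3
    change (∑ q : Fin a, (Pi.single (q : ℕ) (m q) : ℕ → M)) _ = _ at h3
    rw [sum_single_apply, dif_neg (by omega)] at h3
    have h4 : f (f.support.max' hs) = 0 := by
      have h5 := congrArg (fun w => (↑(c.u⁻¹) : S) • w) h3
      simp only [smul_zero, ← mul_smul, Units.inv_mul, one_smul] at h5
      exact h5.symm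
    exact (Finsupp.mem_support_iff.1 (Finset.max'_mem _ hs)) h4
  rw [hf0, map_zero] at hf
  refine Prod.ext ?_ ?_
  · exact (congrArg Prod.fst hf).symm
  · funext q
    have h6 := congrFun (congrArg Prod.snd hf) (q : ℕ)
    change _ = (∑ q : Fin a, (Pi.single (q : ℕ) (m q) : ℕ → M)) _ at h6
    rw [sum_single_apply, dif_pos q.2] at h6
    exact h6.symm

theorem phi_one (c : Ctx C L N i a S B) : c.φ 1 = c.pB (E C N i) := by
  rw [← map_one c.pS, c.hφ, map_one, one_mul]

theorem om_E (y : RA C (N + 1)) (v : M) :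
    om M c.φ (c.pB (y * E C N i)) v = om M c.φ (c.pB y) v := by
  rw [map_mul, ← phi_one, om_phi_one]

theorem om_up (y : RA C (N + 1)) (r : RA C N) (v : M) :
    om M c.φ (c.pB (y * up C N r * E C N i)) v = om M c.φ (c.pB y) (c.pS r • v) := by
  rw [mul_assoc, map_mul, ← c.hφ, om_bal]

theorem om_decomp (y : RA C (N + 1)) (v : M) : ∃ N0, ∀ n ≥ N0,
    om M c.φ (c.pB (E C N i * y)) v = x.gam (x.psi y v) +
      ∑ D ∈ Finset.range n, om M c.φ (c.pB (X C N ^ D * E C N i)) (c.pS (Y C N i D y) • v) := by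
  refine R_ind C (p := fun y => ∃ N0, ∀ n ≥ N0,
    om M c.φ (c.pB (E C N i * y)) v = x.gam (x.psi y v) +
      ∑ D ∈ Finset.range n, om M c.φ (c.pB (X C N ^ D * E C N i)) (c.pS (Y C N i D y) • v))
    ?_ ?_ ?_ ?_ ?_ y
  · intro r m j
    refine ⟨m + 1, fun n hn => ?_⟩
    rw [x.hpm, LinearMap.zero_apply, map_zero, zero_add, E_pm]
    simp only [Y_pm]
    by_cases hj : j = i
    · subst hj
      rw [if_pos rfl, Finset.sum_eq_single m]
      · rw [if_pos ⟨rfl, rfl⟩]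
        rw [← om_up]
        congr 3
        unfold pm
        have hE : E C N j * E C N j = E C N j := by rw [E_E, if_pos rfl]
        calc up C N r * (X C N ^ m * E C N j) = (up C N r * X C N ^ m) * (E C N j * E C N j) := by
              rw [hE, mul_assoc]
          _ = X C N ^ m * (up C N r * E C N j) * E C N j := by
              rw [← ((cXu C r).pow_left m).eq]
              simp only [mul_assoc]
          _ = _ := by
              rw [← (cEu C j r).eq]
              simp only [mul_assoc]
      · intro D _ hD
        rw [if_neg (fun h => hD h.1.symm), map_zero, zero_smul, map_zero]
      · intro h
        exact absurd (Finset.mem_range.2 (by omega)) h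
    · rw [if_neg hj, map_zero, map_zero, LinearMap.zero_apply, Finset.sum_eq_zero]
      intro D _
      rw [if_neg (fun h => hj h.2), map_zero, zero_smul, map_zero]
  · intro y hy
    refine ⟨0, fun n _ => ?_⟩
    rw [← om_E, x.gam_tau y hy, Finset.sum_eq_zero, add_zero]
    intro D _
    rw [Y_tau C i D hy, map_zero, zero_smul, map_zero]
  · refine ⟨0, fun n _ => ?_⟩
    simp
  · rintro y y' ⟨n1, h1⟩ ⟨n2, h2⟩
    refine ⟨max n1 n2, fun n hn => ?_⟩
    rw [mul_add, map_add, map_add, LinearMap.add_apply, h1 n (le_trans (le_max_left _ _) hn),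
      h2 n (le_trans (le_max_right _ _) hn)]
    simp only [map_add, LinearMap.add_apply, add_smul, Finset.sum_add_distrib]
    abel
  · rintro r y ⟨n1, h1⟩
    refine ⟨n1, fun n hn => ?_⟩
    rw [mul_smul_comm, map_smul, map_smul, LinearMap.smul_apply, h1 n hn]
    simp only [map_smul, LinearMap.smul_apply, smul_assoc, smul_add, Finset.smul_sum]

theorem om_X_mem (D : ℕ) : ∀ v : M,
    om M c.φ (c.pB (X C N ^ D * E C N i)) v ∈ LinearMap.range (GG x) := by
  induction D using Nat.strong_induction_on with
  | _ D ih =>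
    intro v
    by_cases hD : D < a
    · refine ⟨(0, Pi.single ⟨D, hD⟩ v), ?_⟩
      rw [GG_apply, map_zero, zero_add, Finset.sum_eq_single ⟨D, hD⟩]
      · rw [Pi.single_eq_same]
      · intro q _ hq
        rw [Pi.single_eq_of_ne hq, map_zero]
      · intro h
        exact absurd (Finset.mem_univ _) h
    · obtain ⟨m, rfl⟩ := Nat.exists_eq_add_of_le (not_lt.1 hD)
      set w : M := (↑(c.u⁻¹) : S) • v with hw
      obtain ⟨n0, hn⟩ := om_decomp x (X C N ^ m * zz C L N) w
      have h1 := hn (max n0 (a + m + 1)) (le_max_left _ _)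
      have h2 : c.pB (E C N i * (X C N ^ m * zz C L N)) = 0 := by
        apply c.pB_J
        exact J_mul_left C _ (J_mul_left C _ (zz_mem C N))
      rw [h2, map_zero, LinearMap.zero_apply] at h1
      have h3 : ∑ D ∈ Finset.range (max n0 (a + m + 1)),
          om M c.φ (c.pB (X C N ^ D * E C N i)) (c.pS (Y C N i D (X C N ^ m * zz C L N)) • w)
          = ∑ D ∈ Finset.range (a + m + 1),
          om M c.φ (c.pB (X C N ^ D * E C N i))
            (c.pS (Y C N i D (X C N ^ m * zz C L N)) • w) := by
        symm
        apply Finset.sum_subset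
        · intro D hD
          rw [Finset.mem_range] at hD ⊢
          exact lt_of_lt_of_le hD (le_max_right _ _)
        · intro D _ hD
          rw [Finset.mem_range] at hD
          rw [c.lead0 m D (by omega), zero_smul, map_zero]
      rw [h3, Finset.sum_range_succ, c.lead1, hw, ← mul_smul, Units.mul_inv, one_smul,
        ← add_assoc] at h1
      have h4 := eq_neg_of_add_eq_zero_right h1.symm
      rw [h4]
      refine Submodule.neg_mem _ (Submodule.add_mem _ ?_ (Submodule.sum_mem _ ?_))
      · refine ⟨(x.psi (X C N ^ m * zz C L N) w, 0), ?_⟩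
        rw [GG_apply]
        simp [hw]
      · intro D hD
        exact ih D (Finset.mem_range.1 hD) _

theorem E_om_mem (z : OT k S B M c.φ) : c.pB (E C N i) • z ∈ LinearMap.range (GG x) := by
  refine OT_ind c.φ (p := fun z => c.pB (E C N i) • z ∈ LinearMap.range (GG x)) ?_ ?_ ?_ z
  · intro b v
    obtain ⟨y, rfl⟩ := c.pB_surj b
    rw [om_smul, ← map_mul]
    obtain ⟨n0, hn⟩ := om_decomp x y v
    rw [hn n0 le_rfl]
    refine Submodule.add_mem _ ?_ (Submodule.sum_mem _ ?_)
    · refine ⟨(x.psi y v, 0), ?_⟩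
      rw [GG_apply]
      simp
    · intro D _
      exact om_X_mem x D _
  · rw [smul_zero]; exact Submodule.zero_mem _
  · intro z z' h h'
    rw [smul_add]
    exact Submodule.add_mem _ h h'

theorem GG_smul (s : S) (w : Xb × (Fin a → M)) : GG x (s • w) = c.φ s • GG x w := by
  obtain ⟨ξ, m⟩ := w
  obtain ⟨r, rfl⟩ := c.pS_surj s
  rw [Prod.smul_mk, GG_apply, GG_apply, smul_add, x.gam_smul, Finset.smul_sum]
  congr 1
  refine Finset.sum_congr rfl ?_
  intro q _
  rw [om_smul, Pi.smul_apply, ← om_up, c.hφ, ← map_mul]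
  congr 2
  rw [mul_assoc, mul_assoc, ← (cEu C i r).eq]
  have h : X C N ^ (q : ℕ) * (E C N i * (E C N i * up C N r))
      = E C N i * up C N r * (X C N ^ (q : ℕ) * E C N i) := by
    rw [← mul_assoc (E C N i) (E C N i), E_E, if_pos rfl, (cEu C i r).eq, ← mul_assoc,
      ((cXu C r).pow_left _).eq, (cXE C i).pow_left _ |>.eq]
    have hE : E C N i * E C N i = E C N i := by rw [E_E, if_pos rfl]
    rw [mul_assoc, mul_assoc, ← mul_assoc (E C N i) (E C N i), hE, (cXE C i).pow_left _ |>.eq]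
  exact congrArg _ h

theorem GG_mem (w : Xb × (Fin a → M)) :
    GG x w ∈ eSub k B (OT k S B M c.φ) (c.pB (E C N i)) := by
  refine ⟨GG x w, ?_⟩
  show c.pB (E C N i) • GG x w = GG x w
  rw [← phi_one, ← GG_smul, one_smul]

/-- The decomposition isomorphism. -/
noncomputable def PhiE (e : B) (he : e = c.pB (E C N i)) (d : EData k (OT k S B M c.φ) e c.φ) :
    letI := d.inst
    ↥(eSub k B (OT k S B M c.φ) e) ≃ₗ[S] (Xb × (Fin a → M)) :=
  letI := d.inst
  (LinearEquiv.ofBijective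
    ({ toFun := fun w => ⟨GG x w, he ▸ GG_mem x w⟩
       map_add' := fun w w' => Subtype.ext (map_add (GG x) w w')
       map_smul' := fun s w => Subtype.ext
         ((GG_smul x s w).trans (d.compat s ⟨GG x w, he ▸ GG_mem x w⟩).symm) } :
      (Xb × (Fin a → M)) →ₗ[S] ↥(eSub k B (OT k S B M c.φ) e))
    ⟨fun w w' h => GG_inj x (congrArg Subtype.val h), by
      rintro ⟨z, z', hz⟩
      obtain ⟨w, hw⟩ := E_om_mem x z'
      refine ⟨w, Subtype.ext ?_⟩
      subst he
      exact hw.trans hz⟩).symm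

theorem PhiE_symm (e : B) (he : e = c.pB (E C N i)) (d : EData k (OT k S B M c.φ) e c.φ)
    (w : Xb × (Fin a → M)) :
    (letI := d.inst; ((PhiE x e he d).symm w : OT k S B M c.φ)) = GG x w := rfl

end KLR


namespace KLR

set_option linter.unusedSectionVars false
set_option linter.unusedSimpArgs false
set_option autoImplicit false
set_option linter.unusedVariables false

open scoped TensorProduct

variable {k : Type} [Field k] {I : Type} [Fintype I] [DecidableEq I] {C : CartanDatum k I}
variable {L : I → ℕ} {i : I} {a : ℕ} {S B : Type} [Ring S] [Algebra k S]
    [Ring B] [Algebra k B]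

/-- Height zero: there is no `τ`-component. -/
noncomputable def xdat0 (c : Ctx C L 0 i a S B) (M : Type)
    [AddCommGroup M] [Module k M] [Module S M] [IsScalarTower k S M] : XDat C c M PUnit where
  psi := 0
  gam := 0
  upl := by intros; rfl
  upr := by intros; rfl
  El := by intros; exact Subsingleton.elim _ _
  Er := by intros; exact Subsingleton.elim _ _
  hpm := by intros; rfl
  gam_smul := by intros; simp
  gam_tau := by intro y hy; exact hy.elim
  span := by
    intro p _ h0 _ ξ
    exact (Subsingleton.elim (0 : PUnit) ξ) ▸ h0

section pos

variable {n : ℕ} (c : Ctx C L (n + 1) i a S B) {T' : Type} [Ring T'] [Algebra k T']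
  (φd : T' →ₙₐ[k] S) (pT : RA C n →ₐ[k] T') (M : Type)
  [AddCommGroup M] [Module k M] [Module S M] [IsScalarTower k S M]
  (e : S) [Module T' ↥(eSub k S M e)] [IsScalarTower k T' ↥(eSub k S M e)]

/-- Projection onto the idempotent truncation. -/
noncomputable def epr : M →ₗ[k] ↥(eSub k S M e) := (eMap k S M e).rangeRestrict

theorem epr_val (v : M) : ((epr (k := k) M e v : ↥(eSub k S M e)) : M) = e • v := rfl

/-- Building block of `psi`. -/
noncomputable def pc (s : RA C (n + 1)) :
    RA C (n + 1) →ₗ[k] M →ₗ[k] OT k T' S ↥(eSub k S M e) φd :=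
  ((om ↥(eSub k S M e) φd).comp c.pS.toLinearMap).compl₂
    ((epr (k := k) M e).comp (eMap k S M (c.pS s)))

theorem pc_apply (s r : RA C (n + 1)) (v : M) :
    pc c φd M e s r v = om _ φd (c.pS r) (epr (k := k) M e (c.pS s • v)) := rfl

/-- Component at an index. -/
noncomputable def pcI : Idx I (n + 1) →
    (RA C (n + 1) →ₗ[k] M →ₗ[k] OT k T' S ↥(eSub k S M e) φd)
  | Sum.inl _ => 0
  | Sum.inr α => pc c φd M e (bb C n α)

/-- The `τ`-component. -/
noncomputable def psiX : RA C (n + 2) →ₗ[k] M →ₗ[k] OT k T' S ↥(eSub k S M e) φd :=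
  (Finsupp.lsum k (pcI c φd M e)).comp (ThetaE C (n + 1)).symm.toLinearMap

theorem psiX_bb (α : Idx I (n + 1)) (r : RA C (n + 1)) :
    psiX c φd M e (up C (n + 1) r * bb C (n + 1) α) = pcI c φd M e α r := by
  unfold psiX
  rw [LinearMap.comp_apply, LinearEquiv.coe_coe, ThetaE_symm_bb, Finsupp.lsum_single]

theorem psiX_pm (r : RA C (n + 1)) (m : ℕ) (j : I) : psiX c φd M e (pm C r m j) = 0 := by
  have h := psiX_bb c φd M e (topI (n + 1) m j) r
  rw [bb_topI] at h
  exact h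

theorem e_mul (hT : ∀ r, φd (pT r) = c.pS (up C n r * E C n i)) :
    φd 1 = c.pS (E C n i) := by
  rw [← map_one pT, hT, map_one, one_mul]

theorem psiX_tau (he : e = c.pS (E C n i)) (hT : ∀ r, φd (pT r) = c.pS (up C n r * E C n i))
    (hc : ∀ (r : T') (y : ↥(eSub k S M e)), ((r • y : ↥(eSub k S M e)) : M) = φd r • (y : M))
    (r s : RA C (n + 1)) (v : M) :
    psiX c φd M e (up C (n + 1) r * T C n * up C (n + 1) s) v
      = om _ φd (c.pS r) (epr (k := k) M e (c.pS s • v)) := by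
  obtain ⟨f, rfl⟩ := (ThetaE C n).surjective s
  rw [ThetaE_apply]
  induction f using Finsupp.induction_linear with
  | zero => simp
  | add f g hf hg => simp only [map_add, mul_add, add_smul, LinearMap.add_apply, hf, hg]
  | single α b =>
    have h0 : up C (n + 1) r * T C n * up C (n + 1) (up C n b * bb C n α)
        = up C (n + 1) (r * up C n b) * (T C n * up C (n + 1) (bb C n α)) := by
      rw [map_mul, mul_assoc, ← mul_assoc (T C n), T_upup, mul_assoc, ← mul_assoc, ← map_mul]
    rw [Theta_single, h0]
    have h1 := psiX_bb c φd M e (tauI α) (r * up C n b)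
    rw [bb_tauI] at h1
    rw [h1]
    change pc c φd M e (bb C n α) (r * up C n b) v = _
    rw [pc_apply, ← om_phi_one, e_mul c φd pT hT, ← map_mul, mul_assoc, map_mul, ← hT, om_bal]
    congr 1
    apply Subtype.ext
    rw [hc, epr_val, epr_val, hT, he, ← mul_smul, ← map_mul, ← mul_smul, ← mul_smul, ← map_mul,
      ← map_mul]
    congr 2
    have hE : E C n i * E C n i = E C n i := by rw [E_E, if_pos rfl]
    rw [mul_assoc (up C n b), hE, ← mul_assoc, (cEu C i b).eq]

theorem eTe (i : I) : E C (n + 1) i * (T C n * E C (n + 1) i)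
    = T C n * (up C (n + 1) (E C n i) * E C (n + 1) i) := by
  rw [← mul_assoc, ← T_E', mul_assoc]

theorem gam_aux (i : I) (s : RA C (n + 1)) (t : RA C n) :
    up C (n + 1) (s * (up C n t * E C n i)) * E C (n + 1) i * (T C n * E C (n + 1) i)
      = up C (n + 1) s * E C (n + 1) i * (T C n * E C (n + 1) i)
        * up C (n + 1) (up C n t * E C n i) * E C (n + 1) i := by
  set A := T C n * (up C (n + 1) (E C n i) * E C (n + 1) i) with hA
  have hE : E C n i * E C n i = E C n i := by rw [E_E, if_pos rfl]
  have hE' : E C (n + 1) i * E C (n + 1) i = E C (n + 1) i := by rw [E_E, if_pos rfl]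
  have hc1 := cEu C (n := n + 1) i (E C n i)
  have h1 : up C (n + 1) (E C n i) * A = A := by
    rw [hA, ← mul_assoc, ← T_E, mul_assoc, ← mul_assoc (E C (n + 1) i), hc1.eq, mul_assoc, hE']
  have hεe : up C (n + 1) (E C n i) * E C (n + 1) i * (up C (n + 1) (E C n i) * E C (n + 1) i)
      = up C (n + 1) (E C n i) * E C (n + 1) i := by
    rw [mul_assoc, ← mul_assoc (E C (n + 1) i), hc1.eq, mul_assoc, hE', ← mul_assoc, ← map_mul, hE]
  have h2 : A * (up C (n + 1) (E C n i) * E C (n + 1) i) = A := by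
    rw [hA, mul_assoc, hεe]
  have h3 : Commute A (up C (n + 1) (up C n t)) := by
    have c1 : Commute (T C n) (up C (n + 1) (up C n t)) := T_upup C t
    have c2 : Commute (up C (n + 1) (E C n i)) (up C (n + 1) (up C n t)) :=
      (cEu C i t).map (up C (n + 1))
    exact c1.mul_left (c2.mul_left (cEu C i _))
  rw [mul_assoc, eTe, ← hA, mul_assoc (up C (n + 1) s), eTe, ← hA, map_mul, map_mul]
  calc _ = up C (n + 1) s * (up C (n + 1) (up C n t) * (up C (n + 1) (E C n i) * A)) := by
        simp only [mul_assoc]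
    _ = up C (n + 1) s * ((A * up C (n + 1) (up C n t))) := by rw [h1, h3.eq]
    _ = up C (n + 1) s * (up C (n + 1) (up C n t) *
        (A * (up C (n + 1) (E C n i) * E C (n + 1) i))) := by rw [h2, h3.eq]
    _ = up C (n + 1) s * ((up C (n + 1) (up C n t) *
        A) * (up C (n + 1) (E C n i) * E C (n + 1) i)) := by simp only [mul_assoc]
    _ = _ := by
        rw [← h3.eq]
        simp only [mul_assoc]

/-- The kernel data for the inverse map. -/
noncomputable def gamX (he : e = c.pS (E C n i))
    (hT : ∀ r, φd (pT r) = c.pS (up C n r * E C n i)) (hTs : Function.Surjective pT)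
    (hc : ∀ (r : T') (y : ↥(eSub k S M e)), ((r • y : ↥(eSub k S M e)) : M) = φd r • (y : M)) :
    OT k T' S ↥(eSub k S M e) φd →ₗ[k] OT k S B M c.φ :=
  omLift φd
    (LinearMap.mk₂ k (fun s y => om M c.φ (c.φ s * c.pB (T C n * E C (n + 1) i)) (y : M))
      (by intro s s' y; simp [add_mul])
      (by intro r s y; simp [smul_mul_assoc])
      (by intro s y y'; simp)
      (by intro r s y; simp))
    (by
      intro s t y
      obtain ⟨t, rfl⟩ := hTs t
      obtain ⟨s, rfl⟩ := c.pS_surj s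
      simp only [LinearMap.mk₂_apply]
      rw [hc, hT, ← map_mul, c.hφ, c.hφ, ← map_mul, ← map_mul, ← om_up]
      congr 3
      exact gam_aux i s t)

theorem gamX_om (he : e = c.pS (E C n i))
    (hT : ∀ r, φd (pT r) = c.pS (up C n r * E C n i)) (hTs : Function.Surjective pT)
    (hc : ∀ (r : T') (y : ↥(eSub k S M e)), ((r • y : ↥(eSub k S M e)) : M) = φd r • (y : M))
    (s : S) (y : ↥(eSub k S M e)) :
    gamX c φd pT M e he hT hTs hc (om _ φd s y)
      = om M c.φ (c.φ s * c.pB (T C n * E C (n + 1) i)) (y : M) := by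
  unfold gamX
  rw [omLift_om]
  rfl

/-- Positive height: the `τ`-component. -/
noncomputable def xdat (he : e = c.pS (E C n i))
    (hT : ∀ r, φd (pT r) = c.pS (up C n r * E C n i)) (hTs : Function.Surjective pT)
    (hc : ∀ (r : T') (y : ↥(eSub k S M e)), ((r • y : ↥(eSub k S M e)) : M) = φd r • (y : M)) :
    XDat C c M (OT k T' S ↥(eSub k S M e) φd) where
  psi := psiX c φd M e
  gam := gamX c φd pT M e he hT hTs hc
  hpm := psiX_pm c φd M e
  upl := by
    intro r y v
    refine R_ind C (p := fun y => psiX c φd M e (up C (n + 1) r * y) v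
      = c.pS r • psiX c φd M e y v) ?_ ?_ ?_ ?_ ?_ y
    · intro s m j
      have : up C (n + 1) r * pm C s m j = pm C (r * s) m j := by
        rw [pm, pm, map_mul, mul_assoc]
      rw [this, psiX_pm, psiX_pm]
      simp
    · rintro y ⟨r', s, rfl⟩
      rw [← mul_assoc, ← mul_assoc, ← map_mul, psiX_tau c φd pT M e he hT hc,
        psiX_tau c φd pT M e he hT hc, om_smul, map_mul]
    · simp
    · intro y y' h h'
      rw [mul_add, map_add, map_add, LinearMap.add_apply, LinearMap.add_apply, h, h', smul_add]
    · intro q y h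
      rw [mul_smul_comm, map_smul, map_smul, LinearMap.smul_apply, LinearMap.smul_apply, h,
        smul_comm]
  upr := by
    intro r y v
    refine R_ind C (p := fun y => psiX c φd M e (y * up C (n + 1) r) v
      = psiX c φd M e y (c.pS r • v)) ?_ ?_ ?_ ?_ ?_ y
    · intro s m j
      rw [pm_up, psiX_pm, psiX_pm]
      simp
    · rintro y ⟨r', s, rfl⟩
      rw [mul_assoc, ← map_mul, psiX_tau c φd pT M e he hT hc,
        psiX_tau c φd pT M e he hT hc, map_mul, mul_smul]
    · simp
    · intro y y' h h'
      rw [add_mul, map_add, map_add, LinearMap.add_apply, LinearMap.add_apply, h, h']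
    · intro q y h
      rw [smul_mul_assoc, (psiX c φd M e).map_smul, (psiX c φd M e).map_smul,
        LinearMap.smul_apply, LinearMap.smul_apply, h]
  El := by
    intro j y v
    refine R_ind C (p := fun y => psiX c φd M e (E C (n + 1) j * y) v
      = if j = i then psiX c φd M e y v else 0) ?_ ?_ ?_ ?_ ?_ y
    · intro s m j'
      rw [E_pm, psiX_pm]
      split_ifs <;> simp [psiX_pm]
    · rintro y ⟨r', s, rfl⟩
      have h1 : E C (n + 1) j * (up C (n + 1) r' * T C n * up C (n + 1) s)
          = up C (n + 1) r' * T C n * up C (n + 1) (E C n j * s) := by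
        rw [map_mul, ← mul_assoc, ← mul_assoc, (cEu C j r').eq, mul_assoc (up C (n + 1) r'),
          ← T_E']
        simp only [mul_assoc]
      rw [h1, psiX_tau c φd pT M e he hT hc, psiX_tau c φd pT M e he hT hc]
      have h2 : epr (k := k) M e (c.pS (E C n j * s) • v)
          = if j = i then epr (k := k) M e (c.pS s • v) else 0 := by
        apply Subtype.ext
        rw [epr_val, he, ← mul_smul, ← map_mul, ← mul_assoc, E_E]
        split_ifs with h h' h'
        · rw [epr_val, map_mul, mul_smul]
        · exact absurd h.symm h'
        · exact absurd h'.symm h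
        · simp
      rw [h2]
      split_ifs <;> simp
    · simp
    · intro y y' h h'
      rw [mul_add, map_add, map_add, LinearMap.add_apply, LinearMap.add_apply, h, h']
      split_ifs <;> simp
    · intro q y h
      rw [mul_smul_comm, map_smul, map_smul, LinearMap.smul_apply, LinearMap.smul_apply, h]
      split_ifs <;> simp
  Er := by
    intro j y v
    refine R_ind C (p := fun y => psiX c φd M e (y * E C (n + 1) j) v
      = if j = i then psiX c φd M e y v else 0) ?_ ?_ ?_ ?_ ?_ y
    · intro s m j'
      rw [pm_E, psiX_pm]
      split_ifs <;> simp [psiX_pm]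
    · rintro y ⟨r', s, rfl⟩
      have h1 : up C (n + 1) r' * T C n * up C (n + 1) s * E C (n + 1) j
          = up C (n + 1) (r' * E C n j) * T C n * up C (n + 1) s := by
        rw [map_mul, mul_assoc, ← (cEu C j s).eq, mul_assoc (up C (n + 1) r') _ (T C n), ← T_E]
        simp only [mul_assoc]
      rw [h1, psiX_tau c φd pT M e he hT hc, psiX_tau c φd pT M e he hT hc]
      rw [← om_phi_one, e_mul c φd pT hT, ← map_mul, mul_assoc, E_E]
      split_ifs with h
      · subst h
        rw [map_mul, ← e_mul c φd pT hT, om_phi_one]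
      · simp
    · simp
    · intro y y' h h'
      rw [add_mul, map_add, map_add, LinearMap.add_apply, LinearMap.add_apply, h, h']
      split_ifs <;> simp
    · intro q y h
      rw [smul_mul_assoc, map_smul, map_smul, LinearMap.smul_apply, LinearMap.smul_apply, h]
      split_ifs <;> simp
  gam_smul := by
    intro s ξ
    refine OT_ind φd (p := fun ξ => gamX c φd pT M e he hT hTs hc (s • ξ)
      = c.φ s • gamX c φd pT M e he hT hTs hc ξ) ?_ ?_ ?_ ξ
    · intro b m
      rw [om_smul, gamX_om, gamX_om, om_smul, map_mul c.φ, mul_assoc]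
    · simp
    · intro ξ η h h'
      rw [smul_add, map_add, map_add, h, h', smul_add]
  gam_tau := by
    rintro y ⟨r, s, rfl⟩ v
    have hE : E C n i * E C n i = E C n i := by rw [E_E, if_pos rfl]
    have hE' : E C (n + 1) i * E C (n + 1) i = E C (n + 1) i := by rw [E_E, if_pos rfl]
    have h1 : E C (n + 1) i * (up C (n + 1) r * T C n * up C (n + 1) s) * E C (n + 1) i
        = up C (n + 1) r * E C (n + 1) i * (T C n * E C (n + 1) i)
          * up C (n + 1) (E C n i * s) * E C (n + 1) i := by
      rw [mul_assoc (up C (n + 1) r) (E C (n + 1) i), eTe]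
      calc _ = (E C (n + 1) i * up C (n + 1) r) * T C n * up C (n + 1) s * E C (n + 1) i := by
            simp only [mul_assoc]
        _ = up C (n + 1) r * (E C (n + 1) i * T C n) * (up C (n + 1) s * E C (n + 1) i) := by
            rw [(cEu C i r).eq]
            simp only [mul_assoc]
        _ = up C (n + 1) r * T C n * up C (n + 1) (E C n i * E C n i * s)
              * (E C (n + 1) i * E C (n + 1) i) := by
            rw [← T_E', hE, hE', map_mul]
            simp only [mul_assoc]
        _ = up C (n + 1) r * T C n * up C (n + 1) (E C n i)
              * (up C (n + 1) (E C n i * s) * E C (n + 1) i) * E C (n + 1) i := by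
            rw [mul_assoc (E C n i), map_mul]
            simp only [mul_assoc]
        _ = _ := by
            rw [← (cEu C i (E C n i * s)).eq]
            simp only [mul_assoc]
    rw [h1, om_up, psiX_tau c φd pT M e he hT hc, gamX_om, epr_val, he, ← mul_smul, ← map_mul,
      c.hφ, ← map_mul]
  span := by
    intro p h h0 hadd ξ
    refine OT_ind φd (p := p) ?_ h0 hadd ξ
    rintro b ⟨m, v, hv⟩
    obtain ⟨r, rfl⟩ := c.pS_surj b
    have h1 := h (up C (n + 1) r * T C n * up C (n + 1) 1) v ⟨r, 1, rfl⟩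
    rw [psiX_tau c φd pT M e he hT hc, map_one, one_smul] at h1
    have h2 : epr (k := k) M e v = ⟨m, v, hv⟩ := Subtype.ext hv
    rw [h2] at h1
    exact h1

end pos

end KLR


namespace KLR

set_option autoImplicit false
set_option linter.unusedSectionVars false
set_option linter.unusedSimpArgs false

variable {k : Type} [Field k] {I : Type} [Fintype I] [DecidableEq I] (C : CartanDatum k I)
variable (L : I → ℕ)

/-- The projection `R(n) → R^Λ(β)`. -/
noncomputable def pC (n : ℕ) (β : I → ℕ) : RA C n →ₐ[k] cAlg C L n β :=
  (toCB C L).comp (toRA C n).symm.toAlgHom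

theorem pC_toRA (n : ℕ) (β : I → ℕ) (y : Alg C n) : pC C L n β (toRA C n y) = toCB C L y := rfl

theorem toRA_Ee {n : ℕ} (ν : Fin n → I) : toRA C n (Ee C ν) = ee C ν := rfl
theorem toRA_Xx {n : ℕ} (a : Fin n) : toRA C n (Xx C a) = xx C a := rfl
theorem toRA_Tt {n : ℕ} (l : ℕ) (h : l + 1 < n) : toRA C n (Tt C l h) = tt C l h := rfl

theorem pC_mk (n : ℕ) (β : I → ℕ) (f : FA k I n) :
    pC C L n β (mkA C n f) = RingQuot.mkAlgHom k (CRel C L n β) f := by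
  change toC C (toB C (RingQuot.mkAlgHom k (Rel C n) f)) = _
  unfold toC toB
  rw [RingQuot.liftAlgHom_mkAlgHom_apply, RingQuot.liftAlgHom_mkAlgHom_apply]

theorem pC_surj (n : ℕ) (β : I → ℕ) : Function.Surjective (pC C L n β) := by
  intro y
  obtain ⟨f, rfl⟩ := RingQuot.mkAlgHom_surjective k (CRel C L n β) y
  exact ⟨mkA C n f, pC_mk C L n β f⟩

theorem pC_unit (n : ℕ) (β : I → ℕ) : ∑ ν ∈ seqs β n, pC C L n β (ee C ν) = 1 := by
  have h := RingQuot.mkAlgHom_rel k (CRel.unit (C := C) (Λ := L) (n := n) (β := β))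
  rw [← pC_mk, ← pC_mk, map_one, map_one, map_sum, map_sum] at h
  exact h

theorem pC_ee (n : ℕ) (β : I → ℕ) (ν : Fin n → I) (h : ν ∉ seqs β n) :
    pC C L n β (ee C ν) = 0 := by
  rw [← mul_one (pC C L n β (ee C ν)), ← pC_unit C L n β, Finset.mul_sum]
  refine Finset.sum_eq_zero fun μ hμ => ?_
  rw [← map_mul, ee_mul, if_neg, map_zero]
  rintro rfl
  exact h hμ

theorem pC_aL (n : ℕ) (β : I → ℕ) : pC C L n β (aL C L n) = 0 := by
  cases n with
  | zero => exact map_zero _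
  | succ n =>
    have h := RingQuot.mkAlgHom_rel k (CRel.cyc (C := C) (Λ := L) (n := n + 1) (β := β))
    rw [← pC_mk, ← pC_mk, map_zero, map_zero] at h
    rw [← h]
    unfold aL aLamF
    rw [dif_pos (Nat.succ_pos n), map_sum, map_sum, map_sum]
    symm
    apply Finset.sum_subset_zero_on_sdiff (Finset.subset_univ _)
    · intro ν hν
      rw [Finset.mem_sdiff] at hν
      rw [map_mul, pC_ee C L _ _ ν hν.2, mul_zero]
    · intro ν _
      rw [map_mul (mkA C (n + 1)), map_pow]
      rfl

theorem pC_J (n : ℕ) (β : I → ℕ) (y : RA C n) (hy : y ∈ J C L n) : pC C L n β y = 0 := by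
  induction hy using Submodule.span_induction with
  | mem x hx =>
    obtain ⟨r, s, rfl⟩ := hx
    rw [map_mul, map_mul, pC_aL, mul_zero, zero_mul]
  | zero => exact map_zero _
  | add x y _ _ h h' => rw [map_add, h, h', add_zero]
  | smul a x _ h => rw [map_smul, h, smul_zero]

theorem pC_sum_E (n : ℕ) (γ : I → ℕ) (i : I) (F : Finset (Fin (n + 1) → I))
    (hF : ∀ ν ∈ seqs γ (n + 1), (ν ∈ F ↔ ν (Fin.last n) = i)) :
    pC C L (n + 1) γ (∑ ν ∈ F, ee C ν) = pC C L (n + 1) γ (E C n i) := by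
  unfold E ec
  rw [map_sum, map_sum]
  have h0 : ∑ ν ∈ F, pC C L (n + 1) γ (ee C ν)
      = ∑ ν : Fin (n + 1) → I, if ν ∈ F then pC C L (n + 1) γ (ee C ν) else 0 := by
    rw [Finset.sum_ite_mem, Finset.univ_inter]
  rw [h0]
  refine Finset.sum_congr rfl fun ν _ => ?_
  by_cases hν : ν ∈ seqs γ (n + 1)
  · rw [apply_ite (pC C L (n + 1) γ), map_zero]
    exact if_congr (hF ν hν) rfl rfl
  · rw [apply_ite (pC C L (n + 1) γ), map_zero, pC_ee C L _ _ ν hν, ite_self, ite_self]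

theorem toCB_eR (n : ℕ) (β γ : I → ℕ) (i : I)
    (h : ∀ ν ∈ seqs γ (n + 1), ν (Fin.last n) = i → addA β i = γ) :
    toCB C L (eR C n β i) = pC C L (n + 1) γ (E C n i) := by
  rw [← pC_toRA, ← pC_sum_E C L n γ i
    ((seqs (addA β i) (n + 1)).filter (fun ν => ν (Fin.last n) = i))]
  · unfold eR
    rw [map_sum]
    rfl
  · intro ν hν
    rw [Finset.mem_filter]
    constructor
    · exact fun h => h.2
    · intro h'
      refine ⟨?_, h'⟩
      rw [h ν hν h']
      exact hν

theorem eDc_eq (n : ℕ) (γ : I → ℕ) (i : I) :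
    eDc C L (n + 1) γ i = pC C L (n + 1) γ (E C n i) := by
  unfold eDc
  rw [← pC_toRA, ← pC_sum_E C L n γ i ((seqs γ (n + 1)).filter (fun ν =>
    if h : 0 < n + 1 then ν ⟨n + 1 - 1, Nat.sub_lt h one_pos⟩ = i else False))]
  · unfold eD
    rw [map_sum]
    rfl
  · intro ν hν
    rw [Finset.mem_filter, dif_pos (Nat.succ_pos n)]
    exact ⟨fun h => h.2, fun h => ⟨hν, h⟩⟩

theorem up_ee_E {n : ℕ} (ν : Fin n → I) (i : I) :
    up C n (ee C ν) * E C n i = ee C (Fin.snoc ν i : Fin (n + 1) → I) := by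
  rw [ee_eq C n (Fin.snoc ν i), Fin.init_snoc, Fin.snoc_last]

theorem hphi {n : ℕ} {β γ : I → ℕ} {i : I} (φ : cAlg C L n β →ₙₐ[k] cAlg C L (n + 1) γ)
    (hφ : IsUpRc C L i φ)
    (h : ∀ ν ∈ seqs γ (n + 1), ν (Fin.last n) = i → addA β i = γ) (r : RA C n) :
    φ (pC C L n β r) = pC C L (n + 1) γ (up C n r * E C n i) := by
  obtain ⟨h1, h2, h3⟩ := hφ
  have he : ∀ ν : Fin n → I, φ (pC C L n β (ee C ν)) = pC C L (n + 1) γ (up C n (ee C ν) * E C n i) := by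
    intro ν
    rw [up_ee_E]
    exact h1 ν
  have hE : E C n i * E C n i = E C n i := by rw [E_E, if_pos rfl]
  have hone : φ (pC C L n β 1) = pC C L (n + 1) γ (up C n 1 * E C n i) := by
    rw [← (isRep_alg C n).esum, map_sum, map_sum, map_sum, Finset.sum_mul, map_sum]
    exact Finset.sum_congr rfl fun ν _ => he ν
  refine alg_top C (n := n) { carrier := {r | φ (pC C L n β r) = pC C L (n + 1) γ (up C n r * E C n i)}
                              mul_mem' := ?_
                              add_mem' := ?_
                              algebraMap_mem' := ?_ } ?_ ?_ ?_ r
  · intro a b ha hb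
    simp only [Set.mem_ofPred_eq] at ha hb ⊢
    rw [map_mul (pC C L n β), map_mul φ, ha, hb, ← map_mul]
    congr 1
    rw [mul_assoc, ← mul_assoc (E C n i), (cEu C i b).eq, mul_assoc, hE, map_mul, mul_assoc]
  · intro a b ha hb
    simp only [Set.mem_ofPred_eq] at ha hb ⊢
    rw [map_add, map_add, map_add, add_mul, map_add, ha, hb]
  · intro q
    simp only [Set.mem_ofPred_eq]
    rw [Algebra.algebraMap_eq_smul_one, map_smul, map_smul, map_smul, smul_mul_assoc, map_smul, hone]
  · exact he
  · intro a
    change φ (toCB C L (Xx C a)) = _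
    rw [h2 a, map_mul, toCB_eR C L n β γ i h, map_mul, up_x]
    rfl
  · intro l hl
    change φ (toCB C L (Tt C l hl)) = _
    rw [h3 l hl, map_mul, toCB_eR C L n β γ i h, map_mul, up_t]
    rfl

theorem content_snoc {n : ℕ} (μ : Fin (n + 1) → I) :
    content μ = addA (content (Fin.init μ : Fin n → I)) (μ (Fin.last n)) := by
  funext j
  unfold content addA
  dsimp only
  rw [Finset.card_filter, Finset.card_filter, Fin.sum_univ_castSucc]
  simp only [Fin.init, eq_comm]

theorem content_swap {n : ℕ} (ν : Fin n → I) (σ : Equiv.Perm (Fin n)) :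
    content (ν ∘ σ) = content ν := by
  funext j
  unfold content
  exact Finset.card_equiv σ (by simp)

theorem mem_seqs {n : ℕ} (γ : I → ℕ) (ν : Fin n → I) : ν ∈ seqs γ n ↔ content ν = γ := by
  unfold seqs
  simp

theorem addA_inj {β β' : I → ℕ} {i : I} (h : addA β i = addA β' i) : β = β' := by
  funext j
  have := congrFun h j
  unfold addA at this
  omega

/-- The idempotent `e(γ)`. -/
noncomputable def eg (n : ℕ) (γ : I → ℕ) : RA C n := ∑ ν ∈ seqs γ n, ee C ν

theorem eg_ee (n : ℕ) (γ : I → ℕ) (ν : Fin n → I) :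
    eg C n γ * ee C ν = if content ν = γ then ee C ν else 0 := by
  unfold eg
  rw [Finset.sum_mul]
  simp only [ee_mul]
  rw [Finset.sum_ite_eq']
  simp only [mem_seqs]

theorem ee_eg (n : ℕ) (γ : I → ℕ) (ν : Fin n → I) :
    ee C ν * eg C n γ = if content ν = γ then ee C ν else 0 := by
  unfold eg
  rw [Finset.mul_sum]
  simp only [ee_mul]
  rw [Finset.sum_ite_eq]
  simp only [mem_seqs]

theorem eg_central (n : ℕ) (γ : I → ℕ) (y : RA C n) : eg C n γ * y = y * eg C n γ := by
  have hs : ∀ z, z ∈ Subalgebra.centralizer k {eg C n γ} ↔ eg C n γ * z = z * eg C n γ := by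
    intro z
    simp [Subalgebra.mem_centralizer_iff]
  have h : y ∈ Subalgebra.centralizer k {eg C n γ} := by
    refine alg_top C _ ?_ ?_ ?_ y
    · intro ν
      rw [hs, eg_ee, ee_eg]
    · intro a
      rw [hs]
      unfold eg
      rw [Finset.mul_sum, Finset.sum_mul]
      exact Finset.sum_congr rfl fun ν _ => ((isRep_alg C n).xe a ν).symm
    · intro l h
      rw [hs]
      apply ext_e
      intro ν
      rw [mul_assoc, mul_assoc, eg_ee, (isRep_alg C n).taue, ← mul_assoc, eg_ee, content_swap]
      split_ifs
      · rw [(isRep_alg C n).taue]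
      · simp
  exact (hs y).1 h

section ker
variable (n : ℕ) (γ : I → ℕ) {V : Type} [AddCommGroup V] [Module k V] (ψ : RA C n →ₗ[k] V)

/-- The congruence attached to a linear map. -/
def kcon : RingCon (RA C n) where
  r a b := ∀ p s, ψ (p * (a - b) * s) = 0
  iseqv := by
    refine ⟨?_, ?_, ?_⟩
    · intro a p s
      rw [sub_self, mul_zero, zero_mul, map_zero]
    · intro a b h p s
      rw [← neg_sub, mul_neg, neg_mul, map_neg, h, neg_zero]
    · intro a b c h h' p s
      rw [← sub_add_sub_cancel a b c, mul_add, add_mul, map_add, h, h', add_zero]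
  mul' := by
    intro a b c d h h' p s
    have : p * (a * c - b * d) * s = p * (a - b) * (c * s) + (p * b) * (c - d) * s := by
      simp only [mul_sub, sub_mul, mul_assoc]
      abel
    rw [this, map_add, h, h', add_zero]
  add' := by
    intro a b c d h h' p s
    rw [add_sub_add_comm, mul_add, add_mul, map_add, h, h', add_zero]

theorem pC_ker (hJ : ∀ y ∈ J C L n, ψ y = 0)
    (hE : ∀ y, ∀ μ : Fin n → I, content μ ≠ γ → ψ (y * ee C μ) = 0)
    (y : RA C n) (hy : pC C L n γ y = 0) : ψ y = 0 := by
  let g : FA k I n →ₐ[k] (kcon C n ψ).Quotient := ((kcon C n ψ).mkₐ k).comp (mkA C n)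
  have hm : ∀ a b : RA C n, (∀ p s, ψ (p * (a - b) * s) = 0) →
      (kcon C n ψ).mkₐ k a = (kcon C n ψ).mkₐ k b := by
    intro a b h
    exact (RingCon.eq (kcon C n ψ)).2 h
  have hE' : ∀ p s, ψ (p * (eg C n γ - 1) * s) = 0 := by
    intro p s
    have : eg C n γ - 1 = - ∑ μ : Fin n → I, if content μ = γ then 0 else ee C μ := by
      apply ext_e
      intro ν
      rw [sub_mul, eg_ee, one_mul, neg_mul, Finset.sum_mul, Finset.sum_eq_single ν]
      · split_ifs <;> simp [ee_mul]
      · intro μ _ h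
        split_ifs
        · simp
        · rw [ee_mul, if_neg h]
      · simp
    have h2 : p * (eg C n γ - 1) * s = p * s * (eg C n γ - 1) := by
      rw [mul_assoc, mul_assoc, sub_mul, eg_central, one_mul, mul_sub s, mul_one]
    rw [h2, this, mul_neg, map_neg, Finset.mul_sum, map_sum, neg_eq_zero]
    refine Finset.sum_eq_zero fun μ _ => ?_
    split_ifs with h
    · rw [mul_zero, map_zero]
    · exact hE _ μ h
  have hg : ∀ ⦃a b : FA k I n⦄, CRel C L n γ a b → g a = g b := by
    intro a b h
    cases h with
    | base h =>
      change (kcon C n ψ).mkₐ k _ = (kcon C n ψ).mkₐ k _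
      exact congrArg _ (mkA_rel C h)
    | unit =>
      apply hm
      rw [map_sum, map_one]
      exact hE'
    | cyc =>
      apply hm
      intro p s
      apply hJ
      rw [map_zero, sub_zero]
      apply J_mul_right
      apply J_mul_left
      unfold aLamF
      split_ifs with h
      · obtain ⟨m, rfl⟩ : ∃ m, n = m + 1 := ⟨n - 1, by omega⟩
        have : mkA C (m + 1) (∑ ν ∈ seqs γ (m + 1), (gx k (⟨0, h⟩ : Fin (m + 1))) ^ (L (ν ⟨0, h⟩)) * ge k ν)
            = aL C L (m + 1) * eg C (m + 1) γ := by
          unfold aL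
          rw [Finset.sum_mul]
          simp only [mul_assoc, ee_eg]
          rw [map_sum, ← Finset.sum_filter_add_sum_filter_not Finset.univ (fun ν => content ν = γ)]
          rw [Finset.sum_eq_zero (s := Finset.univ.filter (fun ν => ¬ content ν = γ)), add_zero]
          · refine Finset.sum_congr rfl fun ν hν => ?_
            rw [if_pos (Finset.mem_filter.1 hν).2, map_mul, map_pow]
            rfl
          · intro ν hν
            rw [if_neg (Finset.mem_filter.1 hν).2, mul_zero]
        exact this ▸ J_mul_right C _ (aL_mem C _)
      · rw [map_zero]
        exact Submodule.zero_mem _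
  obtain ⟨f, rfl⟩ := mkA_surj C n y
  have h1 : RingQuot.liftAlgHom k ⟨g, hg⟩ (pC C L n γ (mkA C n f)) = g f := by
    rw [pC_mk, RingQuot.liftAlgHom_mkAlgHom_apply]
  rw [hy, map_zero, ← map_zero g] at h1
  have h2 := (RingCon.eq (kcon C n ψ)).1 h1.symm 1 1
  rw [map_zero, sub_zero, mul_one, one_mul] at h2
  exact h2
end ker

theorem wt_content (i : I) {n : ℕ} (ν : Fin n → I) :
    wt C L i ν = (L i : ℤ) - pairH C i (content ν) := by
  unfold wt pairH content
  congr 1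
  simp only [Finset.card_filter, Nat.cast_sum, Nat.cast_ite, Nat.cast_one, Nat.cast_zero,
    Finset.sum_mul, ite_mul, one_mul, zero_mul]
  rw [Finset.sum_comm]
  simp

theorem Yee (N : ℕ) (β : I → ℕ) (y g : RA C N)
    (h : ∀ ν, content ν = β → y * ee C ν - g * ee C ν ∈ J C L N) :
    pC C L N β y = pC C L N β g := by
  have h1 : ∀ z : RA C N, pC C L N β z = ∑ ν ∈ seqs β N, pC C L N β (z * ee C ν) := by
    intro z
    rw [← mul_one (pC C L N β z), ← pC_unit, Finset.mul_sum]
    simp only [map_mul]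
  rw [h1 y, h1 g]
  refine Finset.sum_congr rfl fun ν hν => ?_
  rw [← sub_eq_zero, ← map_sub]
  exact pC_J C L N β _ (h ν ((mem_seqs β ν).1 hν))

/-- diagonal elements -/
noncomputable def diag (N : ℕ) (c : (Fin N → I) → k) : RA C N := ∑ ν, c ν • ee C ν

theorem diag_ee (N : ℕ) (c : (Fin N → I) → k) (ν : Fin N → I) :
    diag C N c * ee C ν = c ν • ee C ν := by
  unfold diag
  rw [Finset.sum_mul, Finset.sum_eq_single ν]
  · rw [smul_mul_assoc, ee_mul, if_pos rfl]
  · intro μ _ h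
    rw [smul_mul_assoc, ee_mul, if_neg h, smul_zero]
  · simp

theorem diag_mul (N : ℕ) (c d : (Fin N → I) → k) (h : ∀ ν, c ν * d ν = 1) :
    diag C N c * diag C N d = 1 := by
  apply ext_e
  intro ν
  rw [mul_assoc, diag_ee, mul_smul_comm, diag_ee, smul_smul, mul_comm, h, one_smul, one_mul]

/-- The context attached to cyclotomic quotients. -/
noncomputable def mkCtx (N : ℕ) (β : I → ℕ) (i : I) (a : ℕ) (ha : (a : ℤ) = L i - pairH C i β)
    (φ : cAlg C L N β →ₙₐ[k] cAlg C L (N + 1) (addA β i)) (hφ : IsUpRc C L i φ) :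
    Ctx C L N i a (cAlg C L N β) (cAlg C L (N + 1) (addA β i)) where
  pS := pC C L N β
  pB := pC C L (N + 1) (addA β i)
  φ := φ
  pS_surj := pC_surj C L N β
  pB_surj := pC_surj C L (N + 1) (addA β i)
  hφ := hphi C L φ hφ (fun _ _ _ => rfl)
  pS_J := pC_J C L N β
  pB_J := pC_J C L (N + 1) (addA β i)
  ker := by
    intro V _ _ ψ hJ hE y hy
    refine pC_ker C L (N + 1) (addA β i) ψ hJ ?_ y hy
    intro y μ hμ
    rw [ee_eq]
    apply hE
    rw [content_snoc] at hμ
    by_cases h : μ (Fin.last N) = i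
    · right
      apply pC_ee
      rw [mem_seqs]
      intro h'
      rw [h, h'] at hμ
      exact hμ rfl
    · exact Or.inl h
  u := ⟨pC C L N β (diag C N (gam C i)), pC C L N β (diag C N (fun ν => (gam C i ν)⁻¹)), by
      rw [← map_mul, diag_mul, map_one]
      exact fun ν => mul_inv_cancel₀ (gam_ne C i ν), by
      rw [← map_mul, diag_mul, map_one]
      exact fun ν => inv_mul_cancel₀ (gam_ne C i ν)⟩
  lead0 := by
    intro m D h
    rw [← map_zero (pC C L N β)]
    apply Yee C L
    intro ν hν
    rw [zero_mul, sub_zero]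
    apply (lead C i N ν m D).1
    rw [wt_content, hν, ← ha]
    exact_mod_cast h
  lead1 := by
    intro m
    apply Yee C L
    intro ν hν
    rw [diag_ee]
    apply (lead C i N ν m (a + m)).2
    rw [wt_content, hν, ← ha]
    push_cast
    rfl

end KLR


namespace KLR

set_option autoImplicit false
set_option linter.unusedSectionVars false
set_option linter.unusedSimpArgs false

open scoped TensorProduct

variable {k : Type} [Field k] {I : Type} [Fintype I] [DecidableEq I] {C : CartanDatum k I}

section Gr
variable {n : ℕ} {A : Type} [Ring A] [Algebra k A] (p : RA C n →ₐ[k] A) (𝒜 : ℤ → Submodule k A)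

/-- `𝒜` is the canonical grading. -/
def GrP : Prop := IsKLRGrading C (p.comp (toRA C n).toAlgHom) 𝒜

variable {p 𝒜}

theorem GrP.e (h : GrP p 𝒜) (ν : Fin n → I) : p (ee C ν) ∈ 𝒜 0 := h.2.1 ν
theorem GrP.x (h : GrP p 𝒜) (a : Fin n) (ν : Fin n → I) :
    p (xx C a * ee C ν) ∈ 𝒜 (B C (ν a) (ν a)) := h.2.2.1 a ν
theorem GrP.t (h : GrP p 𝒜) (l : ℕ) (hl : l + 1 < n) (ν : Fin n → I) :
    p (tt C l hl * ee C ν) ∈ 𝒜 (-(B C (ν ⟨l, Nat.lt_of_succ_lt hl⟩) (ν ⟨l + 1, hl⟩))) :=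
  h.2.2.2 l hl ν
theorem GrP.one (h : GrP p 𝒜) : (1 : A) ∈ 𝒜 0 := h.1.1
theorem GrP.mul (h : GrP p 𝒜) {c d : ℤ} {a b : A} (ha : a ∈ 𝒜 c) (hb : b ∈ 𝒜 d) :
    a * b ∈ 𝒜 (c + d) := h.1.2.1 ha hb
theorem GrP.indep (h : GrP p 𝒜) : iSupIndep 𝒜 := h.1.2.2.submodule_iSupIndep
end Gr

theorem B_ii (C : CartanDatum k I) (i : I) : B C i i = 2 * C.d i := by
  unfold B
  rw [C.a_diag]
  ring

theorem GrP.degXE {N : ℕ} {A : Type} [Ring A] [Algebra k A] {p : RA C (N + 1) →ₐ[k] A}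
    {𝒜 : ℤ → Submodule k A} (h : GrP p 𝒜) (i : I) (q : ℕ) :
    p (X C N ^ q * E C N i) ∈ 𝒜 (2 * C.d i * q) := by
  have h1 : ∀ μ : Fin (N + 1) → I, μ (Fin.last N) = i →
      p (X C N ^ q * ee C μ) ∈ 𝒜 (2 * C.d i * q) := by
    intro μ hμ
    induction q with
    | zero =>
      rw [pow_zero, one_mul]
      simpa using h.e μ
    | succ q ih =>
      have hc : Commute (X C N ^ q) (ee C μ) := by
        apply Commute.pow_left
        exact (isRep_alg C (N + 1)).xe _ μ
      have h2 : X C N ^ (q + 1) * ee C μ = (X C N * ee C μ) * (X C N ^ q * ee C μ) := by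
        rw [hc.eq, mul_assoc, ← mul_assoc (ee C μ) (ee C μ), ee_mul, if_pos rfl, ← hc.eq,
          ← mul_assoc, pow_succ']
      rw [h2, map_mul]
      have h3 := h.mul (h.x (Fin.last N) μ) ih
      rw [hμ, B_ii] at h3
      have h4 : 2 * (C.d i : ℤ) * ((q + 1 : ℕ) : ℤ) = 2 * C.d i + 2 * C.d i * q := by
        push_cast
        ring
      rw [h4]
      exact h3
  unfold E ec
  rw [Finset.mul_sum, map_sum]
  refine Submodule.sum_mem _ fun μ _ => ?_
  split_ifs with hμ
  · exact h1 μ hμ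
  · rw [mul_zero, map_zero]
    exact Submodule.zero_mem _

theorem GrP.degE {N : ℕ} {A : Type} [Ring A] [Algebra k A] {p : RA C (N + 1) →ₐ[k] A}
    {𝒜 : ℤ → Submodule k A} (h : GrP p 𝒜) (i : I) : p (E C N i) ∈ 𝒜 0 := by
  have := h.degXE i 0
  simpa using this

theorem GrP.degTE {N : ℕ} {A : Type} [Ring A] [Algebra k A] {p : RA C (N + 2) →ₐ[k] A}
    {𝒜 : ℤ → Submodule k A} (h : GrP p 𝒜) (i : I) :
    p (T C N * (up C (N + 1) (E C N i) * E C (N + 1) i)) ∈ 𝒜 (-(2 * C.d i)) := by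
  have h1 : T C N * (up C (N + 1) (E C N i) * E C (N + 1) i)
      = ∑ μ : Fin (N + 2) → I, T C N * (up C (N + 1) (E C N i) * E C (N + 1) i) * ee C μ := by
    rw [← Finset.mul_sum, (isRep_alg C (N + 2)).esum, mul_one]
  rw [h1, map_sum]
  refine Submodule.sum_mem _ fun μ _ => ?_
  have hE : E C (N + 1) i * ee C μ = if μ (Fin.last (N + 1)) = i then ee C μ else 0 :=
    ec_mul_ee C _ _ _
  have hE' : up C (N + 1) (E C N i) * ee C μ
      = if μ (Fin.last N).castSucc = i then ee C μ else 0 := by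
    unfold E
    rw [up_ec]
    exact ec_mul_ee C _ _ _
  rw [mul_assoc, mul_assoc, hE]
  by_cases h2 : μ (Fin.last (N + 1)) = i
  · rw [if_pos h2, hE']
    by_cases h3 : μ (Fin.last N).castSucc = i
    · rw [if_pos h3]
      have h4 := h.t N (Nat.lt_succ_self _) μ
      have h5 : (⟨N, Nat.lt_of_succ_lt (Nat.lt_succ_self _)⟩ : Fin (N + 2))
        = (Fin.last N).castSucc := rfl
      have h6 : (⟨N + 1, Nat.lt_succ_self _⟩ : Fin (N + 2)) = Fin.last (N + 1) := rfl
      rw [h5, h6, h2, h3, B_ii] at h4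
      exact h4
    · rw [if_neg h3, mul_zero, map_zero]
      exact Submodule.zero_mem _
  · rw [if_neg h2, mul_zero, mul_zero, map_zero]
    exact Submodule.zero_mem _

theorem le_of_indep {A : Type} [AddCommGroup A] [Module k A] (𝒜 H : ℤ → Submodule k A)
    (hi : iSupIndep 𝒜) (hle : ∀ c, H c ≤ 𝒜 c) (ht : ⨆ c, H c = ⊤) (c : ℤ) : 𝒜 c ≤ H c := by
  intro s hs
  have h1 : s ∈ H c ⊔ ⨆ j, ⨆ (_ : j ≠ c), H j := by
    have : (⨆ c, H c) ≤ H c ⊔ ⨆ j, ⨆ (_ : j ≠ c), H j := by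
      refine iSup_le fun j => ?_
      by_cases h : j = c
      · rw [h]
        exact le_sup_left
      · exact le_sup_of_le_right (le_iSup₂_of_le j h le_rfl)
    exact this (ht ▸ Submodule.mem_top)
  obtain ⟨h, hh, t, htt, rfl⟩ := Submodule.mem_sup.1 h1
  have h2 : t ∈ 𝒜 c := by
    have := Submodule.sub_mem _ hs (hle c hh)
    rwa [add_sub_cancel_left] at this
  have h3 : t ∈ ⨆ j, ⨆ (_ : j ≠ c), 𝒜 j :=
    (iSup₂_mono fun j _ => hle j) htt
  have h4 : t = 0 := by
    have := (hi c).le_bot (Submodule.mem_inf.2 ⟨h2, h3⟩)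
    exact (Submodule.mem_bot k).1 this
  rw [h4, add_zero]
  exact hh

section Phi
variable {L : I → ℕ} {N : ℕ} {i : I} {a : ℕ} {S B' : Type} [Ring S] [Algebra k S]
    [Ring B'] [Algebra k B'] (c : Ctx C L N i a S B') {𝒜S : ℤ → Submodule k S}
    {𝒜B : ℤ → Submodule k B'}

theorem phi_gr (hS : GrP c.pS 𝒜S) (hB : GrP c.pB 𝒜B) (m : ℤ) (s : S) (hs : s ∈ 𝒜S m) :
    c.φ s ∈ 𝒜B m := by
  let H : ℤ → Submodule k S := fun m => 𝒜S m ⊓ (𝒜B m).comap (c.φ : S →ₗ[k] B')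
  have hH : ∀ m s, s ∈ 𝒜S m → c.φ s ∈ 𝒜B m → s ∈ ⨆ m, H m := by
    intro m s h h'
    exact (le_iSup H m) (Submodule.mem_inf.2 ⟨h, h'⟩)
  have hmul : ∀ s ∈ ⨆ m, H m, ∀ t ∈ ⨆ m, H m, s * t ∈ ⨆ m, H m := by
    intro s hs t ht
    induction hs using Submodule.iSup_induction' with
    | mem d s hs =>
      induction ht using Submodule.iSup_induction' with
      | mem d' t ht =>
        refine hH (d + d') _ (hS.mul hs.1 ht.1) ?_
        rw [map_mul]
        exact hB.mul hs.2 ht.2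
      | zero => rw [mul_zero]; exact Submodule.zero_mem _
      | add x y _ _ hx hy => rw [mul_add]; exact Submodule.add_mem _ hx hy
    | zero => rw [zero_mul]; exact Submodule.zero_mem _
    | add x y _ _ hx hy => rw [add_mul]; exact Submodule.add_mem _ hx hy
  have hE : c.pB (E C N i) ∈ 𝒜B 0 := hB.degE i
  have hall : ∀ r : RA C N, c.pS r ∈ ⨆ m, H m := by
    intro r
    refine alg_top C (n := N) { carrier := {r | c.pS r ∈ ⨆ m, H m}
                                mul_mem' := ?_
                                add_mem' := ?_
                                algebraMap_mem' := ?_ } ?_ ?_ ?_ r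
    · intro r s hr hs
      simp only [Set.mem_ofPred_eq] at hr hs ⊢
      rw [map_mul]
      exact hmul _ hr _ hs
    · intro r s hr hs
      simp only [Set.mem_ofPred_eq] at hr hs ⊢
      rw [map_add]
      exact Submodule.add_mem _ hr hs
    · intro q
      simp only [Set.mem_ofPred_eq]
      rw [Algebra.algebraMap_eq_smul_one, map_smul]
      apply Submodule.smul_mem
      refine hH 0 _ ?_ ?_
      · rw [map_one]
        exact hS.one
      · rw [c.hφ, map_one, one_mul]
        exact hE
    · intro ν
      refine hH 0 _ (hS.e ν) ?_
      rw [c.hφ, up_ee_E]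
      exact hB.e _
    · intro b
      change c.pS (xx C b) ∈ ⨆ m, H m
      have : xx C b = ∑ ν, xx C b * ee C ν := by
        rw [← Finset.mul_sum, (isRep_alg C N).esum, mul_one]
      rw [this, map_sum]
      refine Submodule.sum_mem _ fun ν _ => ?_
      refine hH _ _ (hS.x b ν) ?_
      rw [c.hφ, map_mul (up C N), up_x, mul_assoc, up_ee_E]
      have := hB.x b.castSucc (Fin.snoc ν i)
      rw [Fin.snoc_castSucc] at this
      exact this
    · intro l hl
      change c.pS (tt C l hl) ∈ ⨆ m, H m
      have : tt C l hl = ∑ ν, tt C l hl * ee C ν := by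
        rw [← Finset.mul_sum, (isRep_alg C N).esum, mul_one]
      rw [this, map_sum]
      refine Submodule.sum_mem _ fun ν _ => ?_
      refine hH _ _ (hS.t l hl ν) ?_
      rw [c.hφ, map_mul (up C N), up_t, mul_assoc, up_ee_E]
      have := hB.t l (Nat.lt_succ_of_lt hl) (Fin.snoc ν i)
      have h5 : (⟨l, Nat.lt_of_succ_lt (Nat.lt_succ_of_lt hl)⟩ : Fin (N + 1))
        = (⟨l, Nat.lt_of_succ_lt hl⟩ : Fin N).castSucc := rfl
      have h6 : (⟨l + 1, Nat.lt_succ_of_lt hl⟩ : Fin (N + 1))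
        = (⟨l + 1, hl⟩ : Fin N).castSucc := rfl
      rw [h5, h6, Fin.snoc_castSucc, Fin.snoc_castSucc] at this
      exact this
  have htop : ⨆ m, H m = ⊤ := by
    rw [eq_top_iff]
    intro s _
    obtain ⟨r, rfl⟩ := c.pS_surj s
    exact hall r
  exact (le_of_indep 𝒜S H hS.indep (fun c => inf_le_left) htop m hs).2

variable {M Xb : Type}
    [AddCommGroup M] [Module k M] [Module S M] [IsScalarTower k S M]
    [AddCommGroup Xb] [Module k Xb] [Module S Xb] [IsScalarTower k S Xb]

theorem mem_otGr {d d' m : ℤ} (grM : ℤ → Submodule k M) {b : B'} {v : M} (hb : b ∈ 𝒜B d)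
    (hv : v ∈ grM d') (h : d + d' = m) : om M c.φ b v ∈ otGr k S B' M c.φ 𝒜B grM m :=
  Submodule.subset_span ⟨d, d', b, v, h, hb, hv, rfl⟩

variable {c}

theorem GG_gr2 (x : XDat C c M Xb) (hB : GrP c.pB 𝒜B) (grM : ℤ → Submodule k M) (m : ℤ)
    (jj : Fin a) (v : M) (hv : v ∈ grM (m - 2 * C.d i * (jj : ℤ))) :
    GG x (0, Pi.single jj v) ∈ otGr k S B' M c.φ 𝒜B grM m := by
  rw [GG_apply, map_zero, zero_add, Finset.sum_eq_single jj]
  · rw [Pi.single_eq_same]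
    exact mem_otGr c grM (hB.degXE i jj) hv (by ring)
  · intro q _ h
    rw [Pi.single_eq_of_ne h, map_zero]
  · simp

theorem GG_nat {M' Xb' : Type}
    [AddCommGroup M'] [Module k M'] [Module S M'] [IsScalarTower k S M']
    [AddCommGroup Xb'] [Module k Xb'] [Module S Xb'] [IsScalarTower k S Xb']
    (x : XDat C c M Xb) (x' : XDat C c M' Xb') (f : M → M')
    (gF : OT k S B' M c.φ →ₗ[k] OT k S B' M' c.φ)
    (hF : ∀ b m, gF (om M c.φ b m) = om M' c.φ b (f m)) (g : Xb → Xb')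
    (hg : ∀ ξ, x'.gam (g ξ) = gF (x.gam ξ)) (ξ : Xb) (m : Fin a → M) :
    GG x' (g ξ, fun j => f (m j)) = gF (GG x (ξ, m)) := by
  rw [GG_apply, GG_apply, map_add, map_sum, hg]
  simp only [hF]

end Phi

section Xd
variable {L : I → ℕ} {n : ℕ} {i : I} {a : ℕ} {S B' : Type} [Ring S] [Algebra k S]
    [Ring B'] [Algebra k B'] {c : Ctx C L (n + 1) i a S B'} {𝒜S : ℤ → Submodule k S}
    {𝒜B : ℤ → Submodule k B'} {T' : Type} [Ring T'] [Algebra k T']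
    {φd : T' →ₙₐ[k] S} {pT : RA C n →ₐ[k] T'} {M : Type}
    [AddCommGroup M] [Module k M] [Module S M] [IsScalarTower k S M] {e : S}
    [Module T' ↥(eSub k S M e)] [IsScalarTower k T' ↥(eSub k S M e)]

theorem GG_gr1 (he : e = c.pS (E C n i))
    (hT : ∀ r, φd (pT r) = c.pS (up C n r * E C n i)) (hTs : Function.Surjective pT)
    (hc : ∀ (r : T') (y : ↥(eSub k S M e)), ((r • y : ↥(eSub k S M e)) : M) = φd r • (y : M))
    (hS : GrP c.pS 𝒜S) (hB : GrP c.pB 𝒜B) (grM : ℤ → Submodule k M) (m : ℤ)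
    (y : OT k T' S ↥(eSub k S M e) φd)
    (hy : y ∈ otGr k T' S ↥(eSub k S M e) φd 𝒜S (eSubGr k S M e grM) (m + 2 * C.d i)) :
    GG (xdat c φd pT M e he hT hTs hc) (y, 0) ∈ otGr k S B' M c.φ 𝒜B grM m := by
  have hE : E C n i * E C n i = E C n i := by rw [E_E, if_pos rfl]
  have hE' : E C (n + 1) i * E C (n + 1) i = E C (n + 1) i := by rw [E_E, if_pos rfl]
  have h0 : ∀ z, GG (xdat c φd pT M e he hT hTs hc) (z, 0) = gamX c φd pT M e he hT hTs hc z := by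
    intro z
    rw [GG_apply]
    simp only [Pi.zero_apply, map_zero, Finset.sum_const_zero, add_zero]
    rfl
  rw [h0]
  induction hy using Submodule.span_induction with
  | mem z hz =>
    obtain ⟨d, d', b, v, hd, hb, hv, rfl⟩ := hz
    rw [← om_apply, gamX_om]
    have hv' : (v : M) = c.pS (E C n i) • (v : M) := by
      obtain ⟨w, hw⟩ := v.2
      rw [← hw]
      change e • w = _ • e • w
      rw [← he, ← mul_smul, he, ← map_mul, hE]
    rw [hv', ← om_bal, c.hφ, mul_assoc, ← map_mul]
    have h1 : T C n * E C (n + 1) i * (up C (n + 1) (E C n i) * E C (n + 1) i)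
        = T C n * (up C (n + 1) (E C n i) * E C (n + 1) i) := by
      rw [mul_assoc, ← mul_assoc (E C (n + 1) i), (cEu C i (E C n i)).eq, mul_assoc, hE']
    rw [h1]
    refine mem_otGr c grM (hB.mul (phi_gr c hS hB d b hb) (hB.degTE i)) hv ?_
    omega
  | zero => rw [map_zero]; exact Submodule.zero_mem _
  | add x y _ _ hx hy => rw [map_add]; exact Submodule.add_mem _ hx hy
  | smul q x _ hx => rw [map_smul]; exact Submodule.smul_mem _ _ hx

theorem gam_nat {M' : Type}
    [AddCommGroup M'] [Module k M'] [Module S M'] [IsScalarTower k S M']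
    [Module T' ↥(eSub k S M' e)] [IsScalarTower k T' ↥(eSub k S M' e)]
    (he : e = c.pS (E C n i))
    (hT : ∀ r, φd (pT r) = c.pS (up C n r * E C n i)) (hTs : Function.Surjective pT)
    (hc : ∀ (r : T') (y : ↥(eSub k S M e)), ((r • y : ↥(eSub k S M e)) : M) = φd r • (y : M))
    (hc' : ∀ (r : T') (y : ↥(eSub k S M' e)), ((r • y : ↥(eSub k S M' e)) : M') = φd r • (y : M'))
    (f : M → M')
    (gF : OT k S B' M c.φ →ₗ[k] OT k S B' M' c.φ)
    (hF : ∀ b m, gF (om M c.φ b m) = om M' c.φ b (f m))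
    (gE : ↥(eSub k S M e) →ₗ[k] ↥(eSub k S M' e)) (hE : ∀ x, (gE x).val = f x.val)
    (gFE : OT k T' S ↥(eSub k S M e) φd →ₗ[k] OT k T' S ↥(eSub k S M' e) φd)
    (hFE : ∀ b x, gFE (om _ φd b x) = om _ φd b (gE x))
    (ξ : OT k T' S ↥(eSub k S M e) φd) :
    (xdat c φd pT M' e he hT hTs hc').gam (gFE ξ) = gF ((xdat c φd pT M e he hT hTs hc).gam ξ) := by
  change gamX c φd pT M' e he hT hTs hc' (gFE ξ) = gF (gamX c φd pT M e he hT hTs hc ξ)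
  refine OT_ind φd (p := fun ξ => gamX c φd pT M' e he hT hTs hc' (gFE ξ)
    = gF (gamX c φd pT M e he hT hTs hc ξ)) ?_ ?_ ?_ ξ
  · intro b v
    rw [hFE, gamX_om, gamX_om, hF, hE]
  · rw [map_zero, map_zero, map_zero, map_zero]
  · intro x y hx hy
    rw [map_add, map_add, hx, hy, map_add, map_add]
end Xd

end KLR

namespace KLR
open scoped TensorProduct
variable {k : Type} [Field k] {I : Type} [Fintype I] [DecidableEq I] {C : CartanDatum k I}

section Nat
variable {L : I → ℕ} {N : ℕ} {i : I} {a : ℕ} {S B' : Type} [Ring S] [Algebra k S]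
    [Ring B'] [Algebra k B'] {c : Ctx C L N i a S B'} {M Xb : Type}
    [AddCommGroup M] [Module k M] [Module S M] [IsScalarTower k S M]
    [AddCommGroup Xb] [Module k Xb] [Module S Xb] [IsScalarTower k S Xb]

theorem PhiE_nat {M' Xb' : Type}
    [AddCommGroup M'] [Module k M'] [Module S M'] [IsScalarTower k S M']
    [AddCommGroup Xb'] [Module k Xb'] [Module S Xb'] [IsScalarTower k S Xb']
    (x : XDat C c M Xb) (x' : XDat C c M' Xb') (e : B') (he : e = c.pB (E C N i))
    (d : EData k (OT k S B' M c.φ) e c.φ) (d' : EData k (OT k S B' M' c.φ) e c.φ) (f : M → M')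
    (gF : OT k S B' M c.φ →ₗ[k] OT k S B' M' c.φ)
    (hF : ∀ b m, gF (om M c.φ b m) = om M' c.φ b (f m)) (g : Xb → Xb')
    (hg : ∀ ξ, x'.gam (g ξ) = gF (x.gam ξ))
    (gEF : ↥(eSub k B' (OT k S B' M c.φ) e) → ↥(eSub k B' (OT k S B' M' c.φ) e))
    (hEF : ∀ z, (gEF z).val = gF z.val) (z : ↥(eSub k B' (OT k S B' M c.φ) e)) :
    letI := d.inst
    letI := d'.inst
    PhiE x' e he d' (gEF z)
      = (g (PhiE x e he d z).1, fun j => f ((PhiE x e he d z).2 j)) := by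
  letI := d.inst
  letI := d'.inst
  obtain ⟨w, rfl⟩ := (PhiE x e he d).symm.surjective z
  rw [LinearEquiv.apply_symm_apply, ← LinearEquiv.eq_symm_apply]
  apply Subtype.ext
  rw [hEF]
  exact (GG_nat x x' f gF hF g hg w.1 w.2).symm

end Nat

theorem pairH_zero {β : I → ℕ} (h : ht I β = 0) (i : I) : pairH C i β = 0 := by
  unfold ht at h
  rw [Finset.sum_eq_zero_iff] at h
  unfold pairH
  refine Finset.sum_eq_zero fun j hj => ?_
  rw [h j hj]
  simp

theorem addA_subA {n : ℕ} {β : I → ℕ} {i : I} (ν : Fin (n + 1) → I) (h : ν ∈ seqs β (n + 1))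
    (hl : ν (Fin.last n) = i) : addA (subA β i) i = β := by
  rw [mem_seqs, content_snoc, hl] at h
  subst h
  funext j
  simp only [addA, subA]
  split_ifs <;> omega

end KLR

open KLR TensorProduct in
set_option maxHeartbeats 1000000 in
/-- Let `a = ⟨h_i, Λ⟩ - ⟨h_i, β⟩ ≥ 0`.  For every graded `R^Λ(β)`-module `M` there is a
natural isomorphism of graded `R^Λ(β)`-modules
`q_i^{-2} F_i^Λ E_i^Λ M ⊕ (⊕_{c=0}^{a-1} q_i^{2c} M) ≅ E_i^Λ F_i^Λ M`; when `β = 0`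
the term `F_i^Λ E_i^Λ M` is zero. -/
theorem EiFiLambda_decomposition_nonneg {k : Type} [Field k] {I : Type} [Fintype I]
    [DecidableEq I] (C : CartanDatum k I) (Λ : I → ℕ) (β : I → ℕ) (i : I)
    (ha : 0 ≤ (Λ i : ℤ) - pairH C i β) :
    -- the case `β = 0`
    (ht I β = 0 →
      ∀ (φ0 : cAlg C Λ 0 β →ₙₐ[k] cAlg C Λ 1 (addA β i)), IsUpRc C Λ i φ0 →
      ∀ (𝒜S : ℤ → Submodule k (cAlg C Λ 0 β)), IsKLRGrading C (toCB C Λ) 𝒜S →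
      ∀ (𝒜B : ℤ → Submodule k (cAlg C Λ 1 (addA β i))), IsKLRGrading C (toCB C Λ) 𝒜B →
      ∃ Φ : ∀ (M : Type) [AddCommGroup M] [Module k M] [Module (cAlg C Λ 0 β) M]
          [IsScalarTower k (cAlg C Λ 0 β) M]
          (d : EData k (OT k (cAlg C Λ 0 β) (cAlg C Λ 1 (addA β i)) M φ0)
            (eDc C Λ 1 (addA β i) i) φ0),
          (letI := d.inst;
            (↥(eSub k (cAlg C Λ 1 (addA β i))
                (OT k (cAlg C Λ 0 β) (cAlg C Λ 1 (addA β i)) M φ0)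
                (eDc C Λ 1 (addA β i) i))
              ≃ₗ[cAlg C Λ 0 β] (Fin (Λ i) → M))),
        (∀ (M : Type) (_ : AddCommGroup M) (_ : Module k M)
          (_ : Module (cAlg C Λ 0 β) M) (_ : IsScalarTower k (cAlg C Λ 0 β) M)
          (d : EData k (OT k (cAlg C Λ 0 β) (cAlg C Λ 1 (addA β i)) M φ0)
            (eDc C Λ 1 (addA β i) i) φ0),
          letI := d.inst;
          ∀ (grM : ℤ → Submodule k M), IsModGrading k 𝒜S grM →
          ∀ (m : ℤ) (jj : Fin (Λ i)) (x : M), x ∈ grM (m - 2 * C.d i * (jj : ℤ)) →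
            (Φ M d).symm (Pi.single jj x)
              ∈ eSubGr k (cAlg C Λ 1 (addA β i))
                (OT k (cAlg C Λ 0 β) (cAlg C Λ 1 (addA β i)) M φ0)
                (eDc C Λ 1 (addA β i) i)
                (otGr k (cAlg C Λ 0 β) (cAlg C Λ 1 (addA β i)) M φ0 𝒜B grM) m) ∧
        (∀ (M M' : Type) (_ : AddCommGroup M) (_ : Module k M)
          (_ : Module (cAlg C Λ 0 β) M) (_ : IsScalarTower k (cAlg C Λ 0 β) M)
          (_ : AddCommGroup M') (_ : Module k M') (_ : Module (cAlg C Λ 0 β) M')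
          (_ : IsScalarTower k (cAlg C Λ 0 β) M')
          (d : EData k (OT k (cAlg C Λ 0 β) (cAlg C Λ 1 (addA β i)) M φ0)
            (eDc C Λ 1 (addA β i) i) φ0)
          (d' : EData k (OT k (cAlg C Λ 0 β) (cAlg C Λ 1 (addA β i)) M' φ0)
            (eDc C Λ 1 (addA β i) i) φ0),
          letI := d.inst; letI := d'.inst;
          ∀ (f : M →ₗ[cAlg C Λ 0 β] M')
            (gF : OT k (cAlg C Λ 0 β) (cAlg C Λ 1 (addA β i)) M φ0 →ₗ[k]
              OT k (cAlg C Λ 0 β) (cAlg C Λ 1 (addA β i)) M' φ0),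
            (∀ (b : cAlg C Λ 1 (addA β i)) (m : M),
              gF (OTmk k (cAlg C Λ 0 β) (cAlg C Λ 1 (addA β i)) M φ0 (b ⊗ₜ[k] m))
                = OTmk k (cAlg C Λ 0 β) (cAlg C Λ 1 (addA β i)) M' φ0 (b ⊗ₜ[k] f m)) →
          ∀ (gEF : ↥(eSub k (cAlg C Λ 1 (addA β i))
              (OT k (cAlg C Λ 0 β) (cAlg C Λ 1 (addA β i)) M φ0)
              (eDc C Λ 1 (addA β i) i)) →ₗ[k]
              ↥(eSub k (cAlg C Λ 1 (addA β i))
              (OT k (cAlg C Λ 0 β) (cAlg C Λ 1 (addA β i)) M' φ0)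
              (eDc C Λ 1 (addA β i) i))),
            (∀ x, (gEF x).val = gF x.val) →
            ∀ z, Φ M' d' (gEF z) = fun jj => f (Φ M d z jj))) ∧
    -- the case of `β` of positive height
    (∀ n : ℕ, ht I β = n + 1 →
      ∀ (φup : cAlg C Λ (n + 1) β →ₙₐ[k] cAlg C Λ (n + 2) (addA β i)),
        IsUpRc C Λ i φup →
      ∀ (φdown : cAlg C Λ n (subA β i) →ₙₐ[k] cAlg C Λ (n + 1) β),
        IsUpRc C Λ i φdown →
      ∀ (𝒜S : ℤ → Submodule k (cAlg C Λ (n + 1) β)), IsKLRGrading C (toCB C Λ) 𝒜S →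
      ∀ (𝒜B : ℤ → Submodule k (cAlg C Λ (n + 2) (addA β i))),
        IsKLRGrading C (toCB C Λ) 𝒜B →
      ∀ (𝒜T : ℤ → Submodule k (cAlg C Λ n (subA β i))), IsKLRGrading C (toCB C Λ) 𝒜T →
      ∃ Φ : ∀ (M : Type) [AddCommGroup M] [Module k M] [Module (cAlg C Λ (n + 1) β) M]
          [IsScalarTower k (cAlg C Λ (n + 1) β) M]
          (d1 : EData k M (eDc C Λ (n + 1) β i) φdown)
          (d2 : EData k (OT k (cAlg C Λ (n + 1) β) (cAlg C Λ (n + 2) (addA β i)) M φup)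
            (eDc C Λ (n + 2) (addA β i) i) φup),
          (letI := d1.inst; letI := d1.tower; letI := d2.inst;
            (↥(eSub k (cAlg C Λ (n + 2) (addA β i))
                (OT k (cAlg C Λ (n + 1) β) (cAlg C Λ (n + 2) (addA β i)) M φup)
                (eDc C Λ (n + 2) (addA β i) i))
              ≃ₗ[cAlg C Λ (n + 1) β]
              ((OT k (cAlg C Λ n (subA β i)) (cAlg C Λ (n + 1) β)
                  ↥(eSub k (cAlg C Λ (n + 1) β) M (eDc C Λ (n + 1) β i)) φdown) ×
                (Fin ((Λ i : ℤ) - pairH C i β).toNat → M)))),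
        -- gradedness
        (∀ (M : Type) (_ : AddCommGroup M) (_ : Module k M)
          (_ : Module (cAlg C Λ (n + 1) β) M)
          (_ : IsScalarTower k (cAlg C Λ (n + 1) β) M)
          (d1 : EData k M (eDc C Λ (n + 1) β i) φdown)
          (d2 : EData k (OT k (cAlg C Λ (n + 1) β) (cAlg C Λ (n + 2) (addA β i)) M φup)
            (eDc C Λ (n + 2) (addA β i) i) φup),
          letI := d1.inst; letI := d1.tower; letI := d2.inst;
          ∀ (grM : ℤ → Submodule k M), IsModGrading k 𝒜S grM →
          ∀ m : ℤ,
            (∀ y, y ∈ otGr k (cAlg C Λ n (subA β i)) (cAlg C Λ (n + 1) β)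
                ↥(eSub k (cAlg C Λ (n + 1) β) M (eDc C Λ (n + 1) β i)) φdown 𝒜S
                (eSubGr k (cAlg C Λ (n + 1) β) M (eDc C Λ (n + 1) β i) grM)
                (m + 2 * C.d i) →
              (Φ M d1 d2).symm (y, 0) ∈ eSubGr k (cAlg C Λ (n + 2) (addA β i))
                (OT k (cAlg C Λ (n + 1) β) (cAlg C Λ (n + 2) (addA β i)) M φup)
                (eDc C Λ (n + 2) (addA β i) i)
                (otGr k (cAlg C Λ (n + 1) β) (cAlg C Λ (n + 2) (addA β i)) M φup 𝒜B
                  grM) m) ∧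
            (∀ (jj : Fin ((Λ i : ℤ) - pairH C i β).toNat) (x : M),
              x ∈ grM (m - 2 * C.d i * (jj : ℤ)) →
              (Φ M d1 d2).symm (0, Pi.single jj x)
                ∈ eSubGr k (cAlg C Λ (n + 2) (addA β i))
                  (OT k (cAlg C Λ (n + 1) β) (cAlg C Λ (n + 2) (addA β i)) M φup)
                  (eDc C Λ (n + 2) (addA β i) i)
                  (otGr k (cAlg C Λ (n + 1) β) (cAlg C Λ (n + 2) (addA β i)) M φup 𝒜B
                    grM) m)) ∧
        -- naturality in `M`
        (∀ (M M' : Type) (_ : AddCommGroup M) (_ : Module k M)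
          (_ : Module (cAlg C Λ (n + 1) β) M)
          (_ : IsScalarTower k (cAlg C Λ (n + 1) β) M)
          (_ : AddCommGroup M') (_ : Module k M')
          (_ : Module (cAlg C Λ (n + 1) β) M')
          (_ : IsScalarTower k (cAlg C Λ (n + 1) β) M')
          (d1 : EData k M (eDc C Λ (n + 1) β i) φdown)
          (d2 : EData k (OT k (cAlg C Λ (n + 1) β) (cAlg C Λ (n + 2) (addA β i)) M φup)
            (eDc C Λ (n + 2) (addA β i) i) φup)
          (d1' : EData k M' (eDc C Λ (n + 1) β i) φdown)
          (d2' : EData k (OT k (cAlg C Λ (n + 1) β) (cAlg C Λ (n + 2) (addA β i)) M'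
              φup) (eDc C Λ (n + 2) (addA β i) i) φup),
          letI := d1.inst; letI := d1.tower; letI := d2.inst;
          letI := d1'.inst; letI := d1'.tower; letI := d2'.inst;
          ∀ (f : M →ₗ[cAlg C Λ (n + 1) β] M')
            (gF : OT k (cAlg C Λ (n + 1) β) (cAlg C Λ (n + 2) (addA β i)) M φup →ₗ[k]
              OT k (cAlg C Λ (n + 1) β) (cAlg C Λ (n + 2) (addA β i)) M' φup),
            (∀ (b : cAlg C Λ (n + 2) (addA β i)) (m : M),
              gF (OTmk k (cAlg C Λ (n + 1) β) (cAlg C Λ (n + 2) (addA β i)) M φup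
                  (b ⊗ₜ[k] m))
                = OTmk k (cAlg C Λ (n + 1) β) (cAlg C Λ (n + 2) (addA β i)) M' φup
                  (b ⊗ₜ[k] f m)) →
          ∀ (gEF : ↥(eSub k (cAlg C Λ (n + 2) (addA β i))
              (OT k (cAlg C Λ (n + 1) β) (cAlg C Λ (n + 2) (addA β i)) M φup)
              (eDc C Λ (n + 2) (addA β i) i)) →ₗ[k]
              ↥(eSub k (cAlg C Λ (n + 2) (addA β i))
              (OT k (cAlg C Λ (n + 1) β) (cAlg C Λ (n + 2) (addA β i)) M' φup)
              (eDc C Λ (n + 2) (addA β i) i))),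
            (∀ x, (gEF x).val = gF x.val) →
          ∀ (gE : ↥(eSub k (cAlg C Λ (n + 1) β) M (eDc C Λ (n + 1) β i)) →ₗ[k]
              ↥(eSub k (cAlg C Λ (n + 1) β) M' (eDc C Λ (n + 1) β i))),
            (∀ x, (gE x).val = f x.val) →
          ∀ (gFE : OT k (cAlg C Λ n (subA β i)) (cAlg C Λ (n + 1) β)
              ↥(eSub k (cAlg C Λ (n + 1) β) M (eDc C Λ (n + 1) β i)) φdown →ₗ[k]
              OT k (cAlg C Λ n (subA β i)) (cAlg C Λ (n + 1) β)
              ↥(eSub k (cAlg C Λ (n + 1) β) M' (eDc C Λ (n + 1) β i)) φdown),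
            (∀ (b : cAlg C Λ (n + 1) β)
                (x : ↥(eSub k (cAlg C Λ (n + 1) β) M (eDc C Λ (n + 1) β i))),
              gFE (OTmk k (cAlg C Λ n (subA β i)) (cAlg C Λ (n + 1) β)
                  ↥(eSub k (cAlg C Λ (n + 1) β) M (eDc C Λ (n + 1) β i)) φdown
                  (b ⊗ₜ[k] x))
                = OTmk k (cAlg C Λ n (subA β i)) (cAlg C Λ (n + 1) β)
                  ↥(eSub k (cAlg C Λ (n + 1) β) M' (eDc C Λ (n + 1) β i)) φdown
                  (b ⊗ₜ[k] gE x)) →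
            ∀ z, Φ M' d1' d2' (gEF z)
              = (gFE (Φ M d1 d2 z).1, fun jj => f ((Φ M d1 d2 z).2 jj)))) := by
  refine ⟨fun hβ φ0 hφ0 𝒜S hS 𝒜B hB => ?_,
    fun n hn φup hup φdown hdown 𝒜S hS 𝒜B hB 𝒜T _ => ?_⟩
  · let c := mkCtx C Λ 0 β i (Λ i) (by rw [pairH_zero hβ, sub_zero]) φ0 hφ0
    refine ⟨fun M _ _ _ _ d => letI := d.inst
      (PhiE (xdat0 c M) _ (eDc_eq C Λ 0 (addA β i) i) d).trans LinearEquiv.uniqueProd, ?_, ?_⟩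
    · intro M _ _ _ _ d grM _ m jj x hx
      exact GG_gr2 (xdat0 c M) hB grM m jj x hx
    · intro M M' _ _ _ _ _ _ _ _ d d' f gF hF gEF hEF z
      have := PhiE_nat (xdat0 c M) (xdat0 c M') _ (eDc_eq C Λ 0 (addA β i) i) d d' f gF hF
        (fun _ => PUnit.unit) (fun ξ => (map_zero gF).symm) gEF hEF z
      exact congrArg Prod.snd this
  · let c := mkCtx C Λ (n + 1) β i ((Λ i : ℤ) - pairH C i β).toNat (Int.toNat_of_nonneg ha) φup hup
    have hT := hphi C Λ φdown hdown (fun ν h hl => addA_subA ν h hl)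
    have hTs := pC_surj C Λ n (subA β i)
    have he := eDc_eq C Λ n β i
    refine ⟨fun M _ _ _ _ d1 d2 => letI := d1.inst; letI := d1.tower; letI := d2.inst
      PhiE (xdat c φdown (pC C Λ n (subA β i)) M _ he hT hTs d1.compat) _
        (eDc_eq C Λ (n + 1) (addA β i) i) d2, ?_, ?_⟩
    · intro M _ _ _ _ d1 d2 grM _ m
      letI := d1.inst
      letI := d1.tower
      refine ⟨fun y hy => ?_, fun jj x hx => ?_⟩
      · exact GG_gr1 (c := c) he hT hTs d1.compat hS hB grM m y hy
      · exact GG_gr2 (xdat c φdown (pC C Λ n (subA β i)) M _ he hT hTs d1.compat)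
          hB grM m jj x hx
    · intro M M' _ _ _ _ _ _ _ _ d1 d2 d1' d2' f gF hF gEF hEF gE hE gFE hFE z
      letI := d1.inst
      letI := d1.tower
      letI := d1'.inst
      letI := d1'.tower
      exact PhiE_nat (xdat c φdown (pC C Λ n (subA β i)) M _ he hT hTs d1.compat)
        (xdat c φdown (pC C Λ n (subA β i)) M' _ he hT hTs d1'.compat) _
        (eDc_eq C Λ (n + 1) (addA β i) i) d2 d2' f gF hF gFE
        (gam_nat (c := c) he hT hTs d1.compat d1'.compat f gF hF gE hE gFE hFE) gEF hEF z
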